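/- arXiv:1809.09232 — 2 statements merged into one kernel-verified Lean document; each statement's English description precedes it below -/
import Mathlib

section
/- Let H be a graph that is 3-connected or isomorphic to K_3 and let q ≥ 3 be an integer. Then for every natural number k there exists a graph G that is q-Ramsey-minimal for H and has maximum degree at least k and chromatic number at least k. -/
open SimpleGraph

/-- The colouring `c` contains a copy of `H` in `G` all of whose edges have colour `i`. -/
def HasMonoCopyColor {V W : Type*} (G : SimpleGraph V) (H : SimpleGraph W) {q : ℕ}
    (c : Sym2 V → Fin q) (i : Fin q) : Prop :=
  ∃ f : W ↪ V, ∀ a b, H.Adj a b → G.Adj (f a) (f b) ∧ c s(f a, f b) = i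

/-- The colouring `c` contains a monochromatic copy of `H` in `G`. -/
def HasMonoCopy {V W : Type*} (G : SimpleGraph V) (H : SimpleGraph W) {q : ℕ}
    (c : Sym2 V → Fin q) : Prop :=
  ∃ i : Fin q, HasMonoCopyColor G H c i

/-- `G` is `q`-Ramsey for `H`: every `q`-colouring of the edges of `G` contains a
monochromatic copy of `H`. -/
def IsRamsey (q : ℕ) {V W : Type*} (G : SimpleGraph V) (H : SimpleGraph W) : Prop :=
  ∀ c : Sym2 V → Fin q, HasMonoCopy G H c

/-- `G` is `q`-Ramsey-minimal for `H`: `G` is `q`-Ramsey for `H` but no proper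
subgraph of `G` is. -/
def IsRamseyMinimal (q : ℕ) {V W : Type*} (G : SimpleGraph V) (H : SimpleGraph W) : Prop :=
  IsRamsey q G H ∧ ∀ G' : G.Subgraph, G' ≠ ⊤ → ¬ IsRamsey q G'.coe H

/-- `H` is 3-connected: it has at least 4 vertices and deleting any set of at most
2 vertices leaves a connected graph. -/
def ThreeConnected {V : Type*} [Fintype V] (H : SimpleGraph V) : Prop :=
  4 ≤ Fintype.card V ∧
    ∀ S : Finset V, S.card ≤ 2 → (H.induce ((↑S : Set V)ᶜ)).Connected

/-- `H` is 3-connected or isomorphic to `K₃`. -/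
def ThreeConnOrK3 {V : Type*} [Fintype V] (H : SimpleGraph V) : Prop :=
  ThreeConnected H ∨ Nonempty (H ≃g (⊤ : SimpleGraph (Fin 3)))

section

open Finset

/-- The union of the images of the maps `ω j` with `j ∈ F`. -/
def imgUnion {J I X : Type} [Fintype I] [DecidableEq X] (ω : J → I → X) (F : Finset J) :
    Finset X :=
  F.biUnion fun j => univ.image (ω j)

theorem mem_imgUnion {J I X : Type} [Fintype I] [DecidableEq X] {ω : J → I → X} {F : Finset J}
    {x : X} : x ∈ imgUnion ω F ↔ ∃ j ∈ F, ∃ i, ω j i = x := by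
  simp [imgUnion]

theorem card_small_imgUnion_le {J I X : Type} [Fintype I] [Fintype J] [Fintype X] [DecidableEq J]
    [DecidableEq I] [DecidableEq X] [Nonempty X] (F : Finset J) {s : ℕ} (hs : 0 < s) :
    #{ω : J → I → X | #(imgUnion ω F) ≤ s} ≤
      Fintype.card X ^ s * ((s ^ Fintype.card I) ^ #F *
        (Fintype.card X ^ Fintype.card I) ^ (Fintype.card J - #F)) := by
  have hc : Fintype.card ((Fin s → X) × (F → I → Fin s) × ((Fᶜ : Finset J) → I → X)) =
      Fintype.card X ^ s * ((s ^ Fintype.card I) ^ #F *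
        (Fintype.card X ^ Fintype.card I) ^ (Fintype.card J - #F)) := by
    simp
  rw [← hc, ← Finset.card_univ]
  let Φ : (Fin s → X) × (F → I → Fin s) × ((Fᶜ : Finset J) → I → X) → J → I → X :=
    fun p j i => if h : j ∈ F then p.1 (p.2.1 ⟨j, h⟩ i) else p.2.2 ⟨j, by simpa using h⟩ i
  refine (Finset.card_le_card ?_).trans (Finset.card_image_le (f := Φ))
  intro ω hω
  simp only [mem_filter, mem_univ, true_and] at hω
  obtain ⟨e, he⟩ : ∃ e : Fin s → X, ∀ x ∈ imgUnion ω F, ∃ t, e t = x := by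
    have : Nonempty (Fin s) := ⟨⟨0, hs⟩⟩
    obtain ⟨g⟩ : Nonempty (imgUnion ω F ↪ Fin s) := by
      apply Function.Embedding.nonempty_of_card_le
      simpa using hω
    refine ⟨fun t => if h : ∃ x, g x = t then (h.choose : X) else Classical.arbitrary X, ?_⟩
    intro x hx
    refine ⟨g ⟨x, hx⟩, ?_⟩
    have h : ∃ x', g x' = g ⟨x, hx⟩ := ⟨_, rfl⟩
    simp only [h, dif_pos]
    rw [g.injective h.choose_spec]
  have hw : ∀ (j : F) (i : I), ∃ t, e t = ω j i := fun j i =>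
    he _ (mem_imgUnion.2 ⟨j, j.2, i, rfl⟩)
  choose w hw using hw
  refine Finset.mem_image.2 ⟨(e, w, fun j i => ω j i), mem_univ _, ?_⟩
  funext j i
  by_cases h : j ∈ F <;> simp [Φ, h, hw]

theorem card_small_imgUnion_mul_le {J I X : Type} [Fintype I] [Fintype J] [Fintype X]
    [DecidableEq J] [DecidableEq I] [DecidableEq X] [Nonempty X] (F : Finset J) (hF : F.Nonempty)
    (hI : 2 ≤ Fintype.card I) :
    #{ω : J → I → X | #(imgUnion ω F) ≤ (Fintype.card I - 1) * #F} * Fintype.card X ^ #F ≤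
      ((Fintype.card I - 1) * #F) ^ (Fintype.card I * #F) * Fintype.card (J → I → X) := by
  have hs : 0 < (Fintype.card I - 1) * #F := Nat.mul_pos (by omega) hF.card_pos
  refine (Nat.mul_le_mul_right _ (card_small_imgUnion_le F hs)).trans (le_of_eq ?_)
  obtain ⟨m, hm⟩ : ∃ m, Fintype.card I = m + 1 := ⟨Fintype.card I - 1, by omega⟩
  obtain ⟨r, hr⟩ : ∃ r, Fintype.card J = #F + r :=
    ⟨Fintype.card J - #F, by have := F.card_le_univ; omega⟩
  simp only [Fintype.card_fun, hm, hr, Nat.add_sub_cancel, Nat.add_sub_cancel_left]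
  ring

theorem card_powersetCard_le (M f : ℕ) : #(powersetCard f (univ : Finset (Fin M))) ≤ M ^ f := by
  rw [card_powersetCard, card_univ, Fintype.card_fin]
  exact Nat.choose_le_pow M f

theorem sum_card_bad_le {I : Type} [Fintype I] [DecidableEq I] (hI : 2 ≤ Fintype.card I)
    (g L N : ℕ) (hN : 0 < N) :
    ∑ ω : Fin (L * N) → I → Fin N,
      #{F : Finset (Fin (L * N)) | F.Nonempty ∧ #F ≤ g ∧
        #(imgUnion ω F) ≤ (Fintype.card I - 1) * #F} ≤
    (∑ f ∈ Icc 1 g, L ^ f * ((Fintype.card I - 1) * f) ^ (Fintype.card I * f)) *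
      Fintype.card (Fin (L * N) → I → Fin N) := by
  have : Nonempty (Fin N) := ⟨⟨0, hN⟩⟩
  set Ω := Fin (L * N) → I → Fin N
  have h1 : ∀ ω : Ω, #{F : Finset (Fin (L * N)) | F.Nonempty ∧ #F ≤ g ∧
        #(imgUnion ω F) ≤ (Fintype.card I - 1) * #F} ≤
      ∑ f ∈ Icc 1 g, ∑ F ∈ powersetCard f univ,
        if #(imgUnion ω F) ≤ (Fintype.card I - 1) * #F then 1 else 0 := by
    intro ω
    simp only [← Finset.card_filter]
    refine (Finset.card_le_card ?_).trans (Finset.card_biUnion_le (s := Icc 1 g)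
      (t := fun f => {F ∈ powersetCard f (univ : Finset (Fin (L * N))) |
        #(imgUnion ω F) ≤ (Fintype.card I - 1) * #F}))
    intro F hF
    simp only [mem_filter, mem_univ, true_and] at hF
    simp only [mem_biUnion, mem_Icc, mem_filter, mem_powersetCard, subset_univ, true_and]
    exact ⟨#F, ⟨hF.1.card_pos, hF.2.1⟩, rfl, hF.2.2⟩
  refine (Finset.sum_le_sum fun ω _ => h1 ω).trans ?_
  rw [Finset.sum_comm, Finset.sum_mul]
  refine Finset.sum_le_sum fun f hf => ?_
  rw [Finset.sum_comm]
  simp only [← Finset.card_filter]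
  have hNf : 0 < N ^ f := by positivity
  refine Nat.le_of_mul_le_mul_right ?_ hNf
  rw [Finset.sum_mul]
  have h2 : ∀ F ∈ powersetCard f (univ : Finset (Fin (L * N))),
      #{ω : Ω | #(imgUnion ω F) ≤ (Fintype.card I - 1) * #F} * N ^ f ≤
        ((Fintype.card I - 1) * f) ^ (Fintype.card I * f) * Fintype.card Ω := by
    intro F hF
    have hFf := (mem_powersetCard.1 hF).2
    have hne : F.Nonempty := by
      rw [← Finset.card_pos, hFf]; exact (mem_Icc.1 hf).1
    have := card_small_imgUnion_mul_le (X := Fin N) F hne hI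
    rw [hFf, Fintype.card_fin] at this
    rw [hFf]
    exact this
  refine (Finset.sum_le_card_nsmul _ _ _ h2).trans ?_
  rw [smul_eq_mul]
  refine (Nat.mul_le_mul_right _ (card_powersetCard_le _ _)).trans (le_of_eq ?_)
  rw [mul_pow]; ring

theorem pow_card_le_card_const {I : Type} [Fintype I] [DecidableEq I] [Nonempty I] (q N' : ℕ)
    (hq : 0 < q) (φ : Fin (q * N') → Fin q) :
    N' ^ Fintype.card I ≤ #{t : I → Fin (q * N') | ∀ i i', φ (t i) = φ (t i')} := by
  have : Nonempty (Fin q) := ⟨⟨0, hq⟩⟩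
  obtain ⟨a, ha⟩ : ∃ a, N' ≤ #{x | φ x = a} := by
    have := Fintype.exists_le_card_fiber_of_mul_le_card (f := φ) (n := N') (by simp)
    simpa using this
  refine (Nat.pow_le_pow_left ha _).trans ?_
  rw [← Finset.card_univ, ← Finset.prod_const, ← Fintype.card_piFinset]
  refine Finset.card_le_card fun t ht => ?_
  simp only [Fintype.mem_piFinset, mem_filter, mem_univ, true_and] at ht ⊢
  intro i i'; rw [ht, ht]

theorem sum_half_pow_le {I : Type} [Fintype I] [DecidableEq I] [Nonempty I] (q N' M : ℕ)
    (hq : 0 < q) (φ : Fin (q * N') → Fin q) :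
    ∑ ω : Fin M → I → Fin (q * N'), (1 / 2 : ℝ) ^ #{j | ∀ i i', φ (ω j i) = φ (ω j i')} ≤
      Fintype.card (Fin M → I → Fin (q * N')) * (1 - 1 / (2 * q ^ Fintype.card I)) ^ M := by
  set m := Fintype.card I with hm
  let w : (I → Fin (q * N')) → ℝ := fun t => if ∀ i i', φ (t i) = φ (t i') then 1 / 2 else 1
  have h1 : ∀ ω : Fin M → I → Fin (q * N'),
      (1 / 2 : ℝ) ^ #{j | ∀ i i', φ (ω j i) = φ (ω j i')} = ∏ j, w (ω j) := by
    intro ω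
    simp only [w]
    rw [Finset.prod_ite]; simp
  simp only [h1]
  rw [← Fintype.sum_pow]
  have h2 : ∑ t, w t ≤ ((q * N' : ℕ) : ℝ) ^ m * (1 - 1 / (2 * q ^ m)) := by
    have h3 : ∀ t, w t = 1 - (1 / 2) * (if ∀ i i', φ (t i) = φ (t i') then 1 else 0) := by
      intro t; simp only [w]; split_ifs <;> norm_num
    simp only [h3, Finset.sum_sub_distrib, ← Finset.mul_sum, Finset.sum_boole]
    have h4 : ((N' ^ m : ℕ) : ℝ) ≤ #{t : I → Fin (q * N') | ∀ i i', φ (t i) = φ (t i')} := by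
      exact_mod_cast pow_card_le_card_const (I := I) q N' hq φ
    have h5 : ((q * N' : ℕ) : ℝ) ^ m * (1 - 1 / (2 * q ^ m)) =
        ((q * N' : ℕ) : ℝ) ^ m - 1 / 2 * ((N' ^ m : ℕ) : ℝ) := by
      have : (q : ℝ) ≠ 0 := by positivity
      push_cast
      rw [mul_pow]; field_simp
    rw [h5]
    simp only [sum_const, card_univ, Fintype.card_fun, Fintype.card_fin, nsmul_eq_mul, mul_one,
      ← hm, Nat.cast_pow] at h4 ⊢
    linarith
  have h0 : 0 ≤ ∑ t, w t := Finset.sum_nonneg fun t _ => by simp only [w]; split_ifs <;> norm_num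
  refine (pow_le_pow_left₀ h0 h2 M).trans (le_of_eq ?_)
  rw [mul_pow]
  simp [hm]

theorem exists_few_bad_many_const {I : Type} [Fintype I] [DecidableEq I]
    (hI : 2 ≤ Fintype.card I) (q g : ℕ) (hq : 0 < q) :
    ∃ (N M s : ℕ) (ω : Fin M → I → Fin N),
      #{F : Finset (Fin M) | F.Nonempty ∧ #F ≤ g ∧
        #(imgUnion ω F) ≤ (Fintype.card I - 1) * #F} ≤ s ∧
      ∀ φ : Fin N → Fin q, s < #{j | ∀ i i', φ (ω j i) = φ (ω j i')} := by
  have : Nonempty I := Fintype.card_pos_iff.1 (by omega)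
  set δ : ℝ := 1 - 1 / (2 * q ^ Fintype.card I) with hδ
  have hq1 : (1 : ℝ) ≤ (q : ℝ) ^ Fintype.card I := one_le_pow₀ (by exact_mod_cast hq)
  have hδ0 : 0 ≤ δ := by
    rw [hδ, sub_nonneg, div_le_one (by positivity)]; linarith
  have hδ1 : δ < 1 := by rw [hδ, sub_lt_self_iff]; positivity
  obtain ⟨L, hL⟩ := exists_pow_lt_of_lt_one (show (0 : ℝ) < 1 / (2 * q) by positivity) hδ1
  set E := ∑ f ∈ Icc 1 g, L ^ f * ((Fintype.card I - 1) * f) ^ (Fintype.card I * f) with hE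
  set s := 2 * E with hs
  set N := q * (s + 2) with hN
  have hN0 : 0 < N := by positivity
  have hNs : s + 2 ≤ N := Nat.le_mul_of_pos_left _ hq
  set M := L * N with hM
  refine ⟨N, M, s, ?_⟩
  let bad : (Fin M → I → Fin N) → ℕ := fun ω =>
    #{F : Finset (Fin M) | F.Nonempty ∧ #F ≤ g ∧ #(imgUnion ω F) ≤ (Fintype.card I - 1) * #F}
  let mono : (Fin N → Fin q) → (Fin M → I → Fin N) → ℕ := fun φ ω =>
    #{j | ∀ i i', φ (ω j i) = φ (ω j i')}
  let val : (Fin M → I → Fin N) → ℝ := fun ω =>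
    (bad ω : ℝ) / (s + 1) + ∑ φ, 2 ^ s * (1 / 2 : ℝ) ^ mono φ ω
  set C := Fintype.card (Fin M → I → Fin N) with hC
  have hC0 : 0 < C := by
    have : Nonempty (Fin N) := ⟨⟨0, hN0⟩⟩
    exact Fintype.card_pos
  have hbad : ∑ ω, (bad ω : ℝ) ≤ E * C := by
    exact_mod_cast sum_card_bad_le hI g L N hN0
  have hmono : ∀ φ, ∑ ω, (1 / 2 : ℝ) ^ mono φ ω ≤ C * δ ^ M := fun φ =>
    sum_half_pow_le q (s + 2) M hq φ
  have hpow : (q : ℝ) ^ N * 2 ^ s * δ ^ M ≤ 1 / 4 := by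
    have h1 : δ ^ M ≤ (1 / (2 * q)) ^ N := by
      rw [hM, pow_mul]; exact pow_le_pow_left₀ (by positivity) hL.le _
    have h2 : (q : ℝ) ^ N * 2 ^ s * (1 / (2 * q)) ^ N = 2 ^ s * (1 / 2) ^ N := by
      have : (q : ℝ) ≠ 0 := by positivity
      rw [div_pow, mul_pow, div_pow]; field_simp
    have h3 : (1 / 2 : ℝ) ^ N ≤ (1 / 2) ^ (s + 2) :=
      pow_le_pow_of_le_one (by norm_num) (by norm_num) hNs
    calc (q : ℝ) ^ N * 2 ^ s * δ ^ M ≤ (q : ℝ) ^ N * 2 ^ s * (1 / (2 * q)) ^ N := by gcongr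
      _ = 2 ^ s * (1 / 2) ^ N := h2
      _ ≤ 2 ^ s * (1 / 2) ^ (s + 2) := by gcongr
      _ = 1 / 4 := by rw [pow_add, ← mul_assoc, ← mul_pow]; norm_num
  have hsum : ∑ ω, val ω < ∑ _ω : Fin M → I → Fin N, (1 : ℝ) := by
    simp only [val, Finset.sum_add_distrib, ← Finset.sum_div]
    rw [Finset.sum_comm]
    simp only [← Finset.mul_sum]
    have h1 : ∑ φ : Fin N → Fin q, ∑ ω, (1 / 2 : ℝ) ^ mono φ ω ≤ q ^ N * (C * δ ^ M) := by
      refine (Finset.sum_le_card_nsmul _ _ _ fun φ _ => hmono φ).trans (le_of_eq ?_)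
      simp
    have h2 : 2 ^ s * ∑ φ : Fin N → Fin q, ∑ ω, (1 / 2 : ℝ) ^ mono φ ω ≤ C * (1 / 4) := by
      calc _ ≤ 2 ^ s * ((q : ℝ) ^ N * (C * δ ^ M)) := by gcongr
        _ = C * ((q : ℝ) ^ N * 2 ^ s * δ ^ M) := by ring
        _ ≤ _ := by gcongr
    have h3 : (∑ ω, (bad ω : ℝ)) / (s + 1) ≤ C * (1 / 2) := by
      rw [div_le_iff₀ (by positivity)]
      refine hbad.trans ?_
      have : (s : ℝ) = 2 * E := by rw [hs]; push_cast; ring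
      rw [this]
      have : (0 : ℝ) < C := by exact_mod_cast hC0
      nlinarith
    have h4 : (0 : ℝ) < C := by exact_mod_cast hC0
    rw [Finset.sum_const, Finset.card_univ, ← hC, nsmul_eq_mul, mul_one]
    linarith
  obtain ⟨ω, -, hω⟩ := Finset.exists_lt_of_sum_lt hsum
  have hpos : 0 ≤ ∑ φ, 2 ^ s * (1 / 2 : ℝ) ^ mono φ ω := Finset.sum_nonneg fun _ _ => by positivity
  have hpos' : 0 ≤ (bad ω : ℝ) / (s + 1) := by positivity
  refine ⟨ω, ?_, fun φ => ?_⟩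
  · have h1 : (bad ω : ℝ) / (s + 1) < 1 := by simp only [val] at hω; linarith
    rw [div_lt_one (by positivity)] at h1
    have : bad ω < s + 1 := by exact_mod_cast h1
    exact Nat.lt_succ_iff.1 this
  · by_contra! hle
    have h1 : 2 ^ s * (1 / 2 : ℝ) ^ mono φ ω < 1 := by
      refine lt_of_le_of_lt (Finset.single_le_sum (f := fun φ => 2 ^ s * (1 / 2 : ℝ) ^ mono φ ω)
        (fun _ _ => by positivity) (mem_univ φ)) ?_
      simp only [val] at hω; linarith
    have h2 : (1 / 2 : ℝ) ^ s ≤ (1 / 2) ^ mono φ ω :=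
      pow_le_pow_of_le_one (by norm_num) (by norm_num) hle
    have h3 : (1 : ℝ) = 2 ^ s * (1 / 2) ^ s := by rw [← mul_pow]; norm_num
    have h4 : (2 : ℝ) ^ s * (1 / 2) ^ s ≤ 2 ^ s * (1 / 2) ^ mono φ ω := by gcongr
    linarith

/-- A system of maps `ω j : I → X` is `g`-sparse if the images of any `f ≤ g` of them span at least
as many points as in a hyperforest. -/
def IsSparse {J I X : Type} [Fintype I] [DecidableEq X] (g : ℕ) (ω : J → I → X) : Prop :=
  ∀ F : Finset J, F.Nonempty → #F ≤ g → (Fintype.card I - 1) * #F + 1 ≤ #(imgUnion ω F)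

/-- Sparse hypergraphs with no proper `q`-colouring exist. -/
theorem exists_isSparse_not_colorable {I : Type} [Fintype I] (hI : 2 ≤ Fintype.card I)
    (q g : ℕ) (hq : 0 < q) :
    ∃ (N M : ℕ) (ω : Fin M → I → Fin N), IsSparse g ω ∧
      ∀ φ : Fin N → Fin q, ∃ j, ∀ i i', φ (ω j i) = φ (ω j i') := by
  classical
  obtain ⟨N, M, s, ω, hbad, hmono⟩ := exists_few_bad_many_const hI q g hq
  set B : Finset (Finset (Fin M)) := {F : Finset (Fin M) | F.Nonempty ∧ #F ≤ g ∧
        #(imgUnion ω F) ≤ (Fintype.card I - 1) * #F} with hB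
  have hne : ∀ F : B, ∃ j, j ∈ F.1 := fun F => (mem_filter.1 F.2).2.1
  choose r hr using hne
  set R : Finset (Fin M) := univ.image r with hR
  have hRs : #R ≤ s := by
    refine Finset.card_image_le.trans ?_
    simpa using hbad
  let e : Fin (Fintype.card {j // j ∉ R}) ≃ {j // j ∉ R} := (Fintype.equivFin _).symm
  refine ⟨N, _, fun j => ω (e j), ?_, fun φ => ?_⟩
  · intro F hF hFg
    let emb : Fin (Fintype.card {j // j ∉ R}) ↪ Fin M :=
      e.toEmbedding.trans (Function.Embedding.subtype _)
    have h1 : imgUnion (fun j => ω (e j)) F = imgUnion ω (F.map emb) := by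
      ext x; simp [mem_imgUnion, emb]
    rw [h1]
    by_contra! hlt
    have hmem : F.map emb ∈ B := by
      simp only [hB, mem_filter, mem_univ, true_and, card_map]
      refine ⟨by simpa using hF, hFg, by omega⟩
    have h2 := hr ⟨_, hmem⟩
    simp only [Finset.mem_map] at h2
    obtain ⟨j, -, hj⟩ := h2
    apply (e j).2
    rw [show ((e j : {j // j ∉ R}) : Fin M) = r ⟨_, hmem⟩ from hj]
    exact mem_image_of_mem _ (mem_univ _)
  · have h1 := (hRs.trans_lt (hmono φ))
    obtain ⟨j, hj, hjR⟩ := Finset.exists_mem_notMem_of_card_lt_card h1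
    refine ⟨e.symm ⟨j, hjR⟩, ?_⟩
    simpa using hj

/-- The common property of triangles and 3-connected graphs on which the construction relies:
at least three vertices, and no set of at most two vertices separates. -/
def NoSmallCut {W : Type} [Fintype W] (H : SimpleGraph W) : Prop :=
  3 ≤ Fintype.card W ∧ ∀ S : Finset W, #S ≤ 2 → (H.induce ((↑S : Set W)ᶜ)).Connected

theorem ThreeConnOrK3.noSmallCut {W : Type} [Fintype W] {H : SimpleGraph W}
    (hH : ThreeConnOrK3 H) : NoSmallCut H := by
  rcases hH with ⟨h4, hS⟩ | ⟨⟨e⟩⟩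
  · exact ⟨by omega, hS⟩
  · have hcard : Fintype.card W = 3 := by rw [Fintype.card_congr e.toEquiv, Fintype.card_fin]
    refine ⟨hcard.ge, fun S hS => ?_⟩
    have hadj : ∀ a b, a ≠ b → H.Adj a b := fun a b hab => by
      rw [← e.map_adj_iff]; simpa using hab
    obtain ⟨w, -, hw⟩ := Finset.exists_mem_notMem_of_card_lt_card
      (show #S < #(univ : Finset W) by rw [Finset.card_univ]; omega)
    have : Nonempty ↥((↑S : Set W)ᶜ) := ⟨⟨w, by simpa using hw⟩⟩
    refine ⟨fun a b => ?_⟩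
    by_cases hab : a = b
    · rw [hab]
    · exact Adj.reachable (hadj _ _ fun h => hab (Subtype.ext h))

namespace NoSmallCut

variable {W : Type} [Fintype W] {H : SimpleGraph W}

theorem exists_adj_notMem (hH : NoSmallCut H) {S : Finset W} (hS : #S ≤ 2) {v w : W} (hv : v ∉ S)
    (hw : w ∉ S) (hvw : v ≠ w) : ∃ u, u ∉ S ∧ H.Adj v u := by
  have h := (hH.2 S hS).preconnected ⟨v, by simpa using hv⟩ ⟨w, by simpa using hw⟩
  rw [reachable_iff_reflTransGen] at h
  rcases h.cases_head with h | ⟨u, hu, -⟩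
  · exact absurd (congrArg Subtype.val h) hvw
  · exact ⟨u, fun h => u.2 (by simpa using h), hu⟩

theorem exists_notMem (hH : NoSmallCut H) {S : Finset W} (hS : #S ≤ 2) : ∃ w, w ∉ S := by
  obtain ⟨w, -, hw⟩ := Finset.exists_mem_notMem_of_card_lt_card
    (show #S < #(univ : Finset W) by rw [Finset.card_univ]; have := hH.1; omega)
  exact ⟨w, hw⟩

theorem exists_adj_ne (hH : NoSmallCut H) (v r : W) : ∃ u, H.Adj v u ∧ u ≠ r := by
  classical
  by_cases hvr : v = r
  · obtain ⟨w, hw⟩ := hH.exists_notMem (S := {v}) (by simp)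
    obtain ⟨u, -, hu⟩ := hH.exists_adj_notMem (S := ∅) (by simp) (by simp) (by simp)
      (show v ≠ w by simpa [eq_comm] using hw)
    exact ⟨u, hu, fun h => hu.ne (hvr.trans h.symm)⟩
  · obtain ⟨w, hw⟩ := hH.exists_notMem (S := {v, r}) Finset.card_le_two
    simp only [mem_insert, mem_singleton, not_or] at hw
    obtain ⟨u, hu, hvu⟩ := hH.exists_adj_notMem (S := {r}) (by simp) (by simpa using hvr)
      (by simpa using hw.2) (Ne.symm hw.1)
    exact ⟨u, hvu, by simpa using hu⟩

theorem exists_adj (hH : NoSmallCut H) (v : W) : ∃ u, H.Adj v u :=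
  (hH.exists_adj_ne v v).imp fun _ h => h.1

theorem nonempty (hH : NoSmallCut H) : Nonempty W :=
  Fintype.card_pos_iff.1 (by have := hH.1; omega)

/-- Two vertices containing the neighbourhood of a vertex are adjacent. -/
theorem adj_of_neighbors (hH : NoSmallCut H) {v p r : W}
    (hv : ∀ u, H.Adj v u → u = p ∨ u = r) : H.Adj p r := by
  classical
  obtain ⟨u, hvu, hur⟩ := hH.exists_adj_ne v r
  obtain rfl : u = p := (hv u hvu).resolve_right hur
  obtain ⟨u', hvu', hup⟩ := hH.exists_adj_ne v u
  obtain rfl : u' = r := (hv u' hvu').resolve_left hup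
  by_cases h : ∃ w, w ∉ ({v, u, u'} : Finset W)
  · obtain ⟨w, hw⟩ := h
    simp only [mem_insert, mem_singleton, not_or] at hw
    obtain ⟨x, hx, hvx⟩ := hH.exists_adj_notMem (S := {u, u'}) Finset.card_le_two
      (v := v) (w := w) (by simp [hvu.ne, hvu'.ne]) (by simp [hw]) (Ne.symm hw.1)
    rcases hv x hvx with rfl | rfl <;> simp at hx
  · push Not at h
    obtain ⟨x, hux, hxv⟩ := hH.exists_adj_ne u v
    have := h x
    simp only [mem_insert, mem_singleton] at this
    rcases this with rfl | rfl | rfl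
    · exact absurd rfl hxv
    · exact absurd rfl hux.ne
    · exact hux

/-- If every vertex lying on edges of both classes of a bipartition of the edges belongs to a set of
size at most two, then one of the classes is contained in that set. -/
theorem edges_subset_or (hH : NoSmallCut H) (D : Sym2 W → Prop) {s : Finset W} (hs : #s ≤ 2)
    (hb : ∀ v a b, H.Adj v a → H.Adj v b → D s(v, a) → ¬ D s(v, b) → v ∈ s) :
    (∀ a b, H.Adj a b → D s(a, b) → a ∈ s) ∨ (∀ a b, H.Adj a b → ¬ D s(a, b) → a ∈ s) := by
  by_contra! hcon
  obtain ⟨⟨v, a, hva, hD, hv⟩, ⟨w, b, hwb, hnD, hw⟩⟩ := hcon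
  have h := (hH.2 s hs).preconnected ⟨v, by simpa using hv⟩ ⟨w, by simpa using hw⟩
  rw [reachable_iff_reflTransGen] at h
  have key : ∃ a, H.Adj w a ∧ D s(w, a) := by
    refine Relation.ReflTransGen.head_induction_on
      (motive := fun u _ => (∃ a, H.Adj u.1 a ∧ D s(u.1, a)) → ∃ a, H.Adj w a ∧ D s(w, a))
      h id ?_ ⟨a, hva, hD⟩
    rintro u u' huu' - ih ⟨a, hua, hDa⟩
    have huu'' : H.Adj u.1 u'.1 := huu'
    refine ih ⟨u, huu''.symm, ?_⟩
    by_contra hn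
    rw [Sym2.eq_swap] at hn
    exact u.2 (by simpa using hb _ _ _ hua huu'' hDa hn)
  obtain ⟨a', hwa', hDa'⟩ := key
  exact hw (hb _ _ _ hwa' hwb hDa' hnD)

end NoSmallCut

namespace IsSparse

variable {J I X : Type} [Fintype I] [DecidableEq X] {g : ℕ} {ω : J → I → X}

theorem card_image (h : IsSparse g ω) (hg : 1 ≤ g) (hI : 1 ≤ Fintype.card I) (j : J) :
    #(univ.image (ω j)) = Fintype.card I := by
  have h1 := h {j} (by simp) (by simpa using hg)
  simp only [imgUnion, singleton_biUnion, card_singleton] at h1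
  have h2 := Finset.card_image_le (s := univ) (f := ω j)
  rw [Finset.card_univ] at h2
  omega

theorem injective (h : IsSparse g ω) (hg : 1 ≤ g) (j : J) : Function.Injective (ω j) := by
  rcases Nat.eq_zero_or_pos (Fintype.card I) with h0 | h0
  · have := Fintype.card_eq_zero_iff.1 h0
    exact Function.injective_of_subsingleton _
  · rw [← Set.injOn_univ, ← Finset.coe_univ, ← Finset.card_image_iff, card_univ]
    exact h.card_image hg h0 j

/-- A sparse system has a leaf: a member meeting the union of the others in at most one point. -/
theorem exists_leaf [DecidableEq J] (h : IsSparse g ω) (hI : 2 ≤ Fintype.card I) {F : Finset J}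
    (hF : F.Nonempty) (hFg : #F ≤ g) :
    ∃ j ∈ F, #(imgUnion ω {j} ∩ imgUnion ω (F.erase j)) ≤ 1 := by
  by_contra! hcon
  have h1 := h F hF hFg
  have hg : 1 ≤ g := hF.card_pos.trans_le hFg
  have h2 : #(imgUnion ω F) * 2 ≤ ∑ x ∈ imgUnion ω F, ∑ j ∈ F,
      if x ∈ imgUnion ω {j} then (if x ∈ imgUnion ω (F.erase j) then 1 else 2) else 0 := by
    rw [← smul_eq_mul]
    refine Finset.card_nsmul_le_sum _ _ _ fun x hx => ?_
    obtain ⟨j, hj, i, hi⟩ := mem_imgUnion.1 hx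
    have hxj : x ∈ imgUnion ω {j} := mem_imgUnion.2 ⟨j, by simp, i, hi⟩
    by_cases hxe : x ∈ imgUnion ω (F.erase j)
    · obtain ⟨j', hj', i', hi'⟩ := mem_imgUnion.1 hxe
      obtain ⟨hne, hj'⟩ := mem_erase.1 hj'
      have hxj' : x ∈ imgUnion ω {j'} := mem_imgUnion.2 ⟨j', by simp, i', hi'⟩
      have hsub : ({j, j'} : Finset J) ⊆ F := by
        intro t ht; simp only [mem_insert, mem_singleton] at ht; rcases ht with rfl | rfl <;> assumption
      refine le_trans ?_ (Finset.sum_le_sum_of_subset hsub)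
      rw [Finset.sum_pair hne.symm, if_pos hxj, if_pos hxj']
      split_ifs <;> omega
    · refine le_trans ?_ (Finset.single_le_sum (fun _ _ => Nat.zero_le _) hj)
      simp [hxj, hxe]
  rw [Finset.sum_comm] at h2
  have h3 : ∀ j ∈ F, (∑ x ∈ imgUnion ω F,
      if x ∈ imgUnion ω {j} then (if x ∈ imgUnion ω (F.erase j) then 1 else 2) else 0) ≤
      2 * (Fintype.card I - 1) := by
    intro j hj
    have h4 : #(imgUnion ω {j}) = Fintype.card I := by
      rw [imgUnion, singleton_biUnion]; exact h.card_image hg (by omega) j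
    have h5 : ∀ x, (if x ∈ imgUnion ω {j} then (if x ∈ imgUnion ω (F.erase j) then 1 else 2)
        else 0) + (if x ∈ imgUnion ω {j} ∩ imgUnion ω (F.erase j) then 1 else 0) =
        if x ∈ imgUnion ω {j} then 2 else 0 := by
      intro x; by_cases ha : x ∈ imgUnion ω {j} <;> by_cases hb : x ∈ imgUnion ω (F.erase j) <;>
        simp [ha, hb]
    have h6 := Finset.sum_congr (rfl : imgUnion ω F = imgUnion ω F) (fun x _ => h5 x)
    rw [Finset.sum_add_distrib, ← Finset.card_filter, ← Finset.sum_filter (s := imgUnion ω F)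
      (p := fun x => x ∈ imgUnion ω {j}) (f := fun _ => 2), Finset.sum_const, smul_eq_mul] at h6
    have hsub : imgUnion ω {j} ⊆ imgUnion ω F :=
      Finset.biUnion_subset_biUnion_of_subset_left _ (by simpa using hj)
    have h7 : {x ∈ imgUnion ω F | x ∈ imgUnion ω {j} ∩ imgUnion ω (F.erase j)} =
        imgUnion ω {j} ∩ imgUnion ω (F.erase j) := by
      ext x; simp only [mem_filter, mem_inter]
      exact ⟨fun h => h.2, fun h => ⟨hsub h.1, h⟩⟩
    have h8 : {x ∈ imgUnion ω F | x ∈ imgUnion ω {j}} = imgUnion ω {j} := by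
      ext x; simp only [mem_filter]
      exact ⟨fun h => h.2, fun h => ⟨hsub h, h⟩⟩
    rw [h7, h8, h4] at h6
    have h9 := hcon j hj
    omega
  have h4 := h2.trans (Finset.sum_le_card_nsmul _ _ _ h3)
  rw [smul_eq_mul] at h4
  nlinarith

theorem card_inter_le_one [DecidableEq J] (h : IsSparse g ω) (hI : 2 ≤ Fintype.card I)
    (hg : 2 ≤ g) {j j' : J} (hj : j ≠ j') :
    #(imgUnion ω {j} ∩ imgUnion ω {j'}) ≤ 1 := by
  obtain ⟨t, ht, h1⟩ := h.exists_leaf hI (F := {j, j'}) (by simp)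
    ((Finset.card_pair hj).trans_le hg)
  simp only [mem_insert, mem_singleton] at ht
  rcases ht with rfl | rfl
  · rwa [Finset.erase_insert (by simpa using hj)] at h1
  · rw [Finset.pair_comm, Finset.erase_insert (by simpa using hj.symm)] at h1
    rwa [Finset.inter_comm]

end IsSparse

/-- Ramsey's theorem for vertex-coloured cliques, off-diagonal multicolour form. -/
theorem exists_mono_clique {q : ℕ} (hq : 0 < q) (n : ℕ) : ∀ t : Fin q → ℕ, ∑ i, t i = n →
    ∃ N : ℕ, ∀ (V : Type) (c : Sym2 V → Fin q) (S : Finset V), N ≤ #S →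
      ∃ i, ∃ T ⊆ S, #T = t i ∧ ∀ a ∈ T, ∀ b ∈ T, a ≠ b → c s(a, b) = i := by
  have : Nonempty (Fin q) := ⟨⟨0, hq⟩⟩
  induction n with
  | zero =>
    intro t ht
    refine ⟨0, fun V c S _ => ⟨⟨0, hq⟩, ∅, by simp, ?_, by simp⟩⟩
    rw [Finset.sum_eq_zero_iff] at ht
    simp [ht]
  | succ n ih =>
    intro t ht
    by_cases h0 : ∃ i, t i = 0
    · obtain ⟨i, hi⟩ := h0
      exact ⟨0, fun V c S _ => ⟨i, ∅, by simp, by simp [hi], by simp⟩⟩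
    push Not at h0
    have hsum : ∀ i, ∑ j, Function.update t i (t i - 1) j = n := by
      intro i
      have h1 := Finset.sum_update_of_mem (mem_univ i) t (t i - 1)
      have h2 := Finset.sum_eq_add_sum_sdiff_singleton_of_mem (mem_univ i) t
      have := h0 i
      omega
    choose N hN using fun i => ih _ (hsum i)
    refine ⟨∑ i, N i + 1, fun V c S hS => ?_⟩
    classical
    obtain ⟨v, hv⟩ : S.Nonempty := Finset.card_pos.1 (by omega)
    have hcard : ∑ i, N i ≤ ∑ i, #{x ∈ S.erase v | c s(v, x) = i} := by
      rw [← Finset.card_eq_sum_card_fiberwise (fun _ _ => mem_coe.2 (mem_univ _)),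
        Finset.card_erase_of_mem hv]
      omega
    obtain ⟨i, -, hi⟩ := Finset.exists_le_of_sum_le univ_nonempty hcard
    obtain ⟨i', T, hT, hTc, hmono⟩ := hN i V c _ hi
    have hTS : T ⊆ S.erase v := hT.trans (Finset.filter_subset _ _)
    by_cases hii : i' = i
    · subst hii
      refine ⟨i', insert v T, ?_, ?_, ?_⟩
      · exact Finset.insert_subset hv (hTS.trans (Finset.erase_subset _ _))
      · have hvT : v ∉ T := fun h => by simpa using hTS h
        rw [Finset.card_insert_of_notMem hvT, hTc, Function.update_self]
        have := h0 i'; omega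
      · intro a ha b hb hab
        rw [mem_insert] at ha hb
        rcases ha with rfl | ha <;> rcases hb with rfl | hb
        · exact absurd rfl hab
        · exact (mem_filter.1 (hT hb)).2
        · rw [Sym2.eq_swap]; exact (mem_filter.1 (hT ha)).2
        · exact hmono a ha b hb hab
    · refine ⟨i', T, hTS.trans (Finset.erase_subset _ _), ?_, hmono⟩
      rw [hTc, Function.update_of_ne hii]

theorem exists_isRamsey {q : ℕ} (hq : 0 < q) {W : Type} [Fintype W] (H : SimpleGraph W) :
    ∃ n, IsRamsey q (⊤ : SimpleGraph (Fin n)) H := by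
  obtain ⟨N, hN⟩ := exists_mono_clique hq _ (fun _ => Fintype.card W) rfl
  refine ⟨N, fun c => ?_⟩
  obtain ⟨i, T, -, hT, hmono⟩ := hN (Fin N) c univ (by simp)
  let e : W ≃ T := Fintype.equivOfCardEq (by simp [hT])
  refine ⟨i, e.toEmbedding.trans (Function.Embedding.subtype _), fun a b hab => ?_⟩
  have hne : (e a : Fin N) ≠ e b := fun h => hab.ne (e.injective (Subtype.ext h))
  exact ⟨hne, hmono _ (e a).2 _ (e b).2 hne⟩

/-- There is a graph `S` that is not Ramsey but in which every good colouring uses at least two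
colours at the vertex `a`. -/
theorem exists_star_not_const {q : ℕ} (hq : 2 ≤ q) {W : Type} [Fintype W] {H : SimpleGraph W}
    (hH : NoSmallCut H) :
    ∃ (n : ℕ) (S : SimpleGraph (Fin n)) (a : Fin n), ¬ IsRamsey q S H ∧
      ∀ c : Sym2 (Fin n) → Fin q, ¬ HasMonoCopy S H c →
        ∃ v v', S.Adj a v ∧ S.Adj a v' ∧ c s(a, v) ≠ c s(a, v') := by
  obtain ⟨n, hn⟩ := exists_isRamsey (q := q) (by omega) H
  obtain ⟨G, -, hG⟩ := exists_minimal_le_of_wellFoundedLT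
    (fun G : SimpleGraph (Fin n) => IsRamsey q G H) ⊤ hn
  have : NeZero q := ⟨by omega⟩
  obtain ⟨w⟩ := hH.nonempty
  obtain ⟨w', hww'⟩ := hH.exists_adj w
  obtain ⟨i, f, hf⟩ := hG.1 fun _ => 0
  have hab := (hf _ _ hww').1
  generalize f w = a at hab
  generalize f w' = b at hab
  have hlt : G.deleteEdges {s(a, b)} < G :=
    lt_of_le_of_ne (deleteEdges_le _) fun h => by
      rw [← h, deleteEdges_adj] at hab
      exact hab.2 rfl
  refine ⟨n, G.deleteEdges {s(a, b)}, a, fun h => hlt.not_ge (hG.2 h hlt.le), fun c hc => ?_⟩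
  by_contra! hcon
  obtain ⟨β, hβ⟩ : ∃ β, ∀ v, (G.deleteEdges {s(a, b)}).Adj a v → c s(a, v) ≠ β := by
    have : Nontrivial (Fin q) := Fin.nontrivial_iff_two_le.2 hq
    by_cases h : ∃ v, (G.deleteEdges {s(a, b)}).Adj a v
    · obtain ⟨v, hv⟩ := h
      obtain ⟨β, hβ⟩ := exists_ne (c s(a, v))
      exact ⟨β, fun v' hv' => by rw [← hcon v v' hv hv']; exact hβ.symm⟩
    · push Not at h
      exact ⟨0, fun v hv => absurd hv (h v)⟩
  classical
  obtain ⟨i, f, hf⟩ := hG.1 (Function.update c s(a, b) β)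
  have hedge : ∀ x y, H.Adj x y → s(f x, f y) ≠ s(a, b) →
      (G.deleteEdges {s(a, b)}).Adj (f x) (f y) ∧ c s(f x, f y) = i := fun x y hxy hne => by
    have := hf x y hxy
    rw [Function.update_of_ne hne] at this
    exact ⟨SimpleGraph.deleteEdges_adj.2 ⟨this.1, by simpa using hne⟩, this.2⟩
  by_cases h : ∃ x y, H.Adj x y ∧ f x = a ∧ f y = b
  · obtain ⟨x, y, hxy, hx, hy⟩ := h
    have hi : i = β := by
      have := (hf x y hxy).2
      rw [hx, hy, Function.update_self] at this
      exact this.symm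
    obtain ⟨y', hxy', hne⟩ := hH.exists_adj_ne x y
    have h1 := hedge x y' hxy' fun h => by
      rw [hx, Sym2.congr_right, ← hy] at h
      exact hne (f.injective h)
    rw [hx, hi] at h1
    exact hβ _ h1.1 h1.2
  · push Not at h
    refine hc ⟨i, f, fun x y hxy => hedge x y hxy fun he => ?_⟩
    rcases Sym2.eq_iff.1 he with ⟨h1, h2⟩ | ⟨h1, h2⟩
    · exact h x y hxy h1 h2
    · exact h y x hxy.symm h2 h1

/-- A functional relation is contained in the graph of a function. -/
theorem exists_fun_of_rel {α β : Type*} [Nonempty β] (R : α → β → Prop)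
    (hR : ∀ a b b', R a b → R a b' → b = b') : ∃ f : α → β, ∀ a b, R a b → f a = b := by
  classical
  refine ⟨fun a => if h : ∃ b, R a b then h.choose else Classical.arbitrary β, fun a b hab => ?_⟩
  have h : ∃ b, R a b := ⟨b, hab⟩
  simp only [h, dif_pos]
  exact hR _ _ _ h.choose_spec hab

/-- A monochromatic copy contained in an isomorphic image of `S` pulls back to `S`. -/
theorem hasMonoCopy_of_map {V W U : Type} [Fintype W] {H : SimpleGraph W} (hH : NoSmallCut H)
    {S : SimpleGraph V} {q : ℕ} {c : Sym2 V → Fin q} {i : Fin q} (ψ : V → U)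
    (hψ : Function.Injective ψ) (f : W ↪ U)
    (hf : ∀ a b, H.Adj a b → ∃ v v', S.Adj v v' ∧ ψ v = f a ∧ ψ v' = f b ∧ c s(v, v') = i) :
    HasMonoCopy S H c := by
  have hg : ∀ a, ∃ v, ψ v = f a := fun a => by
    obtain ⟨b, hab⟩ := hH.exists_adj a
    obtain ⟨v, v', -, h, -⟩ := hf a b hab
    exact ⟨v, h⟩
  choose g hg using hg
  have hgi : Function.Injective g := fun a b hab => f.injective (by rw [← hg, ← hg, hab])
  refine ⟨i, ⟨g, hgi⟩, fun a b hab => ?_⟩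
  obtain ⟨v, v', hvv', h1, h2, h3⟩ := hf a b hab
  have e1 : g a = v := hψ (by rw [hg, h1])
  have e2 : g b = v' := hψ (by rw [hg, h2])
  change S.Adj (g a) (g b) ∧ c s(g a, g b) = i
  rw [e1, e2]
  exact ⟨hvv', h3⟩

/-- Colourings pull back along graph homomorphisms that are injective. -/
theorem not_hasMonoCopy_comap {V W U : Type} {H : SimpleGraph W} {S : SimpleGraph V}
    {T : SimpleGraph U} {q : ℕ} {c : Sym2 U → Fin q} (hc : ¬ HasMonoCopy T H c) (ψ : V ↪ U)
    (hψ : ∀ v v', S.Adj v v' → T.Adj (ψ v) (ψ v')) :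
    ¬ HasMonoCopy S H fun e => c (e.map ψ) := by
  rintro ⟨i, f, hf⟩
  exact hc ⟨i, f.trans ψ, fun a b hab => ⟨hψ _ _ (hf a b hab).1, (hf a b hab).2⟩⟩

section Pieces

variable {V X J W : Type} {S : SimpleGraph V} {a : V}

open Classical in
/-- The embedding of the `j`-th copy of `S` into the union of all copies: the centre `a` goes to
`none`, a leaf `i` with `(j, i) ∈ A` is identified with `ω j i`, other vertices stay private. -/
noncomputable def pieceMap (ω : J → {v // S.Adj a v} → X) (A : Finset (J × {v // S.Adj a v}))
    (j : J) (v : V) : Option (X ⊕ J × V) :=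
  if v = a then none
  else if h : ∃ hv : S.Adj a v, (j, ⟨v, hv⟩) ∈ A then some (Sum.inl (ω j ⟨v, h.1⟩))
  else some (Sum.inr (j, v))

variable {ω : J → {v // S.Adj a v} → X} {A : Finset (J × {v // S.Adj a v})} {j j' : J} {v v' : V}

theorem pieceMap_self : pieceMap ω A j a = none := by simp [pieceMap]

theorem pieceMap_eq_none : pieceMap ω A j v = none ↔ v = a := by
  unfold pieceMap; split_ifs <;> simp_all

theorem pieceMap_leaf {i : {v // S.Adj a v}} (hi : (j, i) ∈ A) :
    pieceMap ω A j i = some (Sum.inl (ω j i)) := by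
  have h : ∃ hv : S.Adj a i, (j, (⟨i, hv⟩ : {v // S.Adj a v})) ∈ A := ⟨i.2, hi⟩
  rw [pieceMap, if_neg i.2.ne', dif_pos h]

theorem pieceMap_leaf_notMem {i : {v // S.Adj a v}} (hi : (j, i) ∉ A) :
    pieceMap ω A j i = some (Sum.inr (j, i.1)) := by
  have h : ¬ ∃ hv : S.Adj a i, (j, (⟨i, hv⟩ : {v // S.Adj a v})) ∈ A := fun h => hi h.2
  rw [pieceMap, if_neg i.2.ne', dif_neg h]

theorem pieceMap_eq_inl {x : X} :
    pieceMap ω A j v = some (Sum.inl x) ↔ ∃ i, i.1 = v ∧ (j, i) ∈ A ∧ ω j i = x := by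
  constructor
  · intro h
    unfold pieceMap at h
    split_ifs at h with h1 h2
    · exact ⟨⟨v, h2.1⟩, rfl, h2.2, by simpa using h⟩
    · simp at h
  · rintro ⟨i, rfl, hi, rfl⟩
    exact pieceMap_leaf hi

theorem eq_of_pieceMap_eq_inr {p : J × V} (h : pieceMap ω A j v = some (Sum.inr p)) :
    p = (j, v) := by
  unfold pieceMap at h
  split_ifs at h
  · simp at h
  · simpa [eq_comm] using h

theorem pieceMap_injective (hω : Function.Injective (ω j)) :
    Function.Injective (pieceMap ω A j) := by
  intro v v' h
  rcases h1 : pieceMap ω A j v with _ | x | p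
  · rw [pieceMap_eq_none.1 h1, pieceMap_eq_none.1 (h.symm.trans h1)]
  · obtain ⟨i, rfl, -, hi⟩ := pieceMap_eq_inl.1 h1
    obtain ⟨i', rfl, -, hi'⟩ := pieceMap_eq_inl.1 (h.symm.trans h1)
    rw [hω (hi.trans hi'.symm)]
  · have h2 := eq_of_pieceMap_eq_inr h1
    have h3 := eq_of_pieceMap_eq_inr (h.symm.trans h1)
    exact (Prod.ext_iff.1 (h2.symm.trans h3)).2

/-- Distinct pieces only share the centre and identified leaves. -/
theorem pieceMap_eq_cases (hj : j ≠ j') (h : pieceMap ω A j v = pieceMap ω A j' v') :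
    (v = a ∧ v' = a) ∨ ∃ i i', i.1 = v ∧ i'.1 = v' ∧ (j, i) ∈ A ∧ (j', i') ∈ A ∧
      ω j i = ω j' i' := by
  rcases h1 : pieceMap ω A j v with _ | x | p
  · exact Or.inl ⟨pieceMap_eq_none.1 h1, pieceMap_eq_none.1 (h.symm.trans h1)⟩
  · obtain ⟨i, hv, hA, hi⟩ := pieceMap_eq_inl.1 h1
    obtain ⟨i', hv', hA', hi'⟩ := pieceMap_eq_inl.1 (h.symm.trans h1)
    exact Or.inr ⟨i, i', hv, hv', hA, hA', hi.trans hi'.symm⟩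
  · have h2 := eq_of_pieceMap_eq_inr h1
    have h3 := eq_of_pieceMap_eq_inr (h.symm.trans h1)
    exact absurd (Prod.ext_iff.1 (h2.symm.trans h3)).1 hj

/-- The union of all pieces. -/
def pieceUnion (ω : J → {v // S.Adj a v} → X) (A : Finset (J × {v // S.Adj a v})) :
    SimpleGraph (Option (X ⊕ J × V)) :=
  SimpleGraph.fromRel fun p p' =>
    ∃ j v v', S.Adj v v' ∧ pieceMap ω A j v = p ∧ pieceMap ω A j v' = p'

theorem pieceUnion_adj (hω : ∀ j, Function.Injective (ω j)) {p p' : Option (X ⊕ J × V)} :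
    (pieceUnion ω A).Adj p p' ↔
      ∃ j v v', S.Adj v v' ∧ pieceMap ω A j v = p ∧ pieceMap ω A j v' = p' := by
  rw [pieceUnion, fromRel_adj]
  constructor
  · rintro ⟨-, h | ⟨j, v, v', h, h1, h2⟩⟩
    · exact h
    · exact ⟨j, v', v, h.symm, h2, h1⟩
  · rintro ⟨j, v, v', h, rfl, rfl⟩
    exact ⟨fun he => h.ne (pieceMap_injective (hω j) he), Or.inl ⟨j, v, v', h, rfl, rfl⟩⟩

/-- The pair `e` is mapped by `f` to an edge of a piece with index in `F`. -/
def PieceCovers (ω : J → {v // S.Adj a v} → X) (A : Finset (J × {v // S.Adj a v}))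
    (f : W → Option (X ⊕ J × V)) (F : Finset J) (e : Sym2 W) : Prop :=
  ∃ j ∈ F, ∃ v v', S.Adj v v' ∧ s(pieceMap ω A j v, pieceMap ω A j v') = e.map f

theorem pieceCovers_iff {f : W → Option (X ⊕ J × V)} {F : Finset J} {x y : W} :
    PieceCovers ω A f F s(x, y) ↔ ∃ j ∈ F, ∃ v v', S.Adj v v' ∧ pieceMap ω A j v = f x ∧
      pieceMap ω A j v' = f y := by
  simp only [PieceCovers, Sym2.map_mk]
  constructor
  · rintro ⟨j, hj, v, v', h, he⟩
    rcases Sym2.eq_iff.1 he with ⟨h1, h2⟩ | ⟨h1, h2⟩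
    · exact ⟨j, hj, v, v', h, h1, h2⟩
    · exact ⟨j, hj, v', v, h.symm, h2, h1⟩
  · rintro ⟨j, hj, v, v', h, h1, h2⟩
    exact ⟨j, hj, v, v', h, by rw [h1, h2]⟩

variable [Fintype W] {H : SimpleGraph W}

theorem pieceCovers_of_uncovered_subset (hH : NoSmallCut H) (f : W ↪ Option (X ⊕ J × V))
    {K : Finset J} {R : Finset X} (hR : #R ≤ 1)
    (hK : ∀ x y, H.Adj x y → ¬ PieceCovers ω A f K s(x, y) →
      f x = none ∨ ∃ n ∈ R, f x = some (Sum.inl n)) :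
    ∀ x y, H.Adj x y → PieceCovers ω A f K s(x, y) := by
  by_contra! hcon
  obtain ⟨x, y, hxy, hn⟩ := hcon
  have key : ∀ p r, H.Adj p r → ¬ PieceCovers ω A f K s(p, r) → f p = none →
      (∃ n ∈ R, f r = some (Sum.inl n)) → False := by
    rintro p r hpr hn hp ⟨n, hnR, hr⟩
    obtain ⟨t, hrt, htp⟩ := hH.exists_adj_ne r p
    by_cases ht : PieceCovers ω A f K s(r, t)
    · obtain ⟨j, hj, v, v', -, h1, -⟩ := pieceCovers_iff.1 ht
      rw [hr] at h1
      obtain ⟨i, rfl, -⟩ := pieceMap_eq_inl.1 h1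
      exact hn (pieceCovers_iff.2 ⟨j, hj, a, i, i.2, by rw [pieceMap_self, hp], h1.trans hr.symm⟩)
    · rw [Sym2.eq_swap] at ht
      rcases hK t r hrt.symm ht with h1 | ⟨n', hn', h1⟩
      · exact htp (f.injective (h1.trans hp.symm))
      · rw [Finset.card_le_one.1 hR n' hn' n hnR, ← hr] at h1
        exact hrt.ne (f.injective h1).symm
  have hn' : ¬ PieceCovers ω A f K s(y, x) := by rwa [Sym2.eq_swap]
  rcases hK x y hxy hn with hx | hx <;> rcases hK y x hxy.symm hn' with hy | hy
  · exact hxy.ne (f.injective (hx.trans hy.symm))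
  · exact key x y hxy hn hx hy
  · exact key y x hxy.symm hn' hy hx
  · obtain ⟨n, hn, hx⟩ := hx
    obtain ⟨n', hn', hy⟩ := hy
    rw [Finset.card_le_one.1 hR n' hn' n hn, ← hx] at hy
    exact hxy.ne (f.injective hy).symm

variable [Fintype {v // S.Adj a v}] [DecidableEq X]

theorem pieceCovers_split (hH : NoSmallCut H) (f : W ↪ Option (X ⊕ J × V)) {P Q : Finset J}
    (hPQ : Disjoint P Q) (hR : #(imgUnion ω P ∩ imgUnion ω Q) ≤ 1)
    (hcov : ∀ x y, H.Adj x y → PieceCovers ω A f P s(x, y) ∨ PieceCovers ω A f Q s(x, y)) :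
    (∀ x y, H.Adj x y → PieceCovers ω A f P s(x, y)) ∨
      ∀ x y, H.Adj x y → PieceCovers ω A f Q s(x, y) := by
  classical
  set R := imgUnion ω P ∩ imgUnion ω Q with hRdef
  let s : Finset W := {x | f x = none ∨ ∃ n ∈ R, f x = some (Sum.inl n)}
  have hmem : ∀ x, x ∈ s ↔ f x = none ∨ ∃ n ∈ R, f x = some (Sum.inl n) := fun x => by simp [s]
  have hs : #s ≤ 2 := by
    rw [← Finset.card_map f]
    refine (Finset.card_le_card (t := insert none (R.image fun n => some (Sum.inl n))) ?_).trans ?_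
    · intro p hp
      obtain ⟨x, hx, rfl⟩ := Finset.mem_map.1 hp
      rcases (hmem x).1 hx with h | ⟨n, hn, h⟩ <;> rw [h]
      · simp
      · exact Finset.mem_insert_of_mem (Finset.mem_image_of_mem _ hn)
    · refine (Finset.card_insert_le _ _).trans ?_
      have := Finset.card_image_le (s := R) (f := fun n => (some (Sum.inl n) : Option (X ⊕ J × V)))
      omega
  have hb : ∀ v x y, H.Adj v x → H.Adj v y → ¬ PieceCovers ω A f Q s(v, x) →
      ¬ ¬ PieceCovers ω A f Q s(v, y) → v ∈ s := by
    intro v x y hvx hvy h1 h2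
    obtain ⟨j, hj, u, u', -, hu, -⟩ := pieceCovers_iff.1 ((hcov v x hvx).resolve_right h1)
    obtain ⟨j', hj', w, w', -, hw, -⟩ := pieceCovers_iff.1 (not_not.1 h2)
    have hne : j ≠ j' := fun h => Finset.disjoint_left.1 hPQ hj (h ▸ hj')
    rw [hmem]
    rcases pieceMap_eq_cases hne (hu.trans hw.symm) with ⟨h, -⟩ | ⟨i, i', hi, -, hA, -, hii⟩
    · rw [← hu, h, pieceMap_self]; exact Or.inl rfl
    · refine Or.inr ⟨ω j i, mem_inter.2 ⟨mem_imgUnion.2 ⟨j, hj, i, rfl⟩,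
        mem_imgUnion.2 ⟨j', hj', i', hii.symm⟩⟩, ?_⟩
      rw [← hu, ← hi, pieceMap_leaf hA]
  rcases hH.edges_subset_or (fun e => ¬ PieceCovers ω A f Q e) hs hb with h | h
  · exact Or.inr (pieceCovers_of_uncovered_subset hH f hR fun x y hxy hn =>
      (hmem x).1 (h x y hxy hn))
  · refine Or.inl (pieceCovers_of_uncovered_subset hH f hR fun x y hxy hn =>
      (hmem x).1 (h x y hxy (not_not.2 ((hcov x y hxy).resolve_left hn))))

variable [DecidableEq J]

theorem exists_piece_of_covers {g : ℕ} (hH : NoSmallCut H) (hω : IsSparse g ω)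
    (hI : 2 ≤ Fintype.card {v // S.Adj a v}) (f : W ↪ Option (X ⊕ J × V)) (k : ℕ) :
    ∀ F : Finset J, #F = k → #F ≤ g →
      (∀ x y, H.Adj x y → PieceCovers ω A f F s(x, y)) →
      ∃ j, ∀ x y, H.Adj x y → PieceCovers ω A f {j} s(x, y) := by
  induction k with
  | zero =>
    intro F hF _ hcov
    obtain ⟨x⟩ := hH.nonempty
    obtain ⟨y, hxy⟩ := hH.exists_adj x
    obtain ⟨j, hj, -⟩ := hcov x y hxy
    rw [Finset.card_eq_zero] at hF
    simp [hF] at hj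
  | succ k ih =>
    intro F hF hFg hcov
    obtain ⟨j, hj, hleaf⟩ := hω.exists_leaf hI (Finset.card_pos.1 (by omega)) hFg
    have hc : #(F.erase j) = k := by rw [Finset.card_erase_of_mem hj, hF]; rfl
    have hcov' : ∀ x y, H.Adj x y → PieceCovers ω A f {j} s(x, y) ∨
        PieceCovers ω A f (F.erase j) s(x, y) := by
      intro x y hxy
      obtain ⟨j', hj', h⟩ := hcov x y hxy
      by_cases hjj : j' = j
      · exact Or.inl ⟨j', by simpa using hjj, h⟩
      · exact Or.inr ⟨j', Finset.mem_erase.2 ⟨hjj, hj'⟩, h⟩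
    rcases pieceCovers_split hH f (by simp) hleaf hcov' with h | h
    · exact ⟨j, h⟩
    · exact ih _ hc (by omega) h

/-- Every copy of `H` in the union of the pieces lies in a single piece. -/
theorem exists_piece_of_copy {g : ℕ} (hH : NoSmallCut H) (hω : IsSparse g ω)
    (hg : Fintype.card W ^ 2 ≤ g) (hI : 2 ≤ Fintype.card {v // S.Adj a v})
    (f : W ↪ Option (X ⊕ J × V)) (hf : ∀ x y, H.Adj x y → (pieceUnion ω A).Adj (f x) (f y)) :
    ∃ j, ∀ x y, H.Adj x y → ∃ v v', S.Adj v v' ∧ pieceMap ω A j v = f x ∧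
      pieceMap ω A j v' = f y := by
  have hg1 : 1 ≤ g := by
    have := hH.1
    nlinarith
  have hex : ∀ p : W × W, ∃ j, H.Adj p.1 p.2 → ∃ v v', S.Adj v v' ∧ pieceMap ω A j v = f p.1 ∧
      pieceMap ω A j v' = f p.2 := by
    intro p
    by_cases h : H.Adj p.1 p.2
    · obtain ⟨j, hj⟩ := (pieceUnion_adj fun j => hω.injective hg1 j).1 (hf _ _ h)
      exact ⟨j, fun _ => hj⟩
    · obtain ⟨x⟩ := hH.nonempty
      obtain ⟨y, hxy⟩ := hH.exists_adj x
      obtain ⟨j, hj⟩ := (pieceUnion_adj fun j => hω.injective hg1 j).1 (hf _ _ hxy)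
      exact ⟨j, fun h' => absurd h' h⟩
  choose t ht using hex
  obtain ⟨j, hj⟩ := exists_piece_of_covers (A := A) hH hω hI f _ (univ.image t) rfl
    (Finset.card_image_le.trans (by rwa [Finset.card_univ, Fintype.card_prod, ← sq]))
    fun x y hxy => pieceCovers_iff.2 ⟨t (x, y), mem_image_of_mem _ (mem_univ _), ht (x, y) hxy⟩
  refine ⟨j, fun x y hxy => ?_⟩
  obtain ⟨j', hj', h⟩ := pieceCovers_iff.1 (hj x y hxy)
  rw [Finset.mem_singleton] at hj'
  rwa [hj'] at h

end Pieces

/-- The vertices reachable from `x` in at most `i` steps avoiding `z`. -/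
def reachAvoiding {U : Type} (T : SimpleGraph U) (z x : U) : ℕ → Set U
  | 0 => {x}
  | i + 1 => reachAvoiding T z x i ∪ {p' | p' ≠ z ∧ ∃ p ∈ reachAvoiding T z x i, T.Adj p p'}

theorem exists_level {U : Type} (T : SimpleGraph U) (z x y : U) (L : ℕ)
    (hy : ∀ i < L, y ∉ reachAvoiding T z x i) :
    ∃ d : U → ℕ, d x = 0 ∧ d y = L ∧ ∀ p p', T.Adj p p' → p' ≠ z → d p' ≤ d p + 1 := by
  let D : U → Set ℕ := fun p => {i | p ∈ reachAvoiding T z x i} ∪ {L}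
  have hD : ∀ p, (D p).Nonempty := fun p => ⟨L, Or.inr rfl⟩
  refine ⟨fun p => sInf (D p), ?_, ?_, fun p p' hpp' hp' => ?_⟩
  · exact Nat.le_zero.1 (Nat.sInf_le (Or.inl rfl))
  · refine le_antisymm (Nat.sInf_le (Or.inr rfl)) ?_
    rcases Nat.sInf_mem (hD y) with h | h
    · by_contra! hlt
      exact hy _ hlt h
    · exact (Set.mem_singleton_iff.1 h).ge
  · rcases Nat.sInf_mem (hD p) with h | h
    · exact Nat.sInf_le (Or.inl (Or.inr ⟨hp', p, h, hpp'⟩))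
    · rw [Set.mem_singleton_iff] at h
      exact (Nat.sInf_le (Or.inr rfl)).trans (h.ge.trans (Nat.le_succ _))

section Distance

variable {V X J : Type} {S : SimpleGraph V} {a : V} [Fintype {v // S.Adj a v}] [DecidableEq X]
  [DecidableEq J] {ω : J → {v // S.Adj a v} → X} {A : Finset (J × {v // S.Adj a v})}

open Classical in
theorem exists_pieces_of_mem_reachAvoiding (hω : ∀ j, Function.Injective (ω j))
    (l : J × {v // S.Adj a v}) (i : ℕ) : ∀ p,
      p ∈ reachAvoiding (pieceUnion ω A) none (pieceMap ω A l.1 l.2) i →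
      p ≠ none ∧ ∃ F : Finset J, l.1 ∈ F ∧ #F ≤ i + 1 ∧ (∃ j ∈ F, ∃ v, pieceMap ω A j v = p) ∧
        #(imgUnion (fun j (i : {v // S.Adj a v}) => pieceMap ω A j i) F) ≤
          (Fintype.card {v // S.Adj a v} - 1) * #F + 1 := by
  have hm : 1 ≤ Fintype.card {v // S.Adj a v} := Fintype.card_pos_iff.2 ⟨l.2⟩
  induction i with
  | zero =>
    rintro p rfl
    refine ⟨fun h => l.2.2.ne' (pieceMap_eq_none.1 h), {l.1}, by simp, by simp,
      ⟨l.1, by simp, l.2, rfl⟩, ?_⟩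
    rw [imgUnion, singleton_biUnion]
    refine Finset.card_image_le.trans ?_
    rw [Finset.card_univ, card_singleton]; omega
  | succ i ih =>
    rintro p' (hp' | ⟨hp', p, hp, hadj⟩)
    · obtain ⟨h1, F, h2, h3, h4⟩ := ih p' hp'
      exact ⟨h1, F, h2, by omega, h4⟩
    refine ⟨hp', ?_⟩
    obtain ⟨h1, F, h2, h3, ⟨j, hj, v, hv⟩, h5⟩ := ih p hp
    obtain ⟨j', w, w', -, hw, hw'⟩ := (pieceUnion_adj hω).1 hadj
    by_cases hj' : j' ∈ F
    · exact ⟨F, h2, by omega, ⟨j', hj', w', hw'⟩, h5⟩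
    have hne : j ≠ j' := fun h => hj' (h ▸ hj)
    have hp_mem : p ∈ imgUnion (fun j (i : {v // S.Adj a v}) => pieceMap ω A j i) F ∩
        univ.image (fun i : {v // S.Adj a v} => pieceMap ω A j' i) := by
      rcases pieceMap_eq_cases hne (hv.trans hw.symm) with ⟨h, -⟩ | ⟨i, i', hi, hi', -⟩
      · rw [h, pieceMap_self] at hv; exact absurd hv.symm h1
      · rw [mem_inter, mem_imgUnion, mem_image]
        exact ⟨⟨j, hj, i, by rw [hi, hv]⟩, i', mem_univ _, by rw [hi', hw]⟩
    refine ⟨insert j' F, mem_insert_of_mem h2, by rw [card_insert_of_notMem hj']; omega,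
      ⟨j', mem_insert_self _ _, w', hw'⟩, ?_⟩
    have hun : imgUnion (fun j (i : {v // S.Adj a v}) => pieceMap ω A j i) (insert j' F) =
        imgUnion (fun j (i : {v // S.Adj a v}) => pieceMap ω A j i) F ∪
        univ.image (fun i : {v // S.Adj a v} => pieceMap ω A j' i) := by
      rw [imgUnion, biUnion_insert, union_comm]; rfl
    have h6 := Finset.card_union_add_card_inter
      (imgUnion (fun j (i : {v // S.Adj a v}) => pieceMap ω A j i) F)
      (univ.image (fun i : {v // S.Adj a v} => pieceMap ω A j' i))
    have h7 : #(univ.image (fun i : {v // S.Adj a v} => pieceMap ω A j' i)) ≤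
        Fintype.card {v // S.Adj a v} := Finset.card_image_le
    have h8 := Finset.card_pos.2 ⟨p, hp_mem⟩
    rw [hun, card_insert_of_notMem hj', Nat.mul_add, Nat.mul_one]
    omega

/-- An identified leaf is far away from a private leaf with the same label. -/
theorem notMem_reachAvoiding {g : ℕ} (hω : IsSparse g ω) (l l' : J × {v // S.Adj a v})
    (hl : l ∉ A) (hl' : l' ∈ A) (hll : ω l'.1 l'.2 = ω l.1 l.2) {i : ℕ} (hi : i < g) :
    pieceMap ω A l'.1 l'.2 ∉
      reachAvoiding (pieceUnion ω A) none (pieceMap ω A l.1 l.2) i := by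
  classical
  intro hmem
  have hm : 1 ≤ Fintype.card {v // S.Adj a v} := Fintype.card_pos_iff.2 ⟨l.2⟩
  obtain ⟨-, F, hlF, hF, ⟨j, hj, v, hv⟩, hcard⟩ :=
    exists_pieces_of_mem_reachAvoiding (fun j => hω.injective (by omega) j) l i _ hmem
  set Z := imgUnion (fun j (i : {v // S.Adj a v}) => pieceMap ω A j i) F with hZ
  have hy : pieceMap ω A l'.1 l'.2 = some (Sum.inl (ω l'.1 l'.2)) := pieceMap_leaf hl'
  have hx : pieceMap ω A l.1 l.2 = some (Sum.inr (l.1, l.2.1)) := pieceMap_leaf_notMem hl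
  rw [hy] at hv
  obtain ⟨i1, hi1, hA1, hω1⟩ := pieceMap_eq_inl.1 hv
  have hyZ : some (Sum.inl (ω l'.1 l'.2)) ∈ Z :=
    mem_imgUnion.2 ⟨j, hj, i1, by rw [hi1, hv]⟩
  have hxZ : some (Sum.inr (l.1, l.2.1)) ∈ Z := mem_imgUnion.2 ⟨l.1, hlF, l.2, hx⟩
  let π : Option (X ⊕ J × V) → X := fun p => match p with
    | none => ω l.1 l.2
    | some (Sum.inl n) => n
    | some (Sum.inr (j, v)) => if h : S.Adj a v then ω j ⟨v, h⟩ else ω l.1 l.2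
  have hπ : ∀ j (i : {v // S.Adj a v}), π (pieceMap ω A j i) = ω j i := by
    intro j i
    by_cases h : (j, i) ∈ A
    · rw [pieceMap_leaf h]
    · rw [pieceMap_leaf_notMem h]
      simp only [π, i.2, dif_pos]
  have hsub : imgUnion ω F ⊆ (Z.erase (some (Sum.inr (l.1, l.2.1)))).image π := by
    intro n hn
    obtain ⟨j2, hj2, i2, rfl⟩ := mem_imgUnion.1 hn
    by_cases hp : pieceMap ω A j2 i2 = some (Sum.inr (l.1, l.2.1))
    · refine mem_image.2 ⟨_, mem_erase.2 ⟨?_, hyZ⟩, ?_⟩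
      · simp
      · rw [← hy, hπ, hll, ← hπ, hx, ← hp, hπ]
    · exact mem_image.2 ⟨_, mem_erase.2 ⟨hp, mem_imgUnion.2 ⟨j2, hj2, i2, rfl⟩⟩, hπ _ _⟩
  have h1 := (Finset.card_le_card hsub).trans Finset.card_image_le
  rw [Finset.card_erase_of_mem hxZ] at h1
  have h2 := hω F ⟨_, hlF⟩ (by omega)
  omega

end Distance

/-- `T` is not Ramsey, but good colourings give `zx` and `zy` different colours; the level function
`d` shows that `x` and `y` have distance at least `L` in `T - z`. -/
structure IsSender (q : ℕ) {U W : Type} (H : SimpleGraph W) (T : SimpleGraph U) (z x y : U)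
    (d : U → ℕ) (L : ℕ) : Prop where
  adj_left : T.Adj z x
  adj_right : T.Adj z y
  not_isRamsey : ¬ IsRamsey q T H
  ne : ∀ c : Sym2 U → Fin q, ¬ HasMonoCopy T H c → c s(z, x) ≠ c s(z, y)
  level_left : d x = 0
  level_right : d y = L
  level_step : ∀ p p', T.Adj p p' → p' ≠ z → d p' ≤ d p + 1

/-- Senders exist, with the two edges arbitrarily far apart. -/
theorem exists_sender {q : ℕ} (hq : 2 ≤ q) {W : Type} [Fintype W] {H : SimpleGraph W}
    (hH : NoSmallCut H) (L : ℕ) :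
    ∃ (U : Type) (_ : Finite U) (T : SimpleGraph U) (z x y : U) (d : U → ℕ),
      IsSender q H T z x y d L := by
  classical
  have : NeZero q := ⟨by omega⟩
  obtain ⟨n, S, a, hS, hstar⟩ := exists_star_not_const hq hH
  have hI : 2 ≤ Fintype.card {v // S.Adj a v} := by
    unfold IsRamsey at hS
    push Not at hS
    obtain ⟨c, hc⟩ := hS
    obtain ⟨v, v', hv, hv', hne⟩ := hstar c hc
    refine Fintype.one_lt_card_iff.2 ⟨⟨v, hv⟩, ⟨v', hv'⟩, fun h => hne ?_⟩
    rw [Subtype.mk.inj h]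
  set g := Fintype.card W ^ 2 + L + 2 with hg
  obtain ⟨N, M, ω, hω, hmono⟩ := exists_isSparse_not_colorable hI q g (by omega)
  have hinj : ∀ j, Function.Injective (ω j) := fun j => hω.injective (by omega) j
  let Sol : Finset (Fin M × {v // S.Adj a v}) → Prop := fun A =>
    ∃ c : Fin M → Sym2 (Fin n) → Fin q, (∀ j, ¬ HasMonoCopy S H (c j)) ∧
      ∀ l ∈ A, ∀ l' ∈ A, ω l.1 l.2 = ω l'.1 l'.2 → c l.1 s(a, l.2) = c l'.1 s(a, l'.2)
  have hSol0 : Sol ∅ := by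
    unfold IsRamsey at hS
    push Not at hS
    obtain ⟨c, hc⟩ := hS
    exact ⟨fun _ => c, fun _ => hc, by simp⟩
  have hSol1 : ¬ Sol univ := by
    rintro ⟨c, hc, hA⟩
    obtain ⟨φ, hφ⟩ := exists_fun_of_rel
      (fun (x : Fin N) (col : Fin q) => ∃ l : Fin M × {v // S.Adj a v}, ω l.1 l.2 = x ∧
        c l.1 s(a, l.2) = col) (by
        rintro x b b' ⟨l, h1, h2⟩ ⟨l', h1', h2'⟩
        rw [← h2, ← h2']
        exact hA l (mem_univ _) l' (mem_univ _) (h1.trans h1'.symm))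
    obtain ⟨j, hj⟩ := hmono φ
    obtain ⟨v, v', hv, hv', hne⟩ := hstar (c j) (hc j)
    have h1 := hφ _ _ ⟨(j, ⟨v, hv⟩), rfl, rfl⟩
    have h2 := hφ _ _ ⟨(j, ⟨v', hv'⟩), rfl, rfl⟩
    exact hne (h1.symm.trans ((hj ⟨v, hv⟩ ⟨v', hv'⟩).trans h2))
  obtain ⟨A, l, hl, hA, hlA⟩ : ∃ A l, l ∉ A ∧ Sol A ∧ ¬ Sol (insert l A) := by
    by_contra! hcon
    exact hSol1 (Finset.induction_on univ hSol0 fun l A hl hA => hcon A l hl hA)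
  obtain ⟨c, hc, hcA⟩ := hA
  obtain ⟨l', hl', hll⟩ : ∃ l' ∈ A, ω l'.1 l'.2 = ω l.1 l.2 := by
    by_contra! hcon
    refine hlA ⟨c, hc, fun l1 h1 l2 h2 he => ?_⟩
    rw [mem_insert] at h1 h2
    rcases h1 with rfl | h1 <;> rcases h2 with rfl | h2
    · rfl
    · exact absurd he.symm (hcon _ h2)
    · exact absurd he (hcon _ h1)
    · exact hcA _ h1 _ h2 he
  have hadj : ∀ l : Fin M × {v // S.Adj a v},
      (pieceUnion ω A).Adj none (pieceMap ω A l.1 l.2) := fun l =>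
    (pieceUnion_adj hinj).2 ⟨l.1, a, l.2, l.2.2, pieceMap_self, rfl⟩
  obtain ⟨d, hdx, hdy, hd⟩ := exists_level (pieceUnion ω A) none (pieceMap ω A l.1 l.2)
    (pieceMap ω A l'.1 l'.2) L fun i hi => notMem_reachAvoiding hω l l' hl hl' hll (by omega)
  refine ⟨_, inferInstance, pieceUnion ω A, none, _, _, d, hadj l, hadj l', ?_, ?_, hdx, hdy, hd⟩
  · obtain ⟨C, hC⟩ := exists_fun_of_rel
      (fun (e : Sym2 (Option (Fin N ⊕ Fin M × Fin n))) (col : Fin q) => ∃ j v v', S.Adj v v' ∧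
        s(pieceMap ω A j v, pieceMap ω A j v') = e ∧ c j s(v, v') = col) (by
        rintro e b b' ⟨j, v, v', hv, rfl, rfl⟩ ⟨j', w, w', hw, he, rfl⟩
        by_cases hj : j = j'
        · subst hj
          rw [← Sym2.map_mk, ← Sym2.map_mk] at he
          rw [Sym2.map.injective (pieceMap_injective (hinj j)) he]
        have key : ∀ w w', S.Adj w w' → pieceMap ω A j' w = pieceMap ω A j v →
            pieceMap ω A j' w' = pieceMap ω A j v' → c j s(v, v') = c j' s(w, w') := by
          intro w w' hw h1 h2
          rcases pieceMap_eq_cases hj h1.symm with ⟨rfl, rfl⟩ | ⟨i, i', rfl, rfl, h3, h4, h5⟩ <;>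
          rcases pieceMap_eq_cases hj h2.symm with ⟨h, h'⟩ | ⟨k, k', rfl, rfl, h3', h4', h5'⟩
          · exact absurd h.symm hv.ne
          · exact hcA _ h3' _ h4' h5'
          · rw [h, h', Sym2.eq_swap, Sym2.eq_swap (a := i'.1)]
            exact hcA _ h3 _ h4 h5
          · have h6 := Finset.card_le_one.1 (hω.card_inter_le_one hI (by omega) hj)
              (ω j i) (mem_inter.2 ⟨mem_imgUnion.2 ⟨j, by simp, i, rfl⟩,
                mem_imgUnion.2 ⟨j', by simp, i', h5.symm⟩⟩)
              (ω j k) (mem_inter.2 ⟨mem_imgUnion.2 ⟨j, by simp, k, rfl⟩,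
                mem_imgUnion.2 ⟨j', by simp, k', h5'.symm⟩⟩)
            exact absurd (congrArg Subtype.val (hinj j h6)) hv.ne
        rcases Sym2.eq_iff.1 he with ⟨h1, h2⟩ | ⟨h1, h2⟩
        · exact key w w' hw h1 h2
        · rw [key w' w hw.symm h2 h1, Sym2.eq_swap])
    intro hR
    obtain ⟨i, f, hf⟩ := hR C
    obtain ⟨j, hj⟩ := exists_piece_of_copy hH hω (by omega) hI f fun x y hxy => (hf x y hxy).1
    refine hc j (hasMonoCopy_of_map (i := i) hH (pieceMap ω A j)
      (pieceMap_injective (hinj j)) f fun x y hxy => ?_)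
    obtain ⟨v, v', hv, h1, h2⟩ := hj x y hxy
    refine ⟨v, v', hv, h1, h2, ?_⟩
    rw [← (hf x y hxy).2, hC _ _ ⟨j, v, v', hv, by rw [h1, h2], rfl⟩]
  · intro C hC heq
    refine hlA ⟨fun j e => C (e.map (pieceMap ω A j)), fun j =>
      not_hasMonoCopy_comap hC ⟨_, pieceMap_injective (hinj j)⟩ fun v v' hv =>
        (pieceUnion_adj hinj).2 ⟨j, v, v', hv, rfl, rfl⟩, ?_⟩
    have hval : ∀ l : Fin M × {v // S.Adj a v}, C ((s(a, l.2.1)).map (pieceMap ω A l.1)) =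
        C s(none, pieceMap ω A l.1 l.2) := fun l => by rw [Sym2.map_mk, pieceMap_self]
    intro l1 h1 l2 h2 he
    beta_reduce
    rw [hval, hval]
    have hl2 : ∀ l2 ∈ A, ω l.1 l.2 = ω l2.1 l2.2 →
        C s(none, pieceMap ω A l.1 l.2) = C s(none, pieceMap ω A l2.1 l2.2) := by
      intro l2 h2 he
      rw [heq, pieceMap_leaf hl', pieceMap_leaf h2, hll, he]
    rw [mem_insert] at h1 h2
    rcases h1 with rfl | h1 <;> rcases h2 with rfl | h2
    · rfl
    · exact hl2 _ h2 he
    · exact (hl2 _ h1 he.symm).symm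
    · rw [pieceMap_leaf h1, pieceMap_leaf h2, he]

theorem exists_perm_pair {α : Type*} [DecidableEq α] {a b a' b' : α} (h : a ≠ b) (h' : a' ≠ b') :
    ∃ σ : Equiv.Perm α, σ a = a' ∧ σ b = b' := by
  have hne : Equiv.swap a a' b ≠ a' := fun hb => h ((Equiv.swap a a').injective (by
    rw [hb, Equiv.swap_apply_left]))
  refine ⟨(Equiv.swap a a').trans (Equiv.swap (Equiv.swap a a' b) b'), ?_, ?_⟩
  · rw [Equiv.trans_apply, Equiv.swap_apply_left, Equiv.swap_apply_of_ne_of_ne hne.symm h']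
  · rw [Equiv.trans_apply, Equiv.swap_apply_left]

theorem not_hasMonoCopy_perm {V W : Type} {G : SimpleGraph V} {H : SimpleGraph W} {q : ℕ}
    {c : Sym2 V → Fin q} (hc : ¬ HasMonoCopy G H c) (σ : Equiv.Perm (Fin q)) :
    ¬ HasMonoCopy G H fun e => σ (c e) := by
  rintro ⟨i, f, hf⟩
  exact hc ⟨σ.symm i, f, fun a b hab =>
    ⟨(hf a b hab).1, by rw [← (hf a b hab).2, Equiv.symm_apply_apply]⟩⟩

/-- A family of pairs of distinct edges of `B` sharing the vertex `hub ν`. -/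
structure IsConflictSystem {VB N : Type} (B : SimpleGraph VB) (hub lft rgt : N → VB) : Prop where
  adj_left : ∀ ν, B.Adj (hub ν) (lft ν)
  adj_right : ∀ ν, B.Adj (hub ν) (rgt ν)
  ne : ∀ ν, lft ν ≠ rgt ν

section Assembly

variable {VB N U W : Type}

open Classical in
/-- The embedding of the copy of the sender responsible for the conflict `ν`. -/
noncomputable def attachMap (hub lft rgt : N → VB) (z x y : U) (ν : N) (p : U) : VB ⊕ N × U :=
  if p = z then Sum.inl (hub ν) else if p = x then Sum.inl (lft ν)
  else if p = y then Sum.inl (rgt ν) else Sum.inr (ν, p)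

/-- The graph obtained from `B` by attaching a sender to each conflicting pair of edges. -/
def attachGraph (B : SimpleGraph VB) (hub lft rgt : N → VB) (T : SimpleGraph U) (z x y : U) :
    SimpleGraph (VB ⊕ N × U) :=
  SimpleGraph.fromRel fun p p' => (∃ b b', B.Adj b b' ∧ Sum.inl b = p ∧ Sum.inl b' = p') ∨
    ∃ ν u u', T.Adj u u' ∧ attachMap hub lft rgt z x y ν u = p ∧
      attachMap hub lft rgt z x y ν u' = p'

variable {B : SimpleGraph VB} {hub lft rgt : N → VB} {T : SimpleGraph U} {z x y : U}
  {d : U → ℕ} {L q : ℕ} {H : SimpleGraph W}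

local notation "θ" => attachMap hub lft rgt z x y
local notation "Γ" => attachGraph B hub lft rgt T z x y

theorem attachMap_hub (ν : N) : θ ν z = Sum.inl (hub ν) := by simp [attachMap]

theorem eq_of_attachMap_eq_inr {ν ν' : N} {p p' : U} (h : θ ν p = Sum.inr (ν', p')) :
    ν = ν' ∧ p = p' := by
  unfold attachMap at h
  split_ifs at h
  simpa using h

theorem attachMap_cases (ν : N) (p : U) :
    p = z ∨ p = x ∨ p = y ∨ (p ≠ z ∧ p ≠ x ∧ p ≠ y ∧ θ ν p = Sum.inr (ν, p)) := by
  unfold attachMap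
  by_cases h1 : p = z <;> by_cases h2 : p = x <;> by_cases h3 : p = y <;> simp [h1, h2, h3]

namespace IsSender

theorem left_ne_right (hT : IsSender q H T z x y d L) (hL : 2 ≤ L) : x ≠ y := fun h => by
  have h1 := hT.level_left
  have h2 := hT.level_right
  rw [h] at h1; omega

theorem not_adj (hT : IsSender q H T z x y d L) (hL : 2 ≤ L) : ¬ T.Adj x y := fun h => by
  have h1 := hT.level_left
  have h2 := hT.level_right
  have h3 := hT.level_step x y h hT.adj_right.ne'
  omega

theorem attachMap_left (hT : IsSender q H T z x y d L) (ν : N) :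
    θ ν x = Sum.inl (lft ν) := by
  simp [attachMap, hT.adj_left.ne']

theorem attachMap_right (hT : IsSender q H T z x y d L) (hL : 2 ≤ L) (ν : N) :
    θ ν y = Sum.inl (rgt ν) := by
  simp [attachMap, hT.adj_right.ne', (hT.left_ne_right hL).symm]

theorem attachMap_injective (hT : IsSender q H T z x y d L) (hL : 2 ≤ L)
    (hK : IsConflictSystem B hub lft rgt) (ν : N) : Function.Injective (θ ν) := by
  have h1 := (hK.adj_left ν).ne
  have h2 := (hK.adj_right ν).ne
  have h3 := hK.ne ν
  have e1 := attachMap_hub (hub := hub) (lft := lft) (rgt := rgt) (z := z) (x := x) (y := y) ν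
  have e2 := hT.attachMap_left (hub := hub) (lft := lft) (rgt := rgt) ν
  have e3 := hT.attachMap_right (hub := hub) (lft := lft) (rgt := rgt) hL ν
  intro p p' h
  have key : ∀ w : U, (w = z ∧ θ ν w = Sum.inl (hub ν)) ∨ (w = x ∧ θ ν w = Sum.inl (lft ν)) ∨
      (w = y ∧ θ ν w = Sum.inl (rgt ν)) ∨ θ ν w = Sum.inr (ν, w) := by
    intro w
    rcases attachMap_cases (hub := hub) (lft := lft) (rgt := rgt) (z := z) (x := x) (y := y) ν w
      with h | h | h | ⟨-, -, -, h⟩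
    · exact Or.inl ⟨h, h ▸ e1⟩
    · exact Or.inr (Or.inl ⟨h, h ▸ e2⟩)
    · exact Or.inr (Or.inr (Or.inl ⟨h, h ▸ e3⟩))
    · exact Or.inr (Or.inr (Or.inr h))
  rcases key p with ⟨h4, h5⟩ | ⟨h4, h5⟩ | ⟨h4, h5⟩ | h5 <;>
  rcases key p' with ⟨h6, h7⟩ | ⟨h6, h7⟩ | ⟨h6, h7⟩ | h7 <;>
  rw [h5, h7] at h <;> simp at h <;> grind

theorem attachGraph_adj (hT : IsSender q H T z x y d L) (hL : 2 ≤ L)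
    (hK : IsConflictSystem B hub lft rgt) {p p' : VB ⊕ N × U} :
    (Γ).Adj p p' ↔ (∃ b b', B.Adj b b' ∧ Sum.inl b = p ∧ Sum.inl b' = p') ∨
      ∃ ν u u', T.Adj u u' ∧ θ ν u = p ∧ θ ν u' = p' := by
  rw [attachGraph, fromRel_adj]
  constructor
  · rintro ⟨-, h | ⟨b, b', h, h1, h2⟩ | ⟨ν, u, u', h, h1, h2⟩⟩
    · exact h
    · exact Or.inl ⟨b', b, h.symm, h2, h1⟩
    · exact Or.inr ⟨ν, u', u, h.symm, h2, h1⟩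
  · rintro (⟨b, b', h, rfl, rfl⟩ | ⟨ν, u, u', h, rfl, rfl⟩)
    · exact ⟨fun he => h.ne (Sum.inl_injective he), Or.inl (Or.inl ⟨b, b', h, rfl, rfl⟩)⟩
    · exact ⟨fun he => h.ne (hT.attachMap_injective hL hK ν he),
        Or.inl (Or.inr ⟨ν, u, u', h, rfl, rfl⟩)⟩

/-- An edge at an interior vertex of a sender belongs to that sender. -/
theorem adj_of_interior (hT : IsSender q H T z x y d L) (hL : 2 ≤ L)
    (hK : IsConflictSystem B hub lft rgt) {ν : N} {u : U} {p' : VB ⊕ N × U}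
    (h : (Γ).Adj (Sum.inr (ν, u)) p') : ∃ u', T.Adj u u' ∧ θ ν u' = p' := by
  rcases (hT.attachGraph_adj hL hK).1 h with ⟨b, b', -, h1, -⟩ | ⟨ν', w, w', hw, h1, h2⟩
  · cases h1
  · obtain ⟨rfl, rfl⟩ := eq_of_attachMap_eq_inr h1
    exact ⟨w', hw, h2⟩

variable [Fintype W]

theorem copy_in_sender_of_side (hT : IsSender q H T z x y d L) (hL : 2 ≤ L)
    (hK : IsConflictSystem B hub lft rgt) (hH : NoSmallCut H) (f : W ↪ VB ⊕ N × U)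
    (hf : ∀ a b, H.Adj a b → (Γ).Adj (f a) (f b)) (ν : N) (Q : U → Prop) (r : U)
    (hr : T.Adj z r) (hr' : ∃ b, θ ν r = Sum.inl b)
    (hQ : ∀ u, Q u → u ≠ z → u ≠ r → θ ν u = Sum.inr (ν, u))
    (hcross : ∀ a b u u', H.Adj a b → T.Adj u u' → θ ν u = f a → θ ν u' = f b → u ≠ z → u' ≠ z →
      Q u → Q u') (a₀ : W) (u₀ : U) (ha₀ : f a₀ = Sum.inr (ν, u₀)) (hu₀ : θ ν u₀ = f a₀)
    (hu₀z : u₀ ≠ z) (hQ₀ : Q u₀) :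
    ∀ a b, H.Adj a b → ∃ u u', T.Adj u u' ∧ θ ν u = f a ∧ θ ν u' = f b := by
  classical
  let D : Sym2 W → Prop := fun e => ∃ u u', T.Adj u u' ∧ s(θ ν u, θ ν u') = e.map f ∧ u ≠ z ∧ Q u
  have hD : ∀ a b, D s(a, b) → ∃ u u', T.Adj u u' ∧ θ ν u = f a ∧ θ ν u' = f b ∧
      ((u ≠ z ∧ Q u) ∨ (u' ≠ z ∧ Q u')) := by
    rintro a b ⟨u, u', h, he, hu⟩
    rw [Sym2.map_mk] at he
    rcases Sym2.eq_iff.1 he with ⟨h1, h2⟩ | ⟨h1, h2⟩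
    · exact ⟨u, u', h, h1, h2, Or.inl hu⟩
    · exact ⟨u', u, h.symm, h2, h1, Or.inr hu⟩
  let s : Finset W := {a | f a = θ ν z ∨ f a = θ ν r}
  have hmem : ∀ a, a ∈ s ↔ f a = θ ν z ∨ f a = θ ν r := fun a => by simp [s]
  have hs : #s ≤ 2 := by
    rw [← Finset.card_map f]
    refine (Finset.card_le_card (t := {θ ν z, θ ν r}) fun p hp => ?_).trans Finset.card_le_two
    obtain ⟨a, ha, rfl⟩ := Finset.mem_map.1 hp
    simpa using (hmem a).1 ha
  have hin : ∀ a b u, H.Adj a b → θ ν u = f a → f a = Sum.inr (ν, u) → u ≠ z → Q u →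
      D s(a, b) := by
    intro a b u hab h1 h2 h3 h4
    have h5 := hf a b hab
    rw [h2] at h5
    obtain ⟨u', h6, h7⟩ := hT.adj_of_interior hL hK h5
    exact ⟨u, u', h6, by rw [Sym2.map_mk, h1, h7], h3, h4⟩
  have hb : ∀ v a b, H.Adj v a → H.Adj v b → D s(v, a) → ¬ D s(v, b) → v ∈ s := by
    intro v a b hva hvb h1 h2
    obtain ⟨u, u', huu, h3, h4, h5⟩ := hD v a h1
    rw [hmem]
    by_cases huz : u = z
    · exact Or.inl (by rw [← h3, huz])
    have hQu : Q u := by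
      rcases h5 with h5 | h5
      · exact h5.2
      · exact hcross a v u' u hva.symm huu.symm h4 h3 h5.1 huz h5.2
    by_cases hur : u = r
    · exact Or.inr (by rw [← h3, hur])
    · exact absurd (hin v b u hvb h3 (h3.symm.trans (hQ u hQu huz hur)) huz hQu) h2
  rcases hH.edges_subset_or D hs hb with h | h
  · obtain ⟨b, hb⟩ := hH.exists_adj a₀
    have h1 := (hmem a₀).1 (h a₀ b hb (hin a₀ b u₀ hb hu₀ ha₀ hu₀z hQ₀))
    obtain ⟨b', hb'⟩ := hr'
    rw [attachMap_hub, hb', ha₀] at h1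
    simp at h1
  · intro a b hab
    by_cases hDab : D s(a, b)
    · obtain ⟨u, u', h1, h2, h3, -⟩ := hD a b hDab
      exact ⟨u, u', h1, h2, h3⟩
    · have h1 := (hmem a).1 (h a b hab hDab)
      have h2 := (hmem b).1 (h b a hab.symm (by rwa [Sym2.eq_swap]))
      rcases h1 with h1 | h1 <;> rcases h2 with h2 | h2
      · exact absurd (f.injective (h1.trans h2.symm)) hab.ne
      · exact ⟨z, r, hr, h1.symm, h2.symm⟩
      · exact ⟨r, z, hr.symm, h1.symm, h2.symm⟩
      · exact absurd (f.injective (h1.trans h2.symm)) hab.ne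

/-- If `B` contains no copy of `H`, every copy of `H` in the assembled graph lies in a sender. -/
theorem exists_sender_of_copy (hT : IsSender q H T z x y d (Fintype.card W + 2))
    (hK : IsConflictSystem B hub lft rgt) (hH : NoSmallCut H)
    (hB : ∀ f : W ↪ VB, ∃ a b, H.Adj a b ∧ ¬ B.Adj (f a) (f b)) (f : W ↪ VB ⊕ N × U)
    (hf : ∀ a b, H.Adj a b → (Γ).Adj (f a) (f b)) :
    ∃ ν, ∀ a b, H.Adj a b → ∃ u u', T.Adj u u' ∧ θ ν u = f a ∧ θ ν u' = f b := by
  classical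
  have hL : 2 ≤ Fintype.card W + 2 := by omega
  have hinterior : ∃ a ν u, u ≠ z ∧ u ≠ x ∧ u ≠ y ∧ f a = Sum.inr (ν, u) ∧ θ ν u = f a := by
    by_contra! hcon
    have hbase : ∀ a b, H.Adj a b → ∃ v v', B.Adj v v' ∧ Sum.inl v = f a ∧ Sum.inl v' = f b := by
      intro a b hab
      rcases (hT.attachGraph_adj hL hK).1 (hf a b hab) with h | ⟨ν, u, u', huu, h1, h2⟩
      · exact h
      have e1 := attachMap_hub (hub := hub) (lft := lft) (rgt := rgt) (z := z) (x := x) (y := y) ν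
      have e2 := hT.attachMap_left (hub := hub) (lft := lft) (rgt := rgt) ν
      have e3 := hT.attachMap_right (hub := hub) (lft := lft) (rgt := rgt) hL ν
      have hxy := hT.not_adj hL
      have key : ∀ w a, θ ν w = f a → w = z ∨ w = x ∨ w = y := by
        intro w a hw
        rcases attachMap_cases (hub := hub) (lft := lft) (rgt := rgt) (z := z) (x := x) (y := y) ν w
          with h | h | h | ⟨h3, h4, h5, h6⟩
        · exact Or.inl h
        · exact Or.inr (Or.inl h)
        · exact Or.inr (Or.inr h)
        · exact absurd hw (hcon a ν w h3 h4 h5 (hw.symm.trans h6))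
      rcases key u a h1 with h | h | h <;> rcases key u' b h2 with h' | h' | h' <;>
        rw [h] at h1 huu <;> rw [h'] at h2 huu
      · exact absurd rfl huu.ne
      · exact ⟨_, _, hK.adj_left ν, e1.symm.trans h1, e2.symm.trans h2⟩
      · exact ⟨_, _, hK.adj_right ν, e1.symm.trans h1, e3.symm.trans h2⟩
      · exact ⟨_, _, (hK.adj_left ν).symm, e2.symm.trans h1, e1.symm.trans h2⟩
      · exact absurd rfl huu.ne
      · exact absurd huu hxy
      · exact ⟨_, _, (hK.adj_right ν).symm, e3.symm.trans h1, e1.symm.trans h2⟩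
      · exact absurd huu.symm hxy
      · exact absurd rfl huu.ne
    have hg : ∀ a, ∃ v, Sum.inl v = f a := fun a => by
      obtain ⟨b, hab⟩ := hH.exists_adj a
      obtain ⟨v, v', -, h, -⟩ := hbase a b hab
      exact ⟨v, h⟩
    choose g hg using hg
    have hgi : Function.Injective g := fun a b hab => f.injective (by rw [← hg, ← hg, hab])
    obtain ⟨a, b, hab, hn⟩ := hB ⟨g, hgi⟩
    obtain ⟨v, v', hvv, h1, h2⟩ := hbase a b hab
    refine hn ?_
    change B.Adj (g a) (g b)
    rwa [Sum.inl_injective ((hg a).trans h1.symm), Sum.inl_injective ((hg b).trans h2.symm)]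
  obtain ⟨a₀, ν, u₀, hz, hx, hy, ha₀, hu₀⟩ := hinterior
  let lev : W → ℕ := fun a => match f a with
    | Sum.inl _ => 0
    | Sum.inr (_, u) => d u
  obtain ⟨t, ht, htlev⟩ := Finset.exists_mem_notMem_of_card_lt_card
    (show #(univ.image lev) < #(Icc 1 (Fintype.card W + 1)) by
      refine Finset.card_image_le.trans_lt ?_
      rw [Nat.card_Icc, Finset.card_univ]; omega)
  rw [mem_Icc] at ht
  have hlev : ∀ a u, u ≠ z → θ ν u = f a → d u ≠ t := by
    intro a u huz h
    rcases attachMap_cases (hub := hub) (lft := lft) (rgt := rgt) (z := z) (x := x) (y := y) ν u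
        with h1 | rfl | rfl | ⟨-, -, -, h6⟩
    · exact absurd h1 huz
    · rw [hT.level_left]; omega
    · rw [hT.level_right]; omega
    · rintro rfl
      refine htlev (mem_image.2 ⟨a, mem_univ _, ?_⟩)
      simp only [lev, ← h, h6]
  have hin : ∀ u, u ≠ z → u ≠ x → u ≠ y → θ ν u = Sum.inr (ν, u) := fun u h1 h2 h3 => by
    simp [attachMap, h1, h2, h3]
  rcases lt_or_gt_of_ne (hlev a₀ u₀ hz hu₀) with hlt | hgt
  · refine ⟨ν, hT.copy_in_sender_of_side hL hK hH f hf ν (fun u => d u < t) x hT.adj_left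
      ⟨_, hT.attachMap_left ν⟩ ?_ ?_ a₀ u₀ ha₀ hu₀ hz hlt⟩
    · intro u hu h1 h2
      refine hin u h1 h2 ?_
      rintro rfl
      have := hT.level_right
      omega
    · intro a b u u' _ huu _ h2 _ hz' hu
      have h3 := hT.level_step u u' huu hz'
      have h4 := hlev b u' hz' h2
      omega
  · refine ⟨ν, hT.copy_in_sender_of_side hL hK hH f hf ν (fun u => t < d u) y hT.adj_right
      ⟨_, hT.attachMap_right hL ν⟩ ?_ ?_ a₀ u₀ ha₀ hu₀ hz hgt⟩
    · intro u hu h1 h2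
      refine hin u h1 ?_ h2
      rintro rfl
      have := hT.level_left
      omega
    · intro a b u u' _ huu _ h2 hz hz' hu
      have h3 := hT.level_step u' u huu.symm hz
      have h4 := hlev b u' hz' h2
      omega

end IsSender
end Assembly

theorem IsSender.exists_good_of_le {U W VB N : Type} {q : ℕ} {H : SimpleGraph W}
    {T : SimpleGraph U} {z x y : U} {d : U → ℕ} {L : ℕ} (hT : IsSender q H T z x y d L)
    {Y : SimpleGraph (VB ⊕ N × U)} {c : Sym2 VB → Fin q} (hq : 2 ≤ q) {h l r : VB}
    (hc : ¬ (Y.Adj (Sum.inl h) (Sum.inl l) ∧ Y.Adj (Sum.inl h) (Sum.inl r) ∧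
      c s(h, l) = c s(h, r))) :
    ∃ τ : Sym2 U → Fin q, ¬ HasMonoCopy T H τ ∧
      (Y.Adj (Sum.inl h) (Sum.inl l) → τ s(z, x) = c s(h, l)) ∧
      (Y.Adj (Sum.inl h) (Sum.inl r) → τ s(z, y) = c s(h, r)) := by
  have hT' := hT.not_isRamsey
  rw [IsRamsey] at hT'
  push Not at hT'
  obtain ⟨τ, hτ⟩ := hT'
  have hne := hT.ne τ hτ
  have : Nontrivial (Fin q) := Fin.nontrivial_iff_two_le.2 hq
  obtain ⟨α, β, hαβ, h1, h2⟩ : ∃ α β : Fin q, α ≠ β ∧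
      (Y.Adj (Sum.inl h) (Sum.inl l) → α = c s(h, l)) ∧
      (Y.Adj (Sum.inl h) (Sum.inl r) → β = c s(h, r)) := by
    by_cases hl : Y.Adj (Sum.inl h) (Sum.inl l)
    · by_cases hr : Y.Adj (Sum.inl h) (Sum.inl r)
      · exact ⟨_, _, fun he => hc ⟨hl, hr, he⟩, fun _ => rfl, fun _ => rfl⟩
      · obtain ⟨β, hβ⟩ := exists_ne (c s(h, l))
        exact ⟨_, β, hβ.symm, fun _ => rfl, fun h => absurd h hr⟩
    · obtain ⟨α, hα⟩ := exists_ne (c s(h, r))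
      exact ⟨α, _, hα, fun h => absurd h hl, fun _ => rfl⟩
  obtain ⟨σ, h3, h4⟩ := exists_perm_pair hne hαβ
  exact ⟨_, not_hasMonoCopy_perm hτ σ, fun h => h3.trans (h1 h), fun h => h4.trans (h2 h)⟩

/-- A graph `B` with a system of conflicts that no colouring avoids extends to a Ramsey graph such
that the conflicts present in any Ramsey subgraph are still unavoidable. -/
theorem exists_assembly {W VB N : Type} [Fintype W] [Finite VB] [Finite N] {q : ℕ} (hq : 2 ≤ q)
    {H : SimpleGraph W} (hH : NoSmallCut H) {B : SimpleGraph VB} {hub lft rgt : N → VB}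
    (hB : ∀ f : W ↪ VB, ∃ a b, H.Adj a b ∧ ¬ B.Adj (f a) (f b))
    (hK : IsConflictSystem B hub lft rgt)
    (hunc : ∀ c : Sym2 VB → Fin q, ∃ ν, c s(hub ν, lft ν) = c s(hub ν, rgt ν)) :
    ∃ (Z : Type) (_ : Finite Z) (Γ : SimpleGraph Z) (ι : VB ↪ Z), IsRamsey q Γ H ∧
      ∀ Y ≤ Γ, IsRamsey q Y H → ∀ c : Sym2 VB → Fin q, ∃ ν,
        Y.Adj (ι (hub ν)) (ι (lft ν)) ∧ Y.Adj (ι (hub ν)) (ι (rgt ν)) ∧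
          c s(hub ν, lft ν) = c s(hub ν, rgt ν) := by
  obtain ⟨U, _, T, z, x, y, d, hT⟩ := exists_sender hq hH (Fintype.card W + 2)
  have hL : 2 ≤ Fintype.card W + 2 := by omega
  have e1 := attachMap_hub (hub := hub) (lft := lft) (rgt := rgt) (z := z) (x := x) (y := y)
  have e2 := hT.attachMap_left (hub := hub) (lft := lft) (rgt := rgt)
  have e3 := hT.attachMap_right (hub := hub) (lft := lft) (rgt := rgt) hL
  have hcases := attachMap_cases (hub := hub) (lft := lft) (rgt := rgt) (z := z) (x := x) (y := y)
  have hinj := hT.attachMap_injective hL hK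
  refine ⟨VB ⊕ N × U, inferInstance, attachGraph B hub lft rgt T z x y,
    ⟨Sum.inl, Sum.inl_injective⟩, ?_, ?_⟩
  · intro c
    by_contra hc
    obtain ⟨ν, hν⟩ := hunc fun e => c (e.map Sum.inl)
    refine hT.ne _ (not_hasMonoCopy_comap (S := T) hc ⟨_, hinj ν⟩ fun u u' huu =>
      (hT.attachGraph_adj hL hK).2 (Or.inr ⟨ν, u, u', huu, rfl, rfl⟩)) ?_
    simpa [e1, e2, e3] using hν
  · intro Y hY hR c
    by_contra! hcon
    choose τ hτ hτl hτr using fun ν => hT.exists_good_of_le (Y := Y) (c := c) hq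
      (h := hub ν) (l := lft ν) (r := rgt ν) fun h => hcon ν h.1 h.2.1 h.2.2
    have : Nonempty (Fin q) := ⟨⟨0, by omega⟩⟩
    obtain ⟨C, hC⟩ := exists_fun_of_rel (α := Sym2 (VB ⊕ N × U)) (β := Fin q)
      (fun e col => (∃ b b', e = s(Sum.inl b, Sum.inl b') ∧ col = c s(b, b')) ∨
        ∃ ν u u', e = s(attachMap hub lft rgt z x y ν u, attachMap hub lft rgt z x y ν u') ∧
          attachMap hub lft rgt z x y ν u = Sum.inr (ν, u) ∧ col = τ ν s(u, u')) (by
      rintro e col col' (⟨b, b', he, rfl⟩ | ⟨ν, u, u', he, hu, rfl⟩)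
        (⟨b₁, b₁', he', rfl⟩ | ⟨ν₁, u₁, u₁', he', hu₁, rfl⟩)
      · rw [he] at he'
        rcases Sym2.eq_iff.1 he' with ⟨h, h'⟩ | ⟨h, h'⟩
        · rw [Sum.inl_injective h, Sum.inl_injective h']
        · rw [Sum.inl_injective h, Sum.inl_injective h', Sym2.eq_swap]
      · rw [he, hu₁] at he'
        rcases Sym2.eq_iff.1 he' with ⟨h, h'⟩ | ⟨h, h'⟩
        · cases h
        · cases h'
      · rw [he, hu] at he'
        rcases Sym2.eq_iff.1 he' with ⟨h, h'⟩ | ⟨h, h'⟩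
        · cases h
        · cases h
      · rw [he, hu, hu₁] at he'
        rcases Sym2.eq_iff.1 he' with ⟨h, h'⟩ | ⟨h, h'⟩
        · rw [Sum.inr.injEq, Prod.mk.injEq] at h
          obtain ⟨rfl, rfl⟩ := h
          rw [hinj ν h']
        · obtain ⟨h5, h6⟩ := eq_of_attachMap_eq_inr h'
          subst h5 h6
          obtain ⟨-, rfl⟩ := eq_of_attachMap_eq_inr h.symm
          rw [Sym2.eq_swap])
    obtain ⟨i, f, hf⟩ := hR C
    obtain ⟨ν, hν⟩ := hT.exists_sender_of_copy hK hH hB f fun a b hab => hY (hf a b hab).1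
    refine hτ ν (hasMonoCopy_of_map hH _ (hinj ν) f (i := i) fun a b hab => ?_)
    obtain ⟨u, u', huu, h8, h9⟩ := hν a b hab
    refine ⟨u, u', huu, h8, h9, ?_⟩
    obtain ⟨hYab, hcol⟩ := hf a b hab
    rw [← h8, ← h9] at hYab hcol
    rcases or_assoc.2 (or_assoc.2 (hcases ν u)) with h10 | ⟨-, -, -, h10⟩
    · rcases or_assoc.2 (or_assoc.2 (hcases ν u')) with h11 | ⟨-, -, -, h11⟩
      · have hxy := hT.not_adj hL
        have hl : ∀ {w w'}, w = z → w' = x → Y.Adj (attachMap hub lft rgt z x y ν w)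
            (attachMap hub lft rgt z x y ν w') → C s(attachMap hub lft rgt z x y ν w,
              attachMap hub lft rgt z x y ν w') = i → τ ν s(w, w') = i := by
          rintro w w' hw hw' hY' hC'
          rw [hw, hw', e1, e2] at hY' hC'
          rw [hw, hw', hτl ν hY', ← hC']
          exact (hC _ _ (Or.inl ⟨_, _, rfl, rfl⟩)).symm
        have hr : ∀ {w w'}, w = z → w' = y → Y.Adj (attachMap hub lft rgt z x y ν w)
            (attachMap hub lft rgt z x y ν w') → C s(attachMap hub lft rgt z x y ν w,
              attachMap hub lft rgt z x y ν w') = i → τ ν s(w, w') = i := by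
          rintro w w' hw hw' hY' hC'
          rw [hw, hw', e1, e3] at hY' hC'
          rw [hw, hw', hτr ν hY', ← hC']
          exact (hC _ _ (Or.inl ⟨_, _, rfl, rfl⟩)).symm
        rcases h10 with (h10 | h10) | h10 <;> rcases h11 with (h11 | h11) | h11
        · exact absurd (h10.trans h11.symm) huu.ne
        · exact hl h10 h11 hYab hcol
        · exact hr h10 h11 hYab hcol
        · rw [Sym2.eq_swap] at hcol ⊢
          exact hl h11 h10 hYab.symm hcol
        · exact absurd (h10.trans h11.symm) huu.ne
        · rw [h10, h11] at huu
          exact absurd huu hxy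
        · rw [Sym2.eq_swap] at hcol ⊢
          exact hr h11 h10 hYab.symm hcol
        · rw [h10, h11] at huu
          exact absurd huu.symm hxy
        · exact absurd (h10.trans h11.symm) huu.ne
      · rw [← hcol]
        exact (hC _ _ (Or.inr ⟨ν, u', u, Sym2.eq_swap, h11, by rw [Sym2.eq_swap]⟩)).symm
    · rw [← hcol]
      exact (hC _ _ (Or.inr ⟨ν, u, u', rfl, h10, rfl⟩)).symm

/-- `s` is a closed trail of length `n`. -/
structure IsClosedTrail {V : Type} (s : ℕ → V) (n : ℕ) : Prop where
  two_le : 2 ≤ n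
  closed : s n = s 0
  ne : ∀ t < n, s t ≠ s (t + 1)
  inj : ∀ t < n, ∀ t' < n, s(s t, s (t + 1)) = s(s t', s (t' + 1)) → t = t'

/-- The graph formed by the edges of a trail. -/
def trailGraph {V : Type} (s : ℕ → V) (n : ℕ) : SimpleGraph V :=
  SimpleGraph.fromRel fun u v => ∃ t < n, s t = u ∧ s (t + 1) = v

/-- The graph of a trail with `m` pendant edges attached at each passage through a vertex. -/
def pendantGraph {V : Type} (s : ℕ → V) (n m : ℕ) : SimpleGraph (V ⊕ Fin n × Fin m) :=
  SimpleGraph.fromRel fun p p' => (∃ t < n, Sum.inl (s t) = p ∧ Sum.inl (s (t + 1)) = p') ∨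
    ∃ i : Fin n, ∃ t, Sum.inl (s i) = p ∧ Sum.inr (i, t) = p'

/-- The pairs of edges of `pendantGraph` that shall receive different colours. -/
inductive TrailConflict {V : Type} (s : ℕ → V) (n m : ℕ) :
    V ⊕ Fin n × Fin m → V ⊕ Fin n × Fin m → V ⊕ Fin n × Fin m → Prop
  | pendants (i : Fin n) (t t' : Fin m) (h : t ≠ t') :
      TrailConflict s n m (Sum.inl (s i)) (Sum.inr (i, t)) (Sum.inr (i, t'))
  | next (i : Fin n) (t : Fin m) :
      TrailConflict s n m (Sum.inl (s i)) (Sum.inr (i, t)) (Sum.inl (s (i + 1)))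
  | prev (i : ℕ) (h : i + 1 < n) (t : Fin m) :
      TrailConflict s n m (Sum.inl (s (i + 1))) (Sum.inr (⟨i + 1, h⟩, t)) (Sum.inl (s i))
  | closing : TrailConflict s n m (Sum.inl (s 0)) (Sum.inl (s 1)) (Sum.inl (s (n - 1)))

section Trail

variable {V W : Type} {s : ℕ → V} {n m : ℕ}

theorem pendantGraph_adj_inr {p : V ⊕ Fin n × Fin m} {i : Fin n} {t : Fin m}
    (h : (pendantGraph s n m).Adj (Sum.inr (i, t)) p) : p = Sum.inl (s i) := by
  rw [pendantGraph, fromRel_adj] at h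
  rcases h with ⟨-, (⟨t', -, h1, h2⟩ | ⟨j, t', h1, h2⟩) | ⟨t', -, h1, h2⟩ | ⟨j, t', h1, h2⟩⟩
  · cases h1
  · cases h1
  · cases h2
  · cases h2
    exact h1.symm

theorem trailGraph_adj_of_inl {u v : V}
    (h : (pendantGraph s n m).Adj (Sum.inl u) (Sum.inl v)) : (trailGraph s n).Adj u v := by
  rw [pendantGraph, fromRel_adj] at h
  rw [trailGraph, fromRel_adj]
  refine ⟨fun he => h.1 (by rw [he]), ?_⟩
  rcases h with ⟨-, (⟨t', h, h1, h2⟩ | ⟨j, t', h1, h2⟩) | ⟨t', h, h1, h2⟩ | ⟨j, t', h1, h2⟩⟩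
  · exact Or.inl ⟨t', h, Sum.inl_injective h1, Sum.inl_injective h2⟩
  · cases h2
  · exact Or.inr ⟨t', h, Sum.inl_injective h1, Sum.inl_injective h2⟩
  · cases h2

/-- Pendant edges do not create copies of `H`. -/
theorem exists_not_pendantGraph_adj [Fintype W] {H : SimpleGraph W} (hH : NoSmallCut H)
    (h : ∀ f : W ↪ V, ∃ a b, H.Adj a b ∧ ¬ (trailGraph s n).Adj (f a) (f b))
    (f : W ↪ V ⊕ Fin n × Fin m) : ∃ a b, H.Adj a b ∧ ¬ (pendantGraph s n m).Adj (f a) (f b) := by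
  by_contra! hcon
  have hg : ∀ a, ∃ v, Sum.inl v = f a := by
    intro a
    rcases hf : f a with v | ⟨i, t⟩
    · exact ⟨v, rfl⟩
    · obtain ⟨b, hb⟩ := hH.exists_adj a
      obtain ⟨b', hb', hne⟩ := hH.exists_adj_ne a b
      have h1 := hcon a b hb
      have h2 := hcon a b' hb'
      rw [hf] at h1 h2
      exact absurd (f.injective
        ((pendantGraph_adj_inr h2).trans (pendantGraph_adj_inr h1).symm)) hne
  choose g hg using hg
  have hgi : Function.Injective g := fun a b hab => f.injective (by rw [← hg, ← hg, hab])
  obtain ⟨a, b, hab, hn⟩ := h ⟨g, hgi⟩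
  refine hn (trailGraph_adj_of_inl (m := m) ?_)
  change (pendantGraph s n m).Adj (Sum.inl (g a)) (Sum.inl (g b))
  rw [hg, hg]
  exact hcon a b hab

namespace IsClosedTrail

theorem adj_pendant (i : Fin n) (t : Fin m) :
    (pendantGraph s n m).Adj (Sum.inl (s i)) (Sum.inr (i, t)) := by
  rw [pendantGraph, fromRel_adj]
  exact ⟨Sum.inl_ne_inr, Or.inl (Or.inr ⟨i, t, rfl, rfl⟩)⟩

theorem adj_succ (hs : IsClosedTrail s n) {t : ℕ} (ht : t < n) :
    (pendantGraph s n m).Adj (Sum.inl (s t)) (Sum.inl (s (t + 1))) := by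
  rw [pendantGraph, fromRel_adj]
  exact ⟨fun h => hs.ne t ht (Sum.inl_injective h), Or.inl (Or.inl ⟨t, ht, rfl, rfl⟩)⟩

theorem last_eq (hs : IsClosedTrail s n) : s (n - 1 + 1) = s 0 := by
  have := hs.two_le
  rw [Nat.sub_add_cancel (by omega), hs.closed]

theorem isConflictSystem (hs : IsClosedTrail s n) : IsConflictSystem (pendantGraph s n m)
    (fun ν : {p : (V ⊕ Fin n × Fin m) × (V ⊕ Fin n × Fin m) × (V ⊕ Fin n × Fin m) //
      TrailConflict s n m p.1 p.2.1 p.2.2} => ν.1.1) (fun ν => ν.1.2.1) (fun ν => ν.1.2.2) := by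
  have hn := hs.two_le
  constructor
  · rintro ⟨⟨h, l, r⟩, hν⟩
    cases hν with
    | pendants i t t' h => exact adj_pendant i t
    | next i t => exact adj_pendant i t
    | prev i h t => exact adj_pendant ⟨i + 1, h⟩ t
    | closing => exact hs.adj_succ (by omega)
  · rintro ⟨⟨h, l, r⟩, hν⟩
    cases hν with
    | pendants i t t' h => exact adj_pendant i t'
    | next i t => exact hs.adj_succ i.2
    | prev i h t => exact (hs.adj_succ (by omega)).symm
    | closing =>
      have h := (hs.adj_succ (m := m) (t := n - 1) (by omega)).symm
      rwa [hs.last_eq] at h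
  · rintro ⟨⟨h, l, r⟩, hν⟩
    cases hν with
    | pendants i t t' h => simpa using h
    | next i t => simp
    | prev i h t => simp
    | closing =>
      intro h
      have h' := hs.inj 0 (by omega) (n - 1) (by omega) (by
        rw [hs.last_eq, zero_add, Sum.inl_injective h, Sym2.eq_swap])
      omega

/-- No colouring respects all conflicts of a closed trail. -/
theorem exists_conflict (hs : IsClosedTrail s n)
    (c : Sym2 (V ⊕ Fin n × Fin m) → Fin (m + 1)) :
    ∃ h l r, TrailConflict s n m h l r ∧ c s(h, l) = c s(h, r) := by
  classical
  by_contra! hcon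
  have hn := hs.two_le
  have hstep : ∀ i, i + 1 < n → c s(Sum.inl (s (i + 1)), Sum.inl (s (i + 1 + 1))) =
      c s(Sum.inl (s (i + 1)), Sum.inl (s i)) := by
    intro i hi
    let S : Finset (Fin (m + 1)) :=
      univ.image fun t : Fin m => c s(Sum.inl (s (i + 1)), Sum.inr (⟨i + 1, hi⟩, t))
    have hS : #S = m := by
      rw [Finset.card_image_of_injective, Finset.card_univ, Fintype.card_fin]
      intro t t' h
      by_contra hne
      exact hcon _ _ _ (.pendants ⟨i + 1, hi⟩ t t' hne) h
    have hSc : #Sᶜ ≤ 1 := by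
      rw [Finset.card_compl, hS, Fintype.card_fin]
      omega
    refine Finset.card_le_one.1 hSc _ ?_ _ ?_
    · rw [Finset.mem_compl, Finset.mem_image]
      rintro ⟨t, -, h⟩
      exact hcon _ _ _ (.next ⟨i + 1, hi⟩ t) h
    · rw [Finset.mem_compl, Finset.mem_image]
      rintro ⟨t, -, h⟩
      exact hcon _ _ _ (.prev i hi t) h
  have hall : ∀ i < n, c s(Sum.inl (s i), Sum.inl (s (i + 1))) =
      c s(Sum.inl (s 0), Sum.inl (s 1)) := by
    intro i
    induction i with
    | zero => intro _; rfl
    | succ i ih => intro hi; rw [hstep i hi, Sym2.eq_swap, ih (by omega)]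
  refine hcon _ _ _ .closing ?_
  rw [← hall (n - 1) (by omega), hs.last_eq, Sym2.eq_swap]

/-- After deleting one edge of the trail, all conflicts can be respected. -/
theorem exists_colouring_of_lt (hs : IsClosedTrail s n) (hm : 0 < m) {j : ℕ} (hj : j < n) :
    ∃ c : Sym2 (V ⊕ Fin n × Fin m) → Fin (m + 1), ∀ h l r, TrailConflict s n m h l r →
      c s(h, l) = c s(h, r) → s(h, l) = s(Sum.inl (s j), Sum.inl (s (j + 1))) ∨
        s(h, r) = s(Sum.inl (s j), Sum.inl (s (j + 1))) := by
  have hn := hs.two_le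
  let col : ℕ → Fin (m + 1) := fun i => if i < j then Fin.last m else 0
  obtain ⟨c, hc⟩ := exists_fun_of_rel (α := Sym2 (V ⊕ Fin n × Fin m)) (β := Fin (m + 1))
    (fun e a => (∃ i < n, e = s(Sum.inl (s i), Sum.inl (s (i + 1))) ∧ a = col i) ∨
      ∃ (i : Fin n) (t : Fin m), e = s(Sum.inl (s i), Sum.inr (i, t)) ∧
        a = (col (i - 1)).succAbove t) (by
    rintro e a a' (⟨i, hi, rfl, rfl⟩ | ⟨i, t, rfl, rfl⟩) (⟨i', hi', he, rfl⟩ | ⟨i', t', he, rfl⟩)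
    · have h : s(s i, s (i + 1)) = s(s i', s (i' + 1)) := by
        simpa [Sym2.eq_iff] using he
      rw [hs.inj i hi i' hi' h]
    · simp at he
    · simp at he
    · simp at he
      obtain ⟨-, rfl, rfl⟩ := he
      rfl)
  have htrail : ∀ i < n, c s(Sum.inl (s i), Sum.inl (s (i + 1))) = col i := fun i hi =>
    hc _ _ (Or.inl ⟨i, hi, rfl, rfl⟩)
  have hpend : ∀ (i : Fin n) (t : Fin m), c s(Sum.inl (s i), Sum.inr (i, t)) =
      (col (i - 1)).succAbove t := fun i t => hc _ _ (Or.inr ⟨i, t, rfl, rfl⟩)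
  refine ⟨c, fun h l r hν he => ?_⟩
  cases hν with
  | pendants i t t' h =>
    rw [hpend, hpend] at he
    exact absurd (Fin.succAbove_right_injective he) h
  | next i t =>
    rw [hpend, htrail i i.2] at he
    by_cases hij : (i : ℕ) = j
    · exact Or.inr (by rw [hij])
    · have h : col i = col (i - 1) := by
        simp only [col]
        exact if_congr (by omega) rfl rfl
      exact absurd (he.trans h) (Fin.succAbove_ne _ _)
  | prev i h t =>
    have h1 := hpend ⟨i + 1, h⟩ t
    simp only [Nat.add_sub_cancel] at h1
    rw [h1, Sym2.eq_swap (a := Sum.inl (s (i + 1))) (b := Sum.inl (s i)), htrail i (by omega)] at he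
    exact absurd he (Fin.succAbove_ne _ _)
  | closing =>
    have h0 := htrail 0 (by omega)
    have h1 := htrail (n - 1) (by omega)
    rw [hs.last_eq, Sym2.eq_swap] at h1
    rw [h1] at he
    by_cases hj0 : j = 0
    · exact Or.inl (by rw [hj0])
    by_cases hjn : j = n - 1
    · exact Or.inr (by rw [hjn, hs.last_eq, Sym2.eq_swap])
    have he' : Fin.last m = 0 := by
      have h2 := h0.symm.trans he
      simp only [col] at h2
      rwa [if_pos (by omega), if_neg (by omega)] at h2
    have := congrArg Fin.val he'
    simp at this
    omega

end IsClosedTrail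
end Trail

theorem IsSparse.eq_of_pair_eq {N M g : ℕ} {ω : Fin M → Fin 2 → Fin N}
    (hω : IsSparse g ω) (hg : 2 ≤ g) {j j' : Fin M}
    (h : s(ω j 0, ω j 1) = s(ω j' 0, ω j' 1)) : j = j' := by
  by_contra hne
  have h1 := hω.card_inter_le_one (by simp) hg hne
  have hinj := hω.injective (by omega) j
  have hmem : ∀ i : Fin 2, ω j i ∈ s(ω j' 0, ω j' 1) := by
    intro i
    rw [← h]
    fin_cases i <;> simp
  have hmem' : ∀ i : Fin 2, ω j i ∈ imgUnion ω {j} ∩ imgUnion ω {j'} := by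
    intro i
    rw [mem_inter, mem_imgUnion, mem_imgUnion]
    refine ⟨⟨j, by simp, i, rfl⟩, j', by simp, ?_⟩
    rcases Sym2.mem_iff.1 (hmem i) with h | h
    · exact ⟨0, h.symm⟩
    · exact ⟨1, h.symm⟩
  exact absurd (hinj (Finset.card_le_one.1 h1 _ (hmem' 0) _ (hmem' 1))) (by simp)

section SparseTrail

variable {N M : ℕ} [NeZero M]

/-- The closed trail passing through all edges `ω j 0, ω j 1`, where consecutive ones are joined by
paths with three interior vertices. -/
def sparseTrail (ω : Fin M → Fin 2 → Fin N) (t : ℕ) : Fin N ⊕ Fin M × Fin 3 :=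
  match t % 5 with
  | 0 => Sum.inl (ω (Fin.ofNat M (t / 5)) 0)
  | 1 => Sum.inl (ω (Fin.ofNat M (t / 5)) 1)
  | 2 => Sum.inr (Fin.ofNat M (t / 5), 0)
  | 3 => Sum.inr (Fin.ofNat M (t / 5), 1)
  | _ => Sum.inr (Fin.ofNat M (t / 5), 2)

variable {ω : Fin M → Fin 2 → Fin N}

theorem sparseTrail_edge (t : ℕ) : ∃ i, (t = 5 * i ∧
      sparseTrail ω t = Sum.inl (ω (Fin.ofNat M i) 0) ∧
      sparseTrail ω (t + 1) = Sum.inl (ω (Fin.ofNat M i) 1)) ∨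
    (t = 5 * i + 1 ∧ sparseTrail ω t = Sum.inl (ω (Fin.ofNat M i) 1) ∧
      sparseTrail ω (t + 1) = Sum.inr (Fin.ofNat M i, 0)) ∨
    (t = 5 * i + 2 ∧ sparseTrail ω t = Sum.inr (Fin.ofNat M i, 0) ∧
      sparseTrail ω (t + 1) = Sum.inr (Fin.ofNat M i, 1)) ∨
    (t = 5 * i + 3 ∧ sparseTrail ω t = Sum.inr (Fin.ofNat M i, 1) ∧
      sparseTrail ω (t + 1) = Sum.inr (Fin.ofNat M i, 2)) ∨
    (t = 5 * i + 4 ∧ sparseTrail ω t = Sum.inr (Fin.ofNat M i, 2) ∧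
      sparseTrail ω (t + 1) = Sum.inl (ω (Fin.ofNat M (i + 1)) 0)) := by
  refine ⟨t / 5, ?_⟩
  have h : t % 5 = 0 ∨ t % 5 = 1 ∨ t % 5 = 2 ∨ t % 5 = 3 ∨ t % 5 = 4 := by omega
  unfold sparseTrail
  rcases h with h | h | h | h | h
  · have h1 : (t + 1) % 5 = 1 := by omega
    have h2 : (t + 1) / 5 = t / 5 := by omega
    simp only [h, h1, h2]
    exact Or.inl ⟨by omega, trivial, trivial⟩
  · have h1 : (t + 1) % 5 = 2 := by omega
    have h2 : (t + 1) / 5 = t / 5 := by omega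
    simp only [h, h1, h2]
    exact Or.inr (Or.inl ⟨by omega, trivial, trivial⟩)
  · have h1 : (t + 1) % 5 = 3 := by omega
    have h2 : (t + 1) / 5 = t / 5 := by omega
    simp only [h, h1, h2]
    exact Or.inr (Or.inr (Or.inl ⟨by omega, trivial, trivial⟩))
  · have h1 : (t + 1) % 5 = 4 := by omega
    have h2 : (t + 1) / 5 = t / 5 := by omega
    simp only [h, h1, h2]
    exact Or.inr (Or.inr (Or.inr (Or.inl ⟨by omega, trivial, trivial⟩)))
  · have h1 : (t + 1) % 5 = 0 := by omega
    have h2 : (t + 1) / 5 = t / 5 + 1 := by omega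
    simp only [h, h1, h2]
    exact Or.inr (Or.inr (Or.inr (Or.inr ⟨by omega, trivial, trivial⟩)))

theorem ofNat_inj_of_lt {i i' : ℕ} (hi : i < M) (hi' : i' < M)
    (h : Fin.ofNat M i = Fin.ofNat M i') : i = i' := by
  have := congrArg Fin.val h
  simpa [Fin.ofNat, Nat.mod_eq_of_lt, hi, hi'] using this

theorem IsSparse.isClosedTrail {g : ℕ} (hω : IsSparse g ω) (hg : 2 ≤ g) :
    IsClosedTrail (sparseTrail ω) (5 * M) := by
  have hM : 0 < M := Nat.pos_of_ne_zero (NeZero.ne M)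
  have hne : ∀ j, ω j 0 ≠ ω j 1 := fun j h =>
    absurd (hω.injective (by omega) j h) (by simp)
  refine ⟨by omega, ?_, ?_, ?_⟩
  · simp [sparseTrail, Fin.ofNat]
  · intro t _
    obtain ⟨i, ⟨-, h1, h2⟩ | ⟨-, h1, h2⟩ | ⟨-, h1, h2⟩ | ⟨-, h1, h2⟩ | ⟨-, h1, h2⟩⟩ :=
      sparseTrail_edge (ω := ω) t <;> rw [h1, h2] <;> simp [hne]
  · intro t ht t' ht' h
    obtain ⟨i, ⟨hi, h1, h2⟩ | ⟨hi, h1, h2⟩ | ⟨hi, h1, h2⟩ | ⟨hi, h1, h2⟩ | ⟨hi, h1, h2⟩⟩ :=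
      sparseTrail_edge (ω := ω) t <;>
    obtain ⟨i', ⟨hi', h3, h4⟩ | ⟨hi', h3, h4⟩ | ⟨hi', h3, h4⟩ | ⟨hi', h3, h4⟩ | ⟨hi', h3, h4⟩⟩ :=
      sparseTrail_edge (ω := ω) t' <;> rw [h1, h2, h3, h4] at h
    case inl.inl =>
      have h5 : s(ω (Fin.ofNat M i) 0, ω (Fin.ofNat M i) 1) =
          s(ω (Fin.ofNat M i') 0, ω (Fin.ofNat M i') 1) := by
        simpa [Sym2.eq_iff] using h
      have := ofNat_inj_of_lt (by omega) (by omega) (hω.eq_of_pair_eq hg h5)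
      omega
    all_goals
      rw [Sym2.eq_iff] at h
      simp at h
    all_goals
      have := ofNat_inj_of_lt (M := M) (i := i) (i' := i') (by omega) (by omega) (by simp [h])
      omega

theorem exists_of_trailGraph_adj {u v : Fin N}
    (h : (trailGraph (sparseTrail ω) (5 * M)).Adj (Sum.inl u) (Sum.inl v)) :
    ∃ j, s(u, v) = s(ω j 0, ω j 1) := by
  have key : ∀ {u v : Fin N} t, sparseTrail ω t = Sum.inl u → sparseTrail ω (t + 1) = Sum.inl v →
      ∃ j, s(u, v) = s(ω j 0, ω j 1) := by
    intro u v t h3 h4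
    obtain ⟨i, ⟨-, h1, h2⟩ | ⟨-, h1, h2⟩ | ⟨-, h1, h2⟩ | ⟨-, h1, h2⟩ | ⟨-, h1, h2⟩⟩ :=
      sparseTrail_edge (ω := ω) t <;> rw [h1] at h3 <;> rw [h2] at h4
    · exact ⟨_, by rw [Sum.inl_injective h3, Sum.inl_injective h4]⟩
    all_goals simp at h3 h4
  rw [trailGraph, fromRel_adj] at h
  rcases h with ⟨-, ⟨t, -, h1, h2⟩ | ⟨t, -, h1, h2⟩⟩
  · exact key t h1 h2
  · obtain ⟨j, hj⟩ := key t h1 h2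
    exact ⟨j, by rw [← hj, Sym2.eq_swap]⟩

theorem trailGraph_adj_inr {j : Fin M} {r : Fin 3} {p : Fin N ⊕ Fin M × Fin 3}
    (h : (trailGraph (sparseTrail ω) (5 * M)).Adj (Sum.inr (j, r)) p) :
    (r = 0 ∧ (p = Sum.inl (ω j 1) ∨ p = Sum.inr (j, 1))) ∨
    (r = 1 ∧ (p = Sum.inr (j, 0) ∨ p = Sum.inr (j, 2))) ∨
    (r = 2 ∧ (p = Sum.inl (ω (Fin.ofNat M (j + 1)) 0) ∨ p = Sum.inr (j, 1))) := by
  have hj : ∀ i, Fin.ofNat M (i + 1) = Fin.ofNat M (Fin.ofNat M i + 1) := fun i => by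
    apply Fin.ext
    simp only [Fin.ofNat, Nat.mod_add_mod]
  rw [trailGraph, fromRel_adj] at h
  rcases h with ⟨-, ⟨t, -, h1, h2⟩ | ⟨t, -, h2, h1⟩⟩ <;>
  obtain ⟨i, ⟨-, h3, h4⟩ | ⟨-, h3, h4⟩ | ⟨-, h3, h4⟩ | ⟨-, h3, h4⟩ | ⟨-, h3, h4⟩⟩ :=
      sparseTrail_edge (ω := ω) t
  all_goals
    first
    | rw [h3] at h1; rw [h4] at h2
    | rw [h4] at h1; rw [h3] at h2
  all_goals try simp only [Sum.inr.injEq, Prod.mk.injEq, reduceCtorEq] at h1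
  all_goals
    obtain ⟨rfl, rfl⟩ := h1
    rw [← h2]
    try rw [hj i]
    simp

/-- The graph of a sparse trail contains no copy of `H`. -/
theorem IsSparse.exists_not_trailGraph_adj {W : Type} [Fintype W] {H : SimpleGraph W} {g : ℕ}
    (hω : IsSparse g ω) (hg : Fintype.card W ^ 2 ≤ g) (hg' : 2 ≤ g) (hH : NoSmallCut H)
    (f : W ↪ Fin N ⊕ Fin M × Fin 3) :
    ∃ a b, H.Adj a b ∧ ¬ (trailGraph (sparseTrail ω) (5 * M)).Adj (f a) (f b) := by
  classical
  by_contra! hcon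
  have hmid : ∀ a j, f a ≠ Sum.inr (j, 1) := by
    intro a j ha
    obtain ⟨b, hb⟩ := hH.exists_adj a
    obtain ⟨b', hb', hne⟩ := hH.exists_adj_ne a b
    have hnb : ∀ u, H.Adj a u → f u = Sum.inr (j, 0) ∨ f u = Sum.inr (j, 2) := by
      intro u hu
      have h := hcon a u hu
      rw [ha] at h
      simpa using trailGraph_adj_inr h
    have hadj : H.Adj b b' := hH.adj_of_neighbors (v := a) fun u hu => by
      have h1 := hnb u hu
      have h2 := hnb b hb
      have h3 := hnb b' hb'
      have h4 : f b' ≠ f b := f.injective.ne hne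
      rw [← f.injective.eq_iff, ← f.injective.eq_iff (a := u)]
      grind
    have h5 := hcon b b' hadj
    rcases hnb b hb with h1 | h1 <;> rcases hnb b' hb' with h2 | h2 <;> rw [h1, h2] at h5 <;>
      simpa using trailGraph_adj_inr h5
  have hone : ∀ a j r (p : Fin N ⊕ Fin M × Fin 3), f a = Sum.inr (j, r) →
      (∀ u, H.Adj a u → f u = p) → False := by
    intro a j r p _ hp
    obtain ⟨b, hb⟩ := hH.exists_adj a
    obtain ⟨b', hb', hne⟩ := hH.exists_adj_ne a b
    exact hne (f.injective ((hp b' hb').trans (hp b hb).symm))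
  have hinl : ∀ a, ∃ v, Sum.inl v = f a := by
    intro a
    rcases ha : f a with v | ⟨j, r⟩
    · exact ⟨v, rfl⟩
    exfalso
    have hnb := fun u hu => trailGraph_adj_inr (ha ▸ hcon a u hu)
    have hr : r = 0 ∨ r = 1 ∨ r = 2 := by fin_cases r <;> simp
    rcases hr with rfl | rfl | rfl
    · exact hone a j 0 _ ha fun u hu => by simpa [hmid] using hnb u hu
    · exact hmid a j ha
    · exact hone a j 2 _ ha fun u hu => by simpa [hmid] using hnb u hu
  choose w hw using hinl
  have hwi : Function.Injective w := fun a b hab => f.injective (by rw [← hw, ← hw, hab])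
  have hedge : ∀ e : W × W, ∃ j, H.Adj e.1 e.2 → s(w e.1, w e.2) = s(ω j 0, ω j 1) := by
    rintro ⟨a, b⟩
    by_cases hab : H.Adj a b
    · have h := hcon a b hab
      rw [← hw, ← hw] at h
      obtain ⟨j, hj⟩ := exists_of_trailGraph_adj h
      exact ⟨j, fun _ => hj⟩
    · exact ⟨0, fun h => absurd h hab⟩
  choose J hJ using hedge
  let F : Finset (Fin M) := ({e : W × W | H.Adj e.1 e.2} : Finset (W × W)).image J
  have hmem : ∀ a b, H.Adj a b → J (a, b) ∈ F := fun a b hab =>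
    mem_image.2 ⟨(a, b), by simpa using hab, rfl⟩
  have hmemU : ∀ (F' : Finset (Fin M)) a b, H.Adj a b → J (a, b) ∈ F' → w a ∈ imgUnion ω F' := by
    intro F' a b hab hF'
    have h : w a ∈ s(ω (J (a, b)) 0, ω (J (a, b)) 1) := by
      rw [← hJ (a, b) hab]; simp
    rw [mem_imgUnion]
    rcases Sym2.mem_iff.1 h with h | h
    · exact ⟨_, hF', 0, h.symm⟩
    · exact ⟨_, hF', 1, h.symm⟩
  obtain ⟨a₀⟩ := hH.nonempty
  obtain ⟨b₀, hab₀⟩ := hH.exists_adj a₀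
  obtain ⟨j, hj, hle⟩ := hω.exists_leaf (by simp) (F := F) ⟨_, hmem a₀ b₀ hab₀⟩ (by
    refine le_trans ?_ hg
    refine Finset.card_image_le.trans ((Finset.card_le_univ _).trans ?_)
    rw [Fintype.card_prod, sq])
  obtain ⟨⟨a, b⟩, hab, rfl⟩ := mem_image.1 hj
  replace hab : H.Adj a b := by simpa using hab
  have hJs : J (b, a) = J (a, b) := hω.eq_of_pair_eq hg' (by
    rw [← hJ (a, b) hab, ← hJ (b, a) hab.symm, Sym2.eq_swap])
  have hother : ∀ a b, H.Adj a b → w a ∈ imgUnion ω {J (a, b)} ∩ imgUnion ω (F.erase (J (a, b))) := by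
    intro a b hab
    rw [mem_inter]
    refine ⟨hmemU _ a b hab (by simp), ?_⟩
    obtain ⟨u, hau, hub⟩ := hH.exists_adj_ne a b
    refine hmemU _ a u hau (mem_erase.2 ⟨fun h => ?_, hmem a u hau⟩)
    have h1 := hJ (a, u) hau
    rw [h, ← hJ (a, b) hab] at h1
    exact hub (hwi (Sym2.congr_right.1 h1))
  have h1 := hother b a hab.symm
  rw [hJs] at h1
  exact hab.ne (hwi (Finset.card_le_one.1 hle _ (hother a b hab) _ h1))

end SparseTrail

/-- A graph with a system of conflicts that is minimally unavoidable with respect to the edges in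
a set `E` of large chromatic number. -/
theorem exists_base {W : Type} [Fintype W] {H : SimpleGraph W} (hH : NoSmallCut H) {q k : ℕ}
    (hq : 2 ≤ q) (hk : 0 < k) :
    ∃ (VB N : Type) (_ : Finite VB) (_ : Finite N) (B : SimpleGraph VB) (hub lft rgt : N → VB)
      (E : Set (Sym2 VB)), IsConflictSystem B hub lft rgt ∧
      (∀ f : W ↪ VB, ∃ a b, H.Adj a b ∧ ¬ B.Adj (f a) (f b)) ∧
      (∀ c : Sym2 VB → Fin q, ∃ ν, c s(hub ν, lft ν) = c s(hub ν, rgt ν)) ∧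
      (∀ e ∈ E, ∃ c : Sym2 VB → Fin q, ∀ ν, c s(hub ν, lft ν) = c s(hub ν, rgt ν) →
        s(hub ν, lft ν) = e ∨ s(hub ν, rgt ν) = e) ∧
      ∀ φ : VB → Fin k, ∃ u v, s(u, v) ∈ E ∧ φ u = φ v := by
  obtain ⟨N, M, ω, hω, hcol⟩ := exists_isSparse_not_colorable (I := Fin 2) (by simp) k
    (Fintype.card W ^ 2 + 2) hk
  have : NeZero M := ⟨by
    rintro rfl
    exact (hcol fun _ => ⟨0, hk⟩).choose.elim0⟩
  obtain ⟨m, rfl⟩ : ∃ m, q = m + 1 := ⟨q - 1, by omega⟩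
  have hs := hω.isClosedTrail (by omega)
  refine ⟨_, _, inferInstance, inferInstance, pendantGraph (sparseTrail ω) (5 * M) m, _, _, _,
    {e | ∃ j < 5 * M, e = s(Sum.inl (sparseTrail ω j), Sum.inl (sparseTrail ω (j + 1)))},
    hs.isConflictSystem, exists_not_pendantGraph_adj hH
      (hω.exists_not_trailGraph_adj (by omega) (by omega) hH), ?_, ?_, ?_⟩
  · intro c
    obtain ⟨h, l, r, hν, he⟩ := hs.exists_conflict c
    exact ⟨⟨(h, l, r), hν⟩, he⟩
  · rintro e ⟨j, hj, rfl⟩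
    obtain ⟨c, hc⟩ := hs.exists_colouring_of_lt (m := m) (by omega) hj
    exact ⟨c, fun ν => hc _ _ _ ν.2⟩
  · intro φ
    obtain ⟨j, hj⟩ := hcol fun v => φ (Sum.inl (Sum.inl v))
    have h0 : sparseTrail ω (5 * j) = Sum.inl (ω j 0) := by
      simp [sparseTrail]
    have h1 : sparseTrail ω (5 * j + 1) = Sum.inl (ω j 1) := by
      have h2 : (5 * (j : ℕ) + 1) % 5 = 1 := by omega
      have h3 : (5 * (j : ℕ) + 1) / 5 = j := by omega
      simp [sparseTrail, h2, h3]
    exact ⟨Sum.inl (Sum.inl (ω j 0)), Sum.inl (Sum.inl (ω j 1)), ⟨5 * j, by omega, by rw [h0, h1]⟩,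
      hj 0 1⟩

/-- Greedy colouring. -/
theorem colorable_of_forall_card_le {V : Type} [Fintype V] {G : SimpleGraph V} {k : ℕ}
    (h : ∀ (v : V) (S : Finset V), (∀ u ∈ S, G.Adj v u) → #S ≤ k) : G.Colorable (k + 1) := by
  classical
  have key : ∀ A : Finset V, ∃ φ : V → Fin (k + 1), ∀ u ∈ A, ∀ v ∈ A, G.Adj u v → φ u ≠ φ v := by
    intro A
    induction A using Finset.induction_on with
    | empty => exact ⟨fun _ => 0, by simp⟩
    | insert a A ha ih =>
      obtain ⟨φ, hφ⟩ := ih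
      obtain ⟨i, -, hi⟩ := Finset.exists_mem_notMem_of_card_lt_card
        (show #(({u ∈ A | G.Adj a u}).image φ) < #(univ : Finset (Fin (k + 1))) by
          rw [Finset.card_univ, Fintype.card_fin]
          exact Nat.lt_succ_of_le (Finset.card_image_le.trans (h a _ (by simp))))
      have hi' : ∀ u ∈ A, G.Adj a u → φ u ≠ i := fun u hu hau he =>
        hi (mem_image.2 ⟨u, by simp [hu, hau], he⟩)
      have hne : ∀ u ∈ A, u ≠ a := fun u hu he => ha (he ▸ hu)
      refine ⟨Function.update φ a i, fun u hu v hv huv => ?_⟩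
      rcases mem_insert.1 hu with rfl | hu' <;> rcases mem_insert.1 hv with rfl | hv'
      · exact absurd rfl huv.ne
      · rw [Function.update_self, Function.update_of_ne (hne v hv')]
        exact (hi' v hv' huv).symm
      · rw [Function.update_self, Function.update_of_ne (hne u hu')]
        exact hi' u hu' huv.symm
      · rw [Function.update_of_ne (hne u hu'), Function.update_of_ne (hne v hv')]
        exact hφ u hu' v hv' huv
  obtain ⟨φ, hφ⟩ := key univ
  exact ⟨Coloring.mk φ fun {u v} huv => hφ u (mem_univ _) v (mem_univ _) huv⟩

theorem IsRamsey.of_embedding {V U W : Type} {S : SimpleGraph V} {T : SimpleGraph U}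
    {H : SimpleGraph W} {q : ℕ} (h : IsRamsey q S H) (ψ : V ↪ U)
    (hψ : ∀ v v', S.Adj v v' → T.Adj (ψ v) (ψ v')) : IsRamsey q T H := fun c => by
  by_contra hc
  exact not_hasMonoCopy_comap hc ψ hψ (h _)

/-- Ramsey-minimality is invariant under isomorphism. -/
theorem IsRamseyMinimal.of_iso {V U W : Type} {S : SimpleGraph V} {T : SimpleGraph U}
    {H : SimpleGraph W} {q : ℕ} (h : IsRamseyMinimal q S H) (e : S ≃g T) :
    IsRamseyMinimal q T H := by
  refine ⟨h.1.of_embedding e.toEquiv.toEmbedding fun v v' hv => e.map_rel_iff.2 hv,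
    fun K hK hR => h.2 (K.comap e.toHom) (fun hc => hK ?_) ?_⟩
  · ext u v
    · have h1 : e.symm u ∈ (K.comap e.toHom).verts := by rw [hc]; trivial
      simpa using h1
    · refine ⟨fun h => h.adj_sub, fun huv => ?_⟩
      have h1 : (K.comap e.toHom).Adj (e.symm u) (e.symm v) := by
        rw [hc]
        exact e.symm.map_rel_iff.2 huv
      simpa using h1.2
  · refine hR.of_embedding ⟨fun v => ⟨e.symm v.1, by simp⟩, fun v v' hv => ?_⟩ fun v v' hv => ?_
    · simpa [Subtype.ext_iff] using hv
    · refine ⟨e.symm.map_rel_iff.2 hv.adj_sub, ?_⟩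
      change K.Adj (e (e.symm v)) (e (e.symm v'))
      simpa using hv

/-- A finite Ramsey graph contains a Ramsey-minimal subgraph. -/
theorem IsRamsey.exists_minimal {V W : Type} [Finite V] {G : SimpleGraph V} {H : SimpleGraph W}
    {q : ℕ} (h : IsRamsey q G H) : ∃ K : G.Subgraph, IsRamseyMinimal q K.coe H := by
  obtain ⟨K, hK⟩ := Set.Finite.exists_minimal (Set.toFinite {K : G.Subgraph | IsRamsey q K.coe H})
    ⟨⊤, h.of_embedding ⟨fun v => ⟨v, trivial⟩, fun v v' hv => congrArg Subtype.val hv⟩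
      fun v v' hv => hv⟩
  refine ⟨K, hK.1, fun K' hne hR => hne (Subgraph.coeSubgraph_injective K ?_)⟩
  have htop : Subgraph.coeSubgraph (⊤ : K.coe.Subgraph) = K := by
    ext u v
    · simp
    · simp only [Subgraph.coeSubgraph_adj, Subgraph.top_adj, Subgraph.coe_adj]
      exact ⟨fun ⟨_, _, h⟩ => h, fun h => ⟨h.fst_mem, h.snd_mem, h⟩⟩
  rw [htop]
  refine le_antisymm (Subgraph.coeSubgraph_le K') (hK.2 ?_ (Subgraph.coeSubgraph_le K'))
  refine hR.of_embedding ⟨fun v => ⟨v.1.1, by simp⟩, fun v v' hv => ?_⟩ fun v v' hv => ?_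
  · simpa [Subtype.ext_iff] using hv
  · exact (Subgraph.coeSubgraph_adj K' _ _).2 ⟨v.1.2, v'.1.2, hv⟩

/-- There are Ramsey-minimal graphs of arbitrarily large chromatic number. -/
theorem exists_isRamseyMinimal_not_colorable {W : Type} [Fintype W] {H : SimpleGraph W}
    (hH : NoSmallCut H) {q : ℕ} (hq : 2 ≤ q) (k : ℕ) :
    ∃ (n : ℕ) (G : SimpleGraph (Fin n)), IsRamseyMinimal q G H ∧ ¬ G.Colorable (k + 1) := by
  classical
  obtain ⟨VB, N, _, _, B, hub, lft, rgt, E, hK, hB, hunc, hE, hcol⟩ :=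
    exists_base hH hq (Nat.succ_pos k)
  obtain ⟨Z, _, Γ, ι, hΓ, hY⟩ := exists_assembly hq hH hB hK hunc
  obtain ⟨K, hKmin⟩ := hΓ.exists_minimal
  have hKE : ∀ u v, s(u, v) ∈ E → K.Adj (ι u) (ι v) := by
    intro u v huv
    obtain ⟨c, hc⟩ := hE _ huv
    obtain ⟨ν, hl, hr, he⟩ := hY K.spanningCoe K.spanningCoe_le
      (hKmin.1.of_embedding (Function.Embedding.subtype _) fun v v' hv => hv) c
    rcases hc ν he with h | h <;> rcases Sym2.eq_iff.1 h with ⟨h1, h2⟩ | ⟨h1, h2⟩ <;>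
      subst h1 h2
    · exact hl
    · exact hl.symm
    · exact hr
    · exact hr.symm
  obtain ⟨n, ⟨e⟩⟩ := Finite.exists_equiv_fin K.verts
  refine ⟨n, K.coe.map e.toEmbedding, hKmin.of_iso (Iso.map e K.coe), ?_⟩
  rintro ⟨φ⟩
  obtain ⟨u, v, huv, he⟩ := hcol fun b => if h : ι b ∈ K.verts then φ (e ⟨ι b, h⟩) else 0
  have hadj := hKE u v huv
  rw [dif_pos hadj.fst_mem, dif_pos hadj.snd_mem] at he
  refine φ.valid ?_ he
  exact (Iso.map e K.coe).map_rel_iff.2 hadj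

end

/-- If `H` is 3-connected or a triangle and `q ≥ 3`, then for every `k`
there is a `q`-Ramsey-minimal graph for `H` with maximum degree at least `k` (i.e. some
vertex with at least `k` neighbours) and chromatic number at least `k`. -/
theorem stmt8 {VH : Type} [Fintype VH]
    (H : SimpleGraph VH) (hH : ThreeConnOrK3 H)
    (q : ℕ) (hq : 3 ≤ q) (k : ℕ) :
    ∃ (n : ℕ) (G : SimpleGraph (Fin n)),
      IsRamseyMinimal q G H ∧
      (∃ (v : Fin n) (S : Finset (Fin n)), k ≤ S.card ∧ ∀ u ∈ S, G.Adj v u) ∧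
      (k : ℕ∞) ≤ G.chromaticNumber := by
  obtain ⟨n, G, hmin, hcol⟩ :=
    exists_isRamseyMinimal_not_colorable hH.noSmallCut (by omega : 2 ≤ q) k
  refine ⟨n, G, hmin, ?_, ?_⟩
  · by_contra! h
    refine hcol (colorable_of_forall_card_le fun v S hS => ?_)
    by_contra! hlt
    obtain ⟨u, hu, hn⟩ := h v S hlt.le
    exact hn (hS u hu)
  · refine le_of_not_ge fun h => hcol ?_
    exact (chromaticNumber_le_iff_colorable.1 h).mono (Nat.le_succ k)
end

section
/- For all integers q ≥ 3 and k ≥ 3, the complete graph K_k is not q-Ramsey-equivalent to any connected graph other than K_k itself: if H is a connected graph that is q-Ramsey-equivalent to K_k, then H is isomorphic to K_k. -/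
open SimpleGraph

/-- `H` and `H'` are `q`-Ramsey-equivalent: a (finite) graph is `q`-Ramsey for `H`
iff it is `q`-Ramsey for `H'`. -/
def RamseyEquiv (q : ℕ) {W W' : Type*} (H : SimpleGraph W) (H' : SimpleGraph W') : Prop :=
  ∀ (V : Type) [Fintype V] (G : SimpleGraph V), IsRamsey q G H ↔ IsRamsey q G H'

theorem cons_pairwise {V : Type} {n : ℕ} {R : V → V → Prop} (hR : ∀ x y, R x y → R y x) {a : V}
    {f : Fin n → V} (ha : ∀ s, R a (f s)) (hf : ∀ s t, s ≠ t → R (f s) (f t))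
    (s t : Fin (n + 1)) (hst : s ≠ t) :
    R (Fin.cons (α := fun _ => V) a f s) (Fin.cons (α := fun _ => V) a f t) := by
  induction s using Fin.cases with
  | zero =>
    obtain ⟨t, rfl⟩ := Fin.exists_succ_eq.mpr hst.symm
    simpa using ha t
  | succ s =>
    induction t using Fin.cases with
    | zero => simpa using hR _ _ (ha s)
    | succ t => simpa using hf s t (by simpa using hst)

/-- Every sufficiently large set contains a sequence of `m` points on which the colour of a pair
depends only on its first point. -/
theorem exists_prehomogeneous (κ : Type) [Finite κ] (m : ℕ) :
    ∃ N : ℕ, ∀ (α : Type) (c : α → α → κ) (S : Finset α), N ≤ S.card →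
      ∃ (x : Fin m → α) (d : Fin m → κ), Function.Injective x ∧ (∀ i, x i ∈ S) ∧
        ∀ i j, i < j → c (x i) (x j) = d i := by
  classical
  have := Fintype.ofFinite κ
  induction m with
  | zero =>
    exact ⟨0, fun α c S _ => ⟨Fin.elim0, Fin.elim0, fun i => i.elim0, fun i => i.elim0,
      fun i => i.elim0⟩⟩
  | succ m ih =>
    obtain ⟨N, hN⟩ := ih
    refine ⟨Fintype.card κ * N + 1, fun α c S hS => ?_⟩
    obtain ⟨a, ha⟩ : S.Nonempty := Finset.card_pos.mp (by omega)
    have : Nonempty κ := ⟨c a a⟩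
    obtain ⟨y, -, hy⟩ := Finset.exists_le_card_fiber_of_mul_le_card_of_maps_to
      (s := S.erase a) (t := Finset.univ) (f := c a) (n := N) (fun _ _ => Finset.mem_univ _)
      Finset.univ_nonempty (by rw [Finset.card_erase_of_mem ha, Finset.card_univ]; omega)
    obtain ⟨x, d, hx, hxS, hd⟩ := hN α c _ hy
    simp only [Finset.mem_filter, Finset.mem_erase] at hxS
    refine ⟨Fin.cons a x, Fin.cons y d, ?_, ?_, ?_⟩
    · rw [Fin.cons_injective_iff]
      exact ⟨fun ⟨i, hi⟩ => (hxS i).1.1 hi, hx⟩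
    · intro i
      refine Fin.cases ?_ (fun i => ?_) i
      · simpa using ha
      · simpa using (hxS i).1.2
    · intro i j hij
      obtain ⟨j, rfl⟩ := Fin.eq_succ_of_ne_zero (Fin.ne_zero_of_lt hij)
      refine Fin.cases (fun _ => ?_) (fun i hij => ?_) i hij
      · simpa using (hxS j).2
      · simpa using hd i j (by simpa using hij)

/-- Ramsey's theorem for pairs, with colours of ordered pairs. -/
theorem exists_homogeneous (κ : Type) [Finite κ] (n : ℕ) :
    ∃ N : ℕ, ∀ c : Fin N → Fin N → κ, ∃ (g : Fin n ↪ Fin N), ∀ i j i' j',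
      i < j → i' < j' → c (g i) (g j) = c (g i') (g j') := by
  classical
  have := Fintype.ofFinite κ
  obtain ⟨N, hN⟩ := exists_prehomogeneous κ (Fintype.card κ * n + 1)
  refine ⟨N, fun c => ?_⟩
  obtain ⟨x, d, hx, -, hd⟩ := hN (Fin N) c Finset.univ (by simp)
  obtain ⟨y, -, hy⟩ := Finset.exists_le_card_fiber_of_mul_le_card_of_maps_to
    (s := (Finset.univ : Finset (Fin (Fintype.card κ * n + 1)))) (t := Finset.univ) (f := d)
    (n := n) (fun _ _ => Finset.mem_univ _) ⟨d 0, Finset.mem_univ _⟩ (by simp)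
  obtain ⟨T, hT, hTn⟩ := Finset.exists_subset_card_eq hy
  have hdy (i) : d (T.orderEmbOfFin hTn i) = y :=
    (Finset.mem_filter.mp (hT (Finset.orderEmbOfFin_mem T hTn i))).2
  refine ⟨(T.orderEmbOfFin hTn).toEmbedding.trans ⟨x, hx⟩, fun i j i' j' h h' => ?_⟩
  simp only [Function.Embedding.trans_apply, Function.Embedding.coeFn_mk,
    RelEmbedding.coe_toEmbedding]
  rw [hd _ _ (by simpa using h), hd _ _ (by simpa using h'), hdy, hdy]

/-- A family of edge-disjoint graphs on `I × X`, none of which has an edge inside a part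
`{i} × X`. -/
structure IsPicture {I X L : Type} (G : L → SimpleGraph (I × X)) : Prop where
  partite : ∀ l u v, (G l).Adj u v → u.1 ≠ v.1
  disjoint : ∀ l l' u v, (G l).Adj u v → (G l').Adj u v → l = l'

namespace Amalgam

variable {I X L : Type} [DecidableEq I] (G : L → SimpleGraph (I × X)) (i j : I) (l : L)
  (ι : Type)

/-- The `l`-edges between the parts `i` and `j`. -/
abbrev Edge : Type := {e : X × X // (G l).Adj (i, e.1) (j, e.2)}

/-- The combinatorial lines over the alphabet `Edge G i j l`, as words with a free letter. -/
abbrev Copy : Type := {o : ι → Option (Edge G i j l) // ∃ n, o n = none}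

variable {G i j l ι}

/-- The endpoint of an edge in the part `m ∈ {i, j}`. -/
def side (e : Edge G i j l) (m : I) : X := if m = i then e.1.1 else e.1.2

/-- The copy of `I × X` determined by a combinatorial line. -/
def emb (o : Copy G i j l ι) (p : I × X) : I × ((ι → X) ⊕ (Copy G i j l ι × X)) :=
  (p.1, if p.1 = i ∨ p.1 = j then Sum.inl fun n => (o.1 n).elim p.2 fun e => side e p.1
    else Sum.inr (o, p.2))

theorem fst_eq_of_emb_eq {o o' : Copy G i j l ι} {p r : I × X} (h : emb o p = emb o' r) :
    p.1 = r.1 := by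
  have h1 := congrArg Prod.fst h
  exact h1

theorem emb_injective (o : Copy G i j l ι) : Function.Injective (emb o) := by
  rintro ⟨a, x⟩ ⟨b, y⟩ h
  obtain ⟨n, hn⟩ := o.2
  obtain rfl : a = b := congrArg Prod.fst h
  have h2 := congrArg Prod.snd h
  by_cases ha : a = i ∨ a = j
  · simp only [emb, ha, if_true, Sum.inl.injEq] at h2
    simpa [hn] using congrFun h2 n
  · simpa [emb, ha] using h2

theorem eq_of_emb_eq {o o' : Copy G i j l ι} {p r : I × X} (h : emb o p = emb o' r)
    (hp : ¬(p.1 = i ∨ p.1 = j)) : o = o' ∧ p = r := by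
  obtain ⟨a, x⟩ := p
  obtain ⟨b, y⟩ := r
  obtain rfl : a = b := congrArg Prod.fst h
  have h2 := congrArg Prod.snd h
  simp only [emb, hp, if_false, Sum.inr.injEq, Prod.mk.injEq] at h2
  simp [h2]

theorem snd_eq_of_emb_eq {o o' : Copy G i j l ι} {p r : I × X} (h : emb o p = emb o' r)
    (hp : p.1 = i ∨ p.1 = j) {n : ι} (hn : o.1 n = none) :
    p = (p.1, (o'.1 n).elim r.2 fun e => side e p.1) := by
  obtain ⟨a, x⟩ := p
  obtain ⟨b, y⟩ := r
  obtain rfl : a = b := congrArg Prod.fst h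
  have h2 := congrArg Prod.snd h
  dsimp only at hp
  simp only [emb, hp, if_true, Sum.inl.injEq] at h2
  simpa [hn] using congrFun h2 n

theorem adj_side (e : Edge G i j l) {u v : I} (hu : u = i ∨ u = j) (hv : v = i ∨ v = j)
    (huv : u ≠ v) : (G l).Adj (u, side e u) (v, side e v) := by
  rcases hu with rfl | rfl <;> rcases hv with rfl | rfl
  · exact absurd rfl huv
  · simpa [side, huv.symm] using e.2
  · simpa [side, huv] using e.2.symm
  · exact absurd rfl huv

/-- The amalgam of the copies of a member of `G` over all combinatorial lines. -/
def graph (hG : IsPicture G) (l' : L) :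
    SimpleGraph (I × ((ι → X) ⊕ (Copy G i j l ι × X))) where
  Adj a b := ∃ (o : Copy G i j l ι) (p r : I × X), (G l').Adj p r ∧ a = emb o p ∧ b = emb o r
  symm := ⟨fun _ _ ⟨o, p, r, h, ha, hb⟩ => ⟨o, r, p, h.symm, hb, ha⟩⟩
  loopless := ⟨fun _ ⟨_, _, _, h, ha, hb⟩ =>
    hG.partite _ _ _ h (fst_eq_of_emb_eq (ha.symm.trans hb))⟩

variable {hG : IsPicture G}

theorem fst_ne_of_adj {l' : L} {a b : I × ((ι → X) ⊕ (Copy G i j l ι × X))}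
    (h : (graph hG l').Adj a b) : a.1 ≠ b.1 := by
  obtain ⟨o, p, r, h, rfl, rfl⟩ := h
  exact hG.partite _ _ _ h

theorem adj_emb_iff {l' : L} {o : Copy G i j l ι} {p p' : I × X} :
    (graph hG l').Adj (emb o p) (emb o p') ↔ (G l').Adj p p' := by
  refine ⟨fun hadj => ?_, fun h => ⟨o, p, p', h, rfl, rfl⟩⟩
  obtain ⟨o', r, r', h, hr, hr'⟩ := hadj
  by_cases hp : p.1 = i ∨ p.1 = j
  swap
  · obtain ⟨rfl, rfl⟩ := eq_of_emb_eq hr hp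
    rwa [emb_injective _ hr']
  by_cases hp' : p'.1 = i ∨ p'.1 = j
  swap
  · obtain ⟨rfl, rfl⟩ := eq_of_emb_eq hr' hp'
    rwa [emb_injective _ hr]
  have e1 : p.1 = r.1 := fst_eq_of_emb_eq hr
  have e2 : p'.1 = r'.1 := fst_eq_of_emb_eq hr'
  have hne : p.1 ≠ p'.1 := e1 ▸ e2 ▸ hG.partite _ _ _ h
  obtain ⟨n, hn⟩ := o.2
  obtain ⟨m, hm⟩ := o'.2
  have a1 := snd_eq_of_emb_eq hr hp hn
  have a2 := snd_eq_of_emb_eq hr' hp' hn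
  have b1 := snd_eq_of_emb_eq hr.symm (e1 ▸ hp) hm
  have b2 := snd_eq_of_emb_eq hr'.symm (e2 ▸ hp') hm
  cases hon : o'.1 n with
  | none =>
    rw [hon] at a1 a2
    rw [a1, a2, e1, e2]
    exact h
  | some e =>
    rw [hon] at a1 a2
    have key : (G l).Adj p p' := by
      rw [a1, a2]
      exact adj_side e hp hp' hne
    cases hom : o.1 m with
    | none =>
      rw [hom] at b1 b2
      have c1 : r = p := b1.trans (by rw [← e1]; rfl)
      have c2 : r' = p' := b2.trans (by rw [← e2]; rfl)
      rwa [← c1, ← c2]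
    | some e' =>
      rw [hom] at b1 b2
      have : (G l).Adj r r' := by
        rw [b1, b2]
        exact adj_side e' (e1 ▸ hp) (e2 ▸ hp') (e1 ▸ e2 ▸ hne)
      rwa [hG.disjoint _ _ _ _ h this]

theorem isPicture : IsPicture (graph hG : L → SimpleGraph (I × ((ι → X) ⊕ (Copy G i j l ι × X))))
    where
  partite _ _ _ h := fst_ne_of_adj h
  disjoint l₁ l₂ a b h₁ h₂ := by
    obtain ⟨o, p, r, h, rfl, rfl⟩ := h₁
    exact hG.disjoint _ _ _ _ h (adj_emb_iff.mp h₂)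

/-- The amalgam has no larger cliques than the original picture. -/
theorem clique_reflects {l' : L} {n : ℕ} (hn : 2 ≤ n)
    (f : (⊤ : SimpleGraph (Fin n)) →g (graph (i := i) (j := j) (l := l) (ι := ι) hG l')) :
    Nonempty ((⊤ : SimpleGraph (Fin n)) →g G l') := by
  have hadj {s t : Fin n} (h : s ≠ t) : (graph hG l').Adj (f s) (f t) :=
    f.map_adj ((SimpleGraph.top_adj _ _).mpr h)
  obtain ⟨s, hs⟩ : ∃ s : Fin n, ((f s).1 = i ∨ (f s).1 = j) → ∀ t, (f t).1 = i ∨ (f t).1 = j := by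
    by_cases h : ∀ t, (f t).1 = i ∨ (f t).1 = j
    · exact ⟨⟨0, by omega⟩, fun _ => h⟩
    · obtain ⟨s, hs⟩ := not_forall.mp h
      exact ⟨s, fun h => absurd h hs⟩
  have : Nontrivial (Fin n) := Fin.nontrivial_iff_two_le.mpr hn
  obtain ⟨s', hs'⟩ := exists_ne s
  obtain ⟨o, p, r, -, hp, hr⟩ := hadj hs'.symm
  have hrange (t) : ∃ x, f t = emb o x := by
    by_cases hts : t = s
    · exact ⟨p, hts ▸ hp⟩
    by_cases hts' : t = s'
    · exact ⟨r, hts' ▸ hr⟩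
    by_cases h : (f s).1 = i ∨ (f s).1 = j
    · have h1 := fst_ne_of_adj (hadj hs')
      have h2 := fst_ne_of_adj (hadj hts)
      have h3 := fst_ne_of_adj (hadj hts')
      have h4 := hs h s'
      have h5 := hs h t
      grind
    · obtain ⟨o', p', r', -, hp', hr'⟩ := hadj (Ne.symm hts)
      obtain ⟨rfl, rfl⟩ := eq_of_emb_eq (hp.symm.trans hp') (by rw [hp] at h; exact h)
      exact ⟨r', hr'⟩
  choose x hx using hrange
  exact ⟨⟨x, fun {a b} h => adj_emb_iff.mp (hx a ▸ hx b ▸ f.map_adj h)⟩⟩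

end Amalgam

/-- The partite lemma: a picture can be enlarged so that every colouring contains a copy of the
old picture whose `l`-edges between the parts `i` and `j` are monochromatic. -/
theorem IsPicture.exists_step {I X L : Type} [Finite I] [Finite X]
    {G : L → SimpleGraph (I × X)} (hG : IsPicture G) (κ : Type) [Finite κ] {i j : I}
    (hij : i ≠ j) (l : L) :
    ∃ (Y : Type) (_ : Finite Y) (G' : L → SimpleGraph (I × Y)), IsPicture G' ∧
      (∀ l' n, 2 ≤ n → Nonempty ((⊤ : SimpleGraph (Fin n)) →g G' l') →
        Nonempty ((⊤ : SimpleGraph (Fin n)) →g G l')) ∧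
      ∀ χ : Sym2 (I × Y) → κ, ∃ f : I × X → I × Y, Function.Injective f ∧
        (∀ p, (f p).1 = p.1) ∧ (∀ l' p r, (G' l').Adj (f p) (f r) ↔ (G l').Adj p r) ∧
        ∃ c, ∀ p r, p.1 = i → r.1 = j → (G l).Adj p r → χ s(f p, f r) = c := by
  classical
  obtain ⟨ι, _, hι⟩ := Combinatorics.Line.exists_mono_in_high_dimension
    (Amalgam.Edge G i j l) κ
  refine ⟨(ι → X) ⊕ (Amalgam.Copy G i j l ι × X), inferInstance, Amalgam.graph hG,
    Amalgam.isPicture, fun l' n hn ⟨f⟩ => Amalgam.clique_reflects hn f, fun χ => ?_⟩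
  obtain ⟨line, c, hc⟩ := hι fun ω => χ s((i, Sum.inl fun n => (ω n).1.1),
    (j, Sum.inl fun n => (ω n).1.2))
  refine ⟨Amalgam.emb ⟨line.idxFun, line.proper⟩, Amalgam.emb_injective _, fun _ => rfl,
    fun _ _ _ => Amalgam.adj_emb_iff, c, ?_⟩
  rintro ⟨a, x⟩ ⟨b, y⟩ rfl rfl h
  rw [← hc ⟨(x, y), h⟩]
  have ha : Amalgam.emb ⟨line.idxFun, line.proper⟩ (a, x) =
      (a, Sum.inl fun n => (line ⟨(x, y), h⟩ n).1.1) := by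
    simp only [Amalgam.emb, true_or, if_true, Prod.mk.injEq, Sum.inl.injEq, true_and]
    ext n
    cases hn : line.idxFun n <;> simp [hn, Amalgam.side]
  have hb : Amalgam.emb ⟨line.idxFun, line.proper⟩ (b, y) =
      (b, Sum.inl fun n => (line ⟨(x, y), h⟩ n).1.2) := by
    simp only [Amalgam.emb, or_true, if_true, Prod.mk.injEq, Sum.inl.injEq, true_and]
    ext n
    cases hn : line.idxFun n <;> simp [hn, Amalgam.side, hij.symm]
  rw [ha, hb]

/-- The partite lemma, applied to a finite set of pairs of parts with labels. -/
theorem IsPicture.exists_iterate {I X L : Type} [Finite I] [Finite X]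
    {G : L → SimpleGraph (I × X)} (hG : IsPicture G) (κ : Type) [Finite κ]
    (S : Finset (I × I × L)) (hS : ∀ t ∈ S, t.1 ≠ t.2.1) :
    ∃ (Y : Type) (_ : Finite Y) (G' : L → SimpleGraph (I × Y)), IsPicture G' ∧
      (∀ l' n, 2 ≤ n → Nonempty ((⊤ : SimpleGraph (Fin n)) →g G' l') →
        Nonempty ((⊤ : SimpleGraph (Fin n)) →g G l')) ∧
      ∀ χ : Sym2 (I × Y) → κ, ∃ f : I × X → I × Y, Function.Injective f ∧
        (∀ p, (f p).1 = p.1) ∧ (∀ l' p r, (G' l').Adj (f p) (f r) ↔ (G l').Adj p r) ∧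
        ∀ t ∈ S, ∃ c, ∀ p r, p.1 = t.1 → r.1 = t.2.1 → (G t.2.2).Adj p r →
          χ s(f p, f r) = c := by
  classical
  induction S using Finset.induction_on with
  | empty =>
    exact ⟨X, inferInstance, G, hG, fun _ _ _ h => h, fun χ =>
      ⟨id, Function.injective_id, fun _ => rfl, fun _ _ _ => Iff.rfl, by simp⟩⟩
  | insert t S _ ih =>
    obtain ⟨Y, _, G₁, hG₁, hcl₁, h₁⟩ := ih fun t ht => hS t (Finset.mem_insert_of_mem ht)
    obtain ⟨Z, _, G₂, hG₂, hcl₂, h₂⟩ :=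
      hG₁.exists_step κ (hS t (Finset.mem_insert_self _ _)) t.2.2
    refine ⟨Z, inferInstance, G₂, hG₂, fun l n hn h => hcl₁ l n hn (hcl₂ l n hn h), fun χ => ?_⟩
    obtain ⟨f, hf, hf1, hfa, c, hc⟩ := h₂ χ
    obtain ⟨g, hg, hg1, hga, hgc⟩ := h₁ fun e => χ (e.map f)
    refine ⟨f ∘ g, hf.comp hg, fun p => (hf1 _).trans (hg1 p),
      fun l p r => (hfa _ _ _).trans (hga _ _ _), fun s hs => ?_⟩
    rcases Finset.mem_insert.mp hs with rfl | hs
    · exact ⟨c, fun p r hp hr h =>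
        hc _ _ ((hg1 p).trans hp) ((hg1 r).trans hr) ((hga _ _ _).mpr h)⟩
    · exact hgc s hs

/-- Ramsey's theorem for edge-labelled graphs without creating new cliques: for every family `A`
of edge-disjoint graphs there is a family `B` of edge-disjoint graphs with the same clique numbers
such that every colouring of pairs of vertices of `B` contains an induced copy of `A` in which the
colour of an edge depends only on its label. -/
theorem exists_labelled_ramsey {V L : Type} [Finite V] [Finite L] (A : L → SimpleGraph V)
    (hA : ∀ l l' u v, (A l).Adj u v → (A l').Adj u v → l = l') (κ : Type) [Finite κ]
    [Nonempty κ] :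
    ∃ (W : Type) (_ : Finite W) (B : L → SimpleGraph W),
      (∀ l l' u v, (B l).Adj u v → (B l').Adj u v → l = l') ∧
      (∀ l n, 2 ≤ n → Nonempty ((⊤ : SimpleGraph (Fin n)) →g B l) →
        Nonempty ((⊤ : SimpleGraph (Fin n)) →g A l)) ∧
      ∀ χ : Sym2 W → κ, ∃ f : V → W, Function.Injective f ∧
        (∀ l u v, (B l).Adj (f u) (f v) ↔ (A l).Adj u v) ∧
        ∃ γ : L → κ, ∀ l u v, (A l).Adj u v → χ s(f u, f v) = γ l := by
  classical
  have := Fintype.ofFinite V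
  have := Fintype.ofFinite L
  obtain ⟨N, hN⟩ := exists_homogeneous (L → κ) (Fintype.card V)
  let G (l : L) : SimpleGraph (Fin N × (V ↪ Fin N)) :=
    { Adj := fun p r => p.2 = r.2 ∧ ∃ u v, p.2 u = p.1 ∧ r.2 v = r.1 ∧ (A l).Adj u v
      symm := ⟨fun p r ⟨h, u, v, hu, hv, hadj⟩ => ⟨h.symm, v, u, hv, hu, hadj.symm⟩⟩
      loopless := ⟨fun p ⟨_, u, v, hu, hv, hadj⟩ =>
        hadj.ne (p.2.injective (hu.trans hv.symm))⟩ }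
  have hG : IsPicture G := by
    constructor
    · rintro l ⟨a, g⟩ ⟨b, g'⟩ ⟨h, u, v, hu, hv, hadj⟩ hab
      dsimp only at *
      subst h hab
      exact hadj.ne (g.injective (hu.trans hv.symm))
    · rintro l l' ⟨a, g⟩ ⟨b, g'⟩ ⟨h, u, v, hu, hv, hadj⟩ ⟨-, u', v', hu', hv', hadj'⟩
      dsimp only at *
      subst h
      obtain rfl := g.injective (hu.trans hu'.symm)
      obtain rfl := g.injective (hv.trans hv'.symm)
      exact hA _ _ _ _ hadj hadj'
  have hGadj (g : V ↪ Fin N) (l u v) : (G l).Adj (g u, g) (g v, g) ↔ (A l).Adj u v :=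
    ⟨fun ⟨_, u', v', hu, hv, h⟩ => g.injective hu ▸ g.injective hv ▸ h,
      fun h => ⟨rfl, u, v, rfl, rfl, h⟩⟩
  obtain ⟨Y, _, G', hG', hcl, hram⟩ := hG.exists_iterate κ
    (Finset.univ.filter fun t => t.1 ≠ t.2.1) (by simp)
  refine ⟨Fin N × Y, inferInstance, G', hG'.disjoint, fun l n hn h => ?_, fun χ => ?_⟩
  · obtain ⟨f⟩ := hcl l n hn h
    have hadj {s t : Fin n} (h : s ≠ t) : (G l).Adj (f s) (f t) :=
      f.map_adj ((SimpleGraph.top_adj _ _).mpr h)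
    have : Nontrivial (Fin n) := Fin.nontrivial_iff_two_le.mpr hn
    let s₀ : Fin n := ⟨0, by omega⟩
    have hg (s) : (f s).2 = (f s₀).2 := by
      by_cases h : s = s₀
      · rw [h]
      · exact (hadj h).1
    have hpre (s) : ∃ u, f s = ((f s₀).2 u, (f s₀).2) := by
      obtain ⟨t, ht⟩ := exists_ne s
      obtain ⟨-, u, v, hu, -⟩ := hadj ht.symm
      exact ⟨u, Prod.ext (by rw [← hg s, hu]) (hg s)⟩
    choose x hx using hpre
    refine ⟨⟨x, fun {a b} h => ?_⟩⟩
    have := f.map_adj h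
    rw [hx a, hx b] at this
    exact (hGadj _ _ _ _).mp this
  · obtain ⟨f, hf, hf1, hfa, hfc⟩ := hram χ
    have hcol (a b : Fin N) (l : L) : ∃ c : κ, a ≠ b → ∀ p r, p.1 = a → r.1 = b →
        (G l).Adj p r → χ s(f p, f r) = c := by
      by_cases hab : a = b
      · exact ⟨Classical.arbitrary κ, fun h => absurd hab h⟩
      · obtain ⟨c, hc⟩ := hfc (a, b, l) (by simpa using hab)
        exact ⟨c, fun _ => hc⟩
    choose c hc using hcol
    obtain ⟨g₀, hg₀⟩ := hN fun a b l => c a b l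
    let e := Fintype.equivFin V
    let g : V ↪ Fin N := e.toEmbedding.trans g₀
    have hγ : ∃ γ : L → κ, ∀ u v, e u < e v → ∀ l, c (g u) (g v) l = γ l := by
      by_cases h : ∃ u v, e u < e v
      · obtain ⟨u, v, h⟩ := h
        exact ⟨c (g u) (g v), fun u' v' h' l => congrFun (hg₀ _ _ _ _ h' h) l⟩
      · exact ⟨fun _ => Classical.arbitrary κ, fun u v huv => absurd ⟨u, v, huv⟩ h⟩
    obtain ⟨γ, hγ⟩ := hγ
    refine ⟨fun v => f (g v, g), fun u v h => g.injective (congrArg Prod.fst (hf h)),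
      fun l u v => (hfa _ _ _).trans (hGadj g l u v), γ, ?_⟩
    have main (l u v) (h : (A l).Adj u v) (huv : e u < e v) :
        χ s(f (g u, g), f (g v, g)) = γ l := by
      rw [← hγ u v huv l]
      exact hc _ _ _ (fun h' => h.ne (g.injective h')) _ _ rfl rfl ((hGadj _ _ _ _).mpr h)
    intro l u v h
    rcases lt_trichotomy (e u) (e v) with huv | huv | huv
    · exact main l u v h huv
    · exact absurd (e.injective huv) h.ne
    · rw [Sym2.eq_swap]
      exact main l v u h.symm huv

/-- The edge-labelled graph consisting of a clique of order `m + 2` in each label `some d`, where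
for `d = c` one vertex of the clique is isolated, and all edges between these cliques, with label
`none`. -/
def block {q : ℕ} (m : ℕ) (c : Fin q) : Option (Fin q) → SimpleGraph (Fin q × Fin (m + 2))
  | none =>
    { Adj := fun u v => u.1 ≠ v.1
      symm := ⟨fun _ _ h => h.symm⟩
      loopless := ⟨fun _ h => h rfl⟩ }
  | some d =>
    { Adj := fun u v => u.1 = d ∧ v.1 = d ∧ u.2 ≠ v.2 ∧ (d = c → u.2 ≠ 0 ∧ v.2 ≠ 0)
      symm := ⟨fun _ _ ⟨hu, hv, h, hc⟩ => ⟨hv, hu, h.symm, fun e => (hc e).symm⟩⟩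
      loopless := ⟨fun _ h => h.2.2.1 rfl⟩ }

theorem block_disjoint {q m : ℕ} (c : Fin q) (l l' : Option (Fin q))
    (u v : Fin q × Fin (m + 2)) (h : (block m c l).Adj u v) (h' : (block m c l').Adj u v) :
    l = l' := by
  cases l <;> cases l' <;> simp_all [block]

theorem block_snd_injective {q m n : ℕ} {c d : Fin q}
    (f : (⊤ : SimpleGraph (Fin n)) →g block m c (some d)) :
    Function.Injective fun s => (f s).2 := by
  intro s t hst
  by_contra h
  exact (f.map_adj ((SimpleGraph.top_adj _ _).mpr h)).2.2.1 hst

theorem block_no_clique {q m : ℕ} (c d : Fin q) :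
    ¬Nonempty ((⊤ : SimpleGraph (Fin (m + 3))) →g block m c (some d)) := by
  rintro ⟨f⟩
  simpa using Fintype.card_le_of_injective _ (block_snd_injective f)

theorem block_no_clique_self {q m : ℕ} (c : Fin q) :
    ¬Nonempty ((⊤ : SimpleGraph (Fin (m + 2))) →g block m c (some c)) := by
  rintro ⟨f⟩
  obtain ⟨s, hs⟩ := Finite.surjective_of_injective (block_snd_injective f) 0
  obtain ⟨t, ht⟩ := exists_ne s
  exact ((f.map_adj ((SimpleGraph.top_adj _ _).mpr ht)).2.2.2 rfl).2 hs

/-- A vertex-colouring version of `exists_labelled_ramsey` for the cliques in a block. -/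
theorem exists_vertex_ramsey {q : ℕ} (hq : 3 ≤ q) (m : ℕ) (T : Type) [Finite T] [Nonempty T]
    (c : Fin q) :
    ∃ (W : Type) (_ : Finite W) (B : Fin q → SimpleGraph W),
      (∀ d d' u v, (B d).Adj u v → (B d').Adj u v → d = d') ∧
      (∀ d, ¬Nonempty ((⊤ : SimpleGraph (Fin (m + 3))) →g B d)) ∧
      (¬Nonempty ((⊤ : SimpleGraph (Fin (m + 2))) →g B c)) ∧
      ∀ f : W → T, ∃ g : Fin q × Fin (m + 2) → W, (∃ b, ∀ u, f (g u) = b) ∧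
        (∀ d, d ≠ c → ∀ s t, s ≠ t → (B d).Adj (g (d, s)) (g (d, t))) ∧
        ∀ s t : Fin (m + 1), s ≠ t → (B c).Adj (g (c, s.succ)) (g (c, t.succ)) := by
  have : Nonempty (Sym2 T) := ⟨Sym2.diag (Classical.arbitrary T)⟩
  obtain ⟨W, hW, B, hB, hcl, hram⟩ :=
    exists_labelled_ramsey (block m c) (block_disjoint c) (Sym2 T)
  refine ⟨W, hW, fun d => B (some d), fun d d' u v h h' => Option.some.inj (hB _ _ _ _ h h'),
    fun d h => block_no_clique c d (hcl _ _ (by omega) h),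
    fun h => block_no_clique_self c (hcl _ _ (by omega) h), fun f => ?_⟩
  obtain ⟨g, -, hadj, γ, hγ⟩ := hram (Sym2.map f)
  have hcross (u v : Fin q × Fin (m + 2)) (huv : u.1 ≠ v.1) : s(f (g u), f (g v)) = γ none :=
    hγ none u v huv
  have hthird (a b : Fin q) : ∃ d, d ≠ a ∧ d ≠ b := by
    obtain ⟨d, hd⟩ := Finset.exists_mem_notMem_of_card_lt_card
      (s := {a, b}) (t := (Finset.univ : Finset (Fin q)))
      (Finset.card_le_two.trans_lt (by rw [Finset.card_univ, Fintype.card_fin]; omega))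
    exact ⟨d, by simpa [not_or] using hd⟩
  have hne (u v : Fin q × Fin (m + 2)) (huv : u.1 ≠ v.1) : f (g u) = f (g v) := by
    obtain ⟨d, hu, hv⟩ := hthird u.1 v.1
    have h1 := hcross (d, 0) u hu
    have h2 := hcross (d, 0) v hv
    exact Sym2.congr_right.mp (h1.trans h2.symm)
  refine ⟨g, ⟨f (g (c, 0)), fun u => ?_⟩, fun d hd s t hst => ?_, fun s t hst => ?_⟩
  · obtain ⟨d, hd, hd'⟩ := hthird u.1 c
    exact (hne u (d, 0) hd.symm).trans (hne (d, 0) (c, 0) hd')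
  · exact (hadj _ _ _).mpr ⟨rfl, rfl, hst, fun h => absurd h hd⟩
  · exact (hadj _ _ _).mpr ⟨rfl, rfl, by simpa using hst,
      fun _ => ⟨Fin.succ_ne_zero _, Fin.succ_ne_zero _⟩⟩

/-- Given edge-labelled graphs `D c`, there is an edge-labelled graph in which every colouring has a
monochromatic `K_(m+3)` or contains disjoint induced copies of all `D c` whose edges are coloured
according to an injective function of the labels. -/
theorem exists_mono_or_distinct {q : ℕ} (m : ℕ) (W : Fin q → Type) [∀ c, Finite (W c)]
    (D : ∀ c, Fin q → SimpleGraph (W c))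
    (hD : ∀ c d d' u v, (D c d).Adj u v → (D c d').Adj u v → d = d')
    (hcl : ∀ c d, ¬Nonempty ((⊤ : SimpleGraph (Fin (m + 3))) →g D c d)) (hq : 0 < q) :
    ∃ (U : Type) (_ : Finite U) (B : Fin q → SimpleGraph U),
      (∀ d d' u v, (B d).Adj u v → (B d').Adj u v → d = d') ∧
      (∀ d, ¬Nonempty ((⊤ : SimpleGraph (Fin (m + 3))) →g B d)) ∧
      ∀ χ : Sym2 U → Fin q,
        (∃ (f : Fin (m + 3) → U) (i : Fin q), ∀ s t, s ≠ t →
          (⨆ d, B d).Adj (f s) (f t) ∧ χ s(f s, f t) = i) ∨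
        ∃ (φ : (Σ c, W c) → U) (γ : Fin q → Fin q), Function.Injective φ ∧
          (∀ c d u v, (B d).Adj (φ ⟨c, u⟩) (φ ⟨c, v⟩) ↔ (D c d).Adj u v) ∧
          Function.Injective γ ∧
          ∀ c d u v, (D c d).Adj u v → χ s(φ ⟨c, u⟩, φ ⟨c, v⟩) = γ d := by
  classical
  let lab (p : Fin q × Fin q) (s t : Fin (m + 3)) : Fin q := if s = 0 ∨ t = 0 then p.1 else p.2
  let A (l : Fin q) : SimpleGraph ((Σ c, W c) ⊕ ((Fin q × Fin q) × Fin (m + 3))) :=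
    { Adj := fun x y =>
        (∃ c u v, x = Sum.inl ⟨c, u⟩ ∧ y = Sum.inl ⟨c, v⟩ ∧ (D c l).Adj u v) ∨
        ∃ p s t, x = Sum.inr (p, s) ∧ y = Sum.inr (p, t) ∧ s ≠ t ∧ p.1 ≠ p.2 ∧ lab p s t = l
      symm := ⟨by
        rintro x y (⟨c, u, v, hx, hy, h⟩ | ⟨p, s, t, hx, hy, hst, hp, h⟩)
        · exact Or.inl ⟨c, v, u, hy, hx, h.symm⟩
        · exact Or.inr ⟨p, t, s, hy, hx, hst.symm, hp, by rw [← h]; simp only [lab, or_comm]⟩⟩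
      loopless := ⟨by
        rintro x (⟨c, u, v, hx, hy, h⟩ | ⟨p, s, t, hx, hy, hst, hp, h⟩)
        · obtain rfl : u = v := by simpa using hx.symm.trans hy
          exact h.ne rfl
        · exact hst (by simpa using hx.symm.trans hy)⟩ }
  have hAinl (l c u v) : (A l).Adj (Sum.inl ⟨c, u⟩) (Sum.inl ⟨c, v⟩) ↔ (D c l).Adj u v := by
    constructor
    · rintro (⟨c', u', v', hx, hy, h⟩ | ⟨p, s, t, hx, -⟩)
      · cases hx
        cases hy
        exact h
      · cases hx
    · exact fun h => Or.inl ⟨c, u, v, rfl, rfl, h⟩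
  have hAinr (l p s t) : (A l).Adj (Sum.inr (p, s)) (Sum.inr (p, t)) ↔
      s ≠ t ∧ p.1 ≠ p.2 ∧ lab p s t = l := by
    constructor
    · rintro (⟨c', u', v', hx, -⟩ | ⟨p, s, t, hx, hy, h⟩)
      · cases hx
      · cases hx
        cases hy
        exact h
    · exact fun h => Or.inr ⟨p, s, t, rfl, rfl, h⟩
  have hA (l l' x y) (h : (A l).Adj x y) (h' : (A l').Adj x y) : l = l' := by
    rcases h with ⟨c, u, v, rfl, rfl, h⟩ | ⟨p, s, t, rfl, rfl, h⟩
    · exact hD c _ _ _ _ h ((hAinl _ _ _ _).mp h')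
    · exact h.2.2.symm.trans ((hAinr _ _ _ _).mp h').2.2
  have hAcl (l) : ¬Nonempty ((⊤ : SimpleGraph (Fin (m + 3))) →g A l) := by
    rintro ⟨f⟩
    have hadj {s t : Fin (m + 3)} (h : s ≠ t) : (A l).Adj (f s) (f t) :=
      f.map_adj ((SimpleGraph.top_adj _ _).mpr h)
    rcases h0 : f 0 with ⟨c, u⟩ | ⟨p, r⟩
    · have hpre (s) : ∃ v, f s = Sum.inl ⟨c, v⟩ := by
        by_cases hs : s = 0
        · exact ⟨u, hs ▸ h0⟩
        · rcases hadj (Ne.symm hs) with ⟨c', u', v', hx, hy, -⟩ | ⟨p, s, t, hx, -⟩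
          · cases h0.symm.trans hx
            exact ⟨v', hy⟩
          · cases h0.symm.trans hx
      choose x hx using hpre
      refine hcl c l ⟨⟨x, fun {a b} h => ?_⟩⟩
      have := f.map_adj h
      rw [hx a, hx b] at this
      exact (hAinl _ _ _ _).mp this
    · have hpre (s) : ∃ t, f s = Sum.inr (p, t) := by
        by_cases hs : s = 0
        · exact ⟨r, hs ▸ h0⟩
        · rcases hadj (Ne.symm hs) with ⟨c', u', v', hx, -⟩ | ⟨p, s, t, hx, hy, -⟩
          · cases h0.symm.trans hx
          · cases h0.symm.trans hx
            exact ⟨t, hy⟩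
      choose x hx using hpre
      have hx' (a b) (h : a ≠ b) : x a ≠ x b ∧ p.1 ≠ p.2 ∧ lab p (x a) (x b) = l := by
        have := hadj h
        rw [hx a, hx b] at this
        exact (hAinr _ _ _ _).mp this
      have hinj : Function.Injective x := fun a b hab => by
        by_contra h
        exact (hx' a b h).1 hab
      have hsurj := Finite.surjective_of_injective hinj
      obtain ⟨a, ha⟩ := hsurj 0
      obtain ⟨b, hb⟩ := hsurj 1
      obtain ⟨d, hd⟩ := hsurj (Fin.last _)
      have h2 : Fin.last (m + 2) ≠ 0 := by simp [Fin.ext_iff]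
      have h3 : (1 : Fin (m + 3)) ≠ Fin.last (m + 2) := by simp [Fin.ext_iff]
      have e1 := hx' a b fun h => by simp [← h, ha] at hb
      have e2 := hx' b d fun h => h3 (hb.symm.trans ((congrArg x h).trans hd))
      simp only [ha, hb, hd, lab, true_or, if_true, one_ne_zero, h2, or_self, if_false] at e1 e2
      exact e1.2.1 (e1.2.2.trans e2.2.2.symm)
  have : Nonempty (Fin q) := ⟨⟨0, hq⟩⟩
  obtain ⟨U, hU, B, hB, hBcl, hram⟩ := exists_labelled_ramsey A hA (Fin q)
  refine ⟨U, hU, B, hB, fun d h => hAcl d (hBcl _ _ (by omega) h), fun χ => ?_⟩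
  obtain ⟨φ, hφ, hadj, γ, hγ⟩ := hram χ
  by_cases hγi : Function.Injective γ
  · exact Or.inr ⟨φ ∘ Sum.inl, γ, hφ.comp Sum.inl_injective,
      fun c d u v => (hadj _ _ _).trans (hAinl _ _ _ _), hγi,
      fun c d u v h => hγ _ _ _ ((hAinl _ _ _ _).mpr h)⟩
  · obtain ⟨d, d', hdd, hne⟩ := Function.not_injective_iff.mp hγi
    refine Or.inl ⟨fun s => φ (Sum.inr ((d, d'), s)), γ d, fun s t hst => ?_⟩
    have h := (hAinr (lab (d, d') s t) (d, d') s t).mpr ⟨hst, hne, rfl⟩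
    refine ⟨SimpleGraph.iSup_adj.mpr ⟨_, (hadj _ _ _).mpr h⟩, ?_⟩
    rw [hγ _ _ _ h]
    by_cases h0 : s = 0 ∨ t = 0
    · simp [lab, h0]
    · simp [lab, h0, hdd]

theorem isRamsey_top {V : Type} {G : SimpleGraph V} {q n : ℕ}
    (h : ∀ χ : Sym2 V → Fin q, ∃ (f : Fin n → V) (i : Fin q), ∀ s t, s ≠ t →
      G.Adj (f s) (f t) ∧ χ s(f s, f t) = i) :
    IsRamsey q G (⊤ : SimpleGraph (Fin n)) := by
  intro χ
  obtain ⟨f, i, hf⟩ := h χ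
  refine ⟨i, ⟨f, fun s t hst => ?_⟩, fun s t hst => hf s t hst⟩
  by_contra hne
  exact (hf s t hne).1.ne hst

/-- There are edge-disjoint graphs whose union is `q`-Ramsey for a clique, but such that the cliques
of this order in each of the graphs are connected components of that graph. -/
theorem exists_isRamsey_top_isolated {q : ℕ} (hq : 3 ≤ q) (m : ℕ) :
    ∃ (V : Type) (_ : Finite V) (G : Fin q → SimpleGraph V),
      (∀ d d' u v, (G d).Adj u v → (G d').Adj u v → d = d') ∧
      IsRamsey q (⨆ d, G d) (⊤ : SimpleGraph (Fin (m + 3))) ∧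
      ∀ d (f : (⊤ : SimpleGraph (Fin (m + 3))) →g G d) s z, (G d).Adj (f s) z →
        z ∈ Set.range f := by
  classical
  have : Nonempty (Fin q) := ⟨⟨0, by omega⟩⟩
  let c₀ : Fin q := ⟨0, by omega⟩
  choose W hW D hD hcl hcl' hvert using
    exists_vertex_ramsey hq m (Fin (m + 3) → Fin q)
  obtain ⟨U, hU, B, hB, hBcl, hram⟩ := exists_mono_or_distinct m W D hD hcl (by omega)
  let I : Type := {φ : (Σ c, W c) → U // Function.Injective φ ∧
    ∀ c d u v, (B d).Adj (φ ⟨c, u⟩) (φ ⟨c, v⟩) ↔ (D c d).Adj u v}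
  let G (d : Fin q) : SimpleGraph (U ⊕ (I × Fin (m + 3))) :=
    { Adj := fun x y => match x, y with
        | Sum.inl u, Sum.inl v => (B d).Adj u v
        | Sum.inl u, Sum.inr p => d ≠ c₀ ∧ ∃ w, u = p.1.1 ⟨d, w⟩
        | Sum.inr p, Sum.inl u => d ≠ c₀ ∧ ∃ w, u = p.1.1 ⟨d, w⟩
        | Sum.inr p, Sum.inr r => d = c₀ ∧ p.1 = r.1 ∧ p.2 ≠ r.2
      symm := ⟨by
        rintro (u | p) (v | r) h
        · exact SimpleGraph.Adj.symm h
        · exact h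
        · exact h
        · exact ⟨h.1, h.2.1.symm, h.2.2.symm⟩⟩
      loopless := ⟨by
        rintro (u | p) h
        · exact SimpleGraph.Adj.ne h rfl
        · exact h.2.2 rfl⟩ }
  refine ⟨_, inferInstance, G, ?_, ?_, ?_⟩
  · rintro d d' (u | p) (v | r) h h'
    · exact hB _ _ _ _ h h'
    · obtain ⟨-, w, hw⟩ := h
      obtain ⟨-, w', hw'⟩ := h'
      exact congrArg Sigma.fst (r.1.2.1 (hw.symm.trans hw'))
    · obtain ⟨-, w, hw⟩ := h
      obtain ⟨-, w', hw'⟩ := h'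
      exact congrArg Sigma.fst (p.1.2.1 (hw.symm.trans hw'))
    · exact h.1.trans h'.1.symm
  · refine isRamsey_top fun χ => ?_
    rcases hram (fun e => χ (e.map Sum.inl)) with
      ⟨f, i, hf⟩ | ⟨φ, γ, hφ, hφadj, hγ, hφγ⟩
    · refine ⟨fun s => Sum.inl (f s), i, fun s t hst => ⟨?_, (hf s t hst).2⟩⟩
      obtain ⟨d, hd⟩ := SimpleGraph.iSup_adj.mp (hf s t hst).1
      exact SimpleGraph.iSup_adj.mpr ⟨d, hd⟩
    by_contra hno
    let R (i : Fin q) (x y : U ⊕ (I × Fin (m + 3))) : Prop :=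
      (⨆ d, G d).Adj x y ∧ χ s(x, y) = i
    have hR (i x y) (h : R i x y) : R i y x := ⟨h.1.symm, Sym2.eq_swap ▸ h.2⟩
    have hno' (i) (f : Fin (m + 3) → U ⊕ (I × Fin (m + 3))) : ¬∀ s t, s ≠ t → R i (f s) (f t) :=
      fun hf => hno ⟨f, i, hf⟩
    let x (i : Fin (m + 3)) : U ⊕ (I × Fin (m + 3)) := Sum.inr (⟨φ, hφ, hφadj⟩, i)
    have hxx (i j) (h : i ≠ j) : (⨆ d, G d).Adj (x i) (x j) :=
      SimpleGraph.iSup_adj.mpr ⟨c₀, rfl, rfl, h⟩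
    have hxW (i) (c) (hc : c ≠ c₀) (w : W c) : (⨆ d, G d).Adj (x i) (Sum.inl (φ ⟨c, w⟩)) :=
      SimpleGraph.iSup_adj.mpr ⟨c, hc, w, rfl⟩
    have hWW (c d u v) (h : (D c d).Adj u v) :
        R (γ d) (Sum.inl (φ ⟨c, u⟩)) (Sum.inl (φ ⟨c, v⟩)) :=
      ⟨SimpleGraph.iSup_adj.mpr ⟨d, (hφadj _ _ _ _).mpr h⟩, hφγ _ _ _ _ h⟩
    have hγs := Finite.surjective_of_injective hγ
    have hxcol (c) (hc : c ≠ c₀) (i j) (hij : i ≠ j) : χ s(x i, x j) ≠ γ c := by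
      intro hχ
      obtain ⟨g, ⟨b, hb⟩, hg, hg'⟩ := hvert c fun w i => χ s(x i, Sum.inl (φ ⟨c, w⟩))
      have hbi (i) : b i = γ c := by
        obtain ⟨d, hd⟩ := hγs (b i)
        by_contra hne
        have hdc : d ≠ c := fun h => hne (h ▸ hd.symm)
        exact hno' (b i) _ (cons_pairwise (hR _)
          (a := x i) (f := fun s => Sum.inl (φ ⟨c, g (d, s)⟩))
          (fun s => ⟨hxW i c hc _, congrFun (hb _) i⟩)
          (fun s t hst => hd ▸ hWW _ _ _ _ (hg d hdc s t hst)))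
      have hxg (i u) : R (γ c) (x i) (Sum.inl (φ ⟨c, g u⟩)) :=
        ⟨hxW i c hc _, (congrFun (hb _) i).trans (hbi i)⟩
      refine hno' (γ c) _ (cons_pairwise (hR _) (a := x i) (f := Fin.cons (x j)
        fun s : Fin (m + 1) => Sum.inl (φ ⟨c, g (c, s.succ)⟩)) (fun s => ?_)
        (cons_pairwise (hR _) (fun s => hxg j _) fun s t hst => hWW _ _ _ _ (hg' s t hst)))
      induction s using Fin.cases with
      | zero => exact ⟨hxx i j hij, hχ⟩
      | succ s => exact hxg i _
    refine hno' (γ c₀) x fun i j hij => ⟨hxx i j hij, ?_⟩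
    obtain ⟨d, hd⟩ := hγs (χ s(x i, x j))
    by_cases h : d = c₀
    · rw [← hd, h]
    · exact absurd hd.symm (hxcol d h i j hij)
  · intro d f s z hz
    have hadj {s t : Fin (m + 3)} (h : s ≠ t) : (G d).Adj (f s) (f t) :=
      f.map_adj ((SimpleGraph.top_adj _ _).mpr h)
    by_cases hall : ∀ s, ∃ u, f s = Sum.inl u
    · choose u hu using hall
      refine absurd ⟨⟨u, fun {a b} h => ?_⟩⟩ (hBcl d)
      have := f.map_adj h
      rw [hu a, hu b] at this
      exact this
    obtain ⟨s₀, hs₀⟩ := not_forall.mp hall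
    rcases h0 : f s₀ with u | p
    · exact absurd ⟨u, h0⟩ hs₀
    by_cases hd : d = c₀
    · have hpre (t) : ∃ r, f t = Sum.inr (p.1, r) := by
        by_cases ht : t = s₀
        · exact ⟨p.2, ht ▸ h0⟩
        have h := hadj (Ne.symm ht)
        rw [h0] at h
        rcases hft : f t with u | r
        · rw [hft] at h
          exact absurd hd h.1
        · rw [hft] at h
          exact ⟨r.2, by rw [h.2.1]⟩
      choose x hx using hpre
      have hinj : Function.Injective x := fun a b hab => by
        by_contra h
        exact (hadj h).ne (by rw [hx a, hx b, hab])
      rw [hx s] at hz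
      rcases z with u | r
      · exact absurd hd hz.1
      · obtain ⟨t, ht⟩ := Finite.surjective_of_injective hinj r.2
        exact ⟨t, by rw [hx t, ht, show p.1 = r.1 from hz.2.1]⟩
    · have hpre (t : Fin (m + 2)) : ∃ w, f (s₀.succAbove t) = Sum.inl (p.1.1 ⟨d, w⟩) := by
        have h := hadj (Fin.succAbove_ne s₀ t).symm
        rw [h0] at h
        rcases hft : f (s₀.succAbove t) with u | r
        · rw [hft] at h
          obtain ⟨-, w, hw⟩ := h
          exact ⟨w, by rw [hw]⟩
        · rw [hft] at h
          exact absurd h.1 hd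
      choose w hw using hpre
      refine absurd ⟨⟨w, fun {a b} h => ?_⟩⟩ (hcl' d)
      have := hadj (fun e => h.ne (Fin.succAbove_right_injective (p := s₀) e))
      rw [hw a, hw b] at this
      exact (p.1.2.2 _ _ _ _).mp this

/-- Every graph has a Ramsey graph with the same clique number. -/
theorem exists_isRamsey_clique_reflects {V : Type} [Finite V] (H : SimpleGraph V) {q : ℕ}
    (hq : 0 < q) :
    ∃ (W : Type) (_ : Finite W) (G : SimpleGraph W), IsRamsey q G H ∧
      ∀ n, 2 ≤ n → Nonempty ((⊤ : SimpleGraph (Fin n)) →g G) →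
        Nonempty ((⊤ : SimpleGraph (Fin n)) →g H) := by
  have : Nonempty (Fin q) := ⟨⟨0, hq⟩⟩
  obtain ⟨W, hW, B, -, hcl, hram⟩ :=
    exists_labelled_ramsey (fun _ : Unit => H) (fun _ _ _ _ _ _ => rfl) (Fin q)
  refine ⟨W, hW, B (), fun c => ?_, hcl ()⟩
  obtain ⟨f, hf, hadj, γ, hγ⟩ := hram c
  exact ⟨γ (), ⟨f, hf⟩, fun a b h => ⟨(hadj () a b).mpr h, hγ () a b h⟩⟩

/-- For `q ≥ 3` and `k ≥ 3`, any connected graph that is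
`q`-Ramsey-equivalent to `K_k` is isomorphic to `K_k`. -/
theorem stmt9 (q k : ℕ) (hq : 3 ≤ q) (hk : 3 ≤ k)
    {V : Type} [Fintype V] (H : SimpleGraph V) (hconn : H.Connected)
    (hequiv : RamseyEquiv q H (⊤ : SimpleGraph (Fin k))) :
    Nonempty (H ≃g (⊤ : SimpleGraph (Fin k))) := by
  classical
  obtain ⟨m, rfl⟩ : ∃ m, k = m + 3 := ⟨k - 3, by omega⟩
  obtain ⟨g⟩ : Nonempty ((⊤ : SimpleGraph (Fin (m + 3))) →g H) := by
    obtain ⟨W, hW, G, hG, hcl⟩ := exists_isRamsey_clique_reflects H (q := q) (by omega)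
    have := Fintype.ofFinite W
    obtain ⟨i, f, hf⟩ := (hequiv W G).mp hG fun _ => ⟨0, by omega⟩
    exact hcl _ (by omega) ⟨⟨f, fun {a b} h => (hf a b h).1⟩⟩
  have hgadj {s t : Fin (m + 3)} (h : s ≠ t) : H.Adj (g s) (g t) :=
    g.map_adj ((SimpleGraph.top_adj _ _).mpr h)
  have hginj : Function.Injective g := fun s t hst => by
    by_contra h
    exact (hgadj h).ne hst
  by_cases hsurj : Function.Surjective g
  · refine ⟨SimpleGraph.Iso.symm ⟨Equiv.ofBijective g ⟨hginj, hsurj⟩, fun {a b} => ?_⟩⟩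
    exact ⟨fun h e => h.ne (congrArg g e), fun h => hgadj h⟩
  obtain ⟨z, hz⟩ := not_forall.mp hsurj
  obtain ⟨p⟩ := hconn.preconnected (g 0) z
  obtain ⟨e, -, ⟨s, hs⟩, he⟩ := p.exists_boundary_dart (Set.range g) ⟨0, rfl⟩ hz
  obtain ⟨U, hU, G, hdisj, hG, hiso⟩ := exists_isRamsey_top_isolated hq m
  have := Fintype.ofFinite U
  let c (x : Sym2 U) : Fin q := if h : ∃ d, x ∈ (G d).edgeSet then h.choose else ⟨0, by omega⟩
  have hc {d u v} (h : (⨆ d, G d).Adj u v ∧ c s(u, v) = d) : (G d).Adj u v := by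
    have h' : ∃ d, s(u, v) ∈ (G d).edgeSet := SimpleGraph.iSup_adj.mp h.1
    rw [← h.2]
    simp only [c, dif_pos h']
    exact h'.choose_spec
  obtain ⟨d, f, hf⟩ := (hequiv U _).mpr hG c
  obtain ⟨t, ht⟩ := hiso d ⟨fun s => f (g s), fun {a b} h => hc (hf _ _ (g.map_adj h))⟩ s
    (f e.snd) (hc (hf _ _ (hs ▸ e.adj)))
  exact absurd ⟨t, f.injective ht⟩ he
end
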